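/- Let H : ℝⁿ × ℝⁿ → ℝ be C^∞, ℤⁿ-periodic in the first variable, with complete Hamiltonian flow (φ^H_t), and assume that on a neighborhood of {I = 0} one has φ^H_T(θ, I) = (θ + Ā I + R₁(θ,I), I + R₂(θ,I)), where Ā is a symmetric invertible n × n matrix and R₁ = O(I²), R₂ = O(I³) in the sense that all θ-derivatives and I-derivatives of order |β| < 2 (resp. |β| < 3) of R₁ (resp. R₂) are bounded by constants times ‖I‖^{2−|β|} (resp. ‖I‖^{3−|β|}). Let ω̄ ∈ ℝⁿ \ {0} be strongly Diophantine. Then there is m₁ ∈ ℕ such that for every m ≥ m₁ there exist C^∞ ℤⁿ-periodic maps u_m : ℝⁿ → ℝⁿ and v_m : ℝⁿ → ℝⁿ with, for every k ∈ ℕ, ‖u_m‖_{C^k} → 0 and m·‖v_m‖_{C^k} → 0 as m → ∞, such that the map j_m(η) = (η + u_m(η), Ā⁻¹(ω̄/m) + v_m(η)) satisfies: (i) φ^H_{mT}(j_m(η)) = j_m(η + ω̄) modulo the translations (x,p) ↦ (x+l, p), l ∈ ℤⁿ, for all η ∈ ℝⁿ; (ii) j_m induces a Lagrangian embedding of 𝕋ⁿ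 into T*𝕋ⁿ: for all η and all a, b ∈ ℝⁿ, ω₀(Dj_m(η)a, Dj_m(η)b) = 0, where ω₀((a,b),(a',b')) = ⟨b, a'⟩ − ⟨a, b'⟩ is the standard symplectic form. -/

import Mathlib

open MeasureTheory Filter
open scoped NNReal

noncomputable section

abbrev E (n : ℕ) : Type := Fin n → ℝ

/-- The vector of `ℝⁿ` whose coordinates are the integers `m i`. -/
def intVec {n : ℕ} (m : Fin n → ℤ) : E n := fun i => (m i : ℝ)

/-- A Tonelli Hamiltonian on `T*𝕋ⁿ`, identified with a `ℤⁿ`-periodic (in `x`) function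
on `ℝⁿ × ℝⁿ` which is `Cᵏ`, uniformly superlinear in `p` and with positive definite
fiberwise Hessian. -/
structure IsTonelliHamiltonian (n : ℕ) (k : ℕ∞) (H : E n × E n → ℝ) : Prop where
  smooth : ContDiff ℝ k H
  periodic : ∀ (x p : E n) (m : Fin n → ℤ), H (x + intVec m, p) = H (x, p)
  superlinear : ∀ C : ℝ, ∃ R : ℝ, ∀ (x p : E n), R ≤ ‖p‖ → C * ‖p‖ ≤ H (x, p)
  posdef : ∀ (x p w : E n), w ≠ 0 →
    0 < fderiv ℝ (fun p' => fderiv ℝ (fun p'' => H (x, p'')) p' w) p w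

/-- The gradient of `H` in the fiber direction, `∂H/∂p (x, p)`, as a vector of `ℝⁿ`. -/
def gradP (n : ℕ) (H : E n × E n → ℝ) (x p : E n) : E n :=
  fun i => fderiv ℝ (fun p' => H (x, p')) p (Pi.single i 1)

/-- The gradient of `H` in the base direction, `∂H/∂x (x, p)`, as a vector of `ℝⁿ`. -/
def gradX (n : ℕ) (H : E n × E n → ℝ) (x p : E n) : E n :=
  fun i => fderiv ℝ (fun x' => H (x', p)) x (Pi.single i 1)

/-- The Hamiltonian vector field `X_H (x, p) = (∂H/∂p, -∂H/∂x)`. -/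
def hamVF (n : ℕ) (H : E n × E n → ℝ) (z : E n × E n) : E n × E n :=
  (gradP n H z.1 z.2, -gradX n H z.1 z.2)

/-- `φ` is the complete Hamiltonian flow of `H` on `ℝⁿ × ℝⁿ`. -/
def IsHamFlow (n : ℕ) (H : E n × E n → ℝ) (φ : ℝ → E n × E n → E n × E n) : Prop :=
  (∀ z : E n × E n, φ 0 z = z) ∧
  ∀ (z : E n × E n) (t : ℝ), HasDerivAt (fun s => φ s z) (hamVF n H (φ t z)) t

/-- The flow `φ` has no conjugate points: for `t ≠ 0` the image of the vertical
subspace `{0} × ℝⁿ` under `Dφ_t(z)` meets `{0} × ℝⁿ` only in `0`. -/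
def NoConjugatePoints (n : ℕ) (φ : ℝ → E n × E n → E n × E n) : Prop :=
  ∀ (z : E n × E n) (t : ℝ), t ≠ 0 → ∀ w : E n,
    (fderiv ℝ (φ t) z (0, w)).1 = 0 → w = 0

/-- The gradient of a function `u : ℝⁿ → ℝ`, as a vector of `ℝⁿ`. -/
def gradF (n : ℕ) (u : E n → ℝ) (x : E n) : E n :=
  fun i => fderiv ℝ u x (Pi.single i 1)

/-- The euclidean pairing of two vectors of `ℝⁿ`. -/
def dotP (n : ℕ) (a b : E n) : ℝ := ∑ i, a i * b i

/-- The standard symplectic form `ω₀((a,b),(a',b')) = ⟨b, a'⟩ − ⟨a, b'⟩` on `ℝⁿ × ℝⁿ`. -/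
def omega0 (n : ℕ) (w w' : E n × E n) : ℝ := dotP n w.2 w'.1 - dotP n w.1 w'.2

/-- The Jacobian matrix of a map `ψ : ℝⁿ → ℝⁿ` at `x`. -/
def jacobian (n : ℕ) (ψ : E n → E n) (x : E n) : Matrix (Fin n) (Fin n) ℝ :=
  Matrix.of fun i j => fderiv ℝ (fun y => ψ y i) x (Pi.single j 1)

/-- `R = O(Iˢ)` near the zero section: on some neighborhood `{‖I‖ ≤ ε}` of `𝕋ⁿ × {0}`,
all mixed partial derivatives `∂_θ^a ∂_I^b R` with `b < s` are bounded by
`C_{a,b} ‖I‖^{s-b}`. -/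
def BigOI (n : ℕ) (s : ℕ) (R : E n × E n → E n) : Prop :=
  ∃ ε : ℝ, 0 < ε ∧ ∀ a b : ℕ, b < s → ∃ C : ℝ, ∀ θ I : E n, ‖I‖ ≤ ε →
    ‖iteratedFDeriv ℝ a (fun θ' => iteratedFDeriv ℝ b (fun I' => R (θ', I')) I) θ‖
      ≤ C * ‖I‖ ^ (s - b)

/-- A strongly Diophantine vector of `ℝⁿ`. -/
def StronglyDiophantine (n : ℕ) (ω : E n) : Prop :=
  ∃ γ : ℝ, 0 < γ ∧ ∃ τ : ℝ, ∀ k : Fin n → ℤ, k ≠ 0 → ∀ l : ℤ,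
    γ / ‖intVec k‖ ^ τ ≤ |dotP n (intVec k) ω + (l : ℝ)|

/-- The `Cᵏ` norm of a map `ℝⁿ → ℝⁿ` (the supremum of the norms of all its iterated
derivatives of order `≤ k`; a genuine supremum for periodic smooth maps). -/
noncomputable def CkNorm (n k : ℕ) (f : E n → E n) : ℝ :=
  ⨆ p : E n × Fin (k + 1), ‖iteratedFDeriv ℝ (p.2 : ℕ) f p.1‖

section FlowSmooth

open scoped ContDiff

/-- Pointwise application of a continuous family of operators to a continuous curve. -/
def applyCurve (K : Type*) [TopologicalSpace K] [CompactSpace K]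
    (X Y : Type*) [NormedAddCommGroup X] [NormedSpace ℝ X]
    [NormedAddCommGroup Y] [NormedSpace ℝ Y] :
    C(K, X →L[ℝ] Y) →L[ℝ] C(K, X) →L[ℝ] C(K, Y) :=
  LinearMap.mkContinuous₂
    (LinearMap.mk₂ ℝ (fun (A : C(K, X →L[ℝ] Y)) (ξ : C(K, X)) => (⟨fun t => A t (ξ t), by fun_prop⟩ : C(K, Y)))
      (fun _ _ _ => by ext; simp) (fun _ _ _ => by ext; simp)
      (fun _ _ _ => by ext; simp) (fun _ _ _ => by ext; simp)) 1 (by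
    intro A ξ
    rw [ContinuousMap.norm_le _ (by positivity)]
    intro t
    simp only [LinearMap.mk₂_apply, ContinuousMap.coe_mk, one_mul]
    exact (A t).le_of_opNorm_le_of_le (A.norm_coe_le_norm t) (ξ.norm_coe_le_norm t))

lemma applyCurve_apply {K : Type*} [TopologicalSpace K] [CompactSpace K]
    {X Y : Type*} [NormedAddCommGroup X] [NormedSpace ℝ X]
    [NormedAddCommGroup Y] [NormedSpace ℝ Y] (A : C(K, X →L[ℝ] Y)) (ξ : C(K, X)) (t : K) :
    applyCurve K X Y A ξ t = A t (ξ t) := rfl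

lemma hasFDerivAt_postcomp {K : Type*} [TopologicalSpace K] [CompactSpace K]
    {X Y : Type*} [NormedAddCommGroup X] [NormedSpace ℝ X]
    [NormedAddCommGroup Y] [NormedSpace ℝ Y] (f : C(X, Y)) (f' : C(X, X →L[ℝ] Y))
    (hf : ∀ x, HasFDerivAt f (f' x) x) (γ : C(K, X)) :
    HasFDerivAt (fun γ : C(K, X) => f.comp γ) (applyCurve K X Y (f'.comp γ)) γ := by
  rw [hasFDerivAt_iff_isLittleO_nhds_zero, Asymptotics.isLittleO_iff]
  intro c hc
  have hcomp : IsCompact (Set.range γ) := isCompact_range γ.continuous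
  have hU := hcomp.uniformContinuousAt_of_continuousAt f'
    (fun a _ => f'.continuous.continuousAt) (Metric.dist_mem_uniformity hc)
  obtain ⟨δ, hδ, hδ'⟩ := Metric.mem_uniformity_dist.1 hU
  filter_upwards [Metric.ball_mem_nhds (0 : C(K, X)) hδ] with ξ hξ
  rw [mem_ball_zero_iff] at hξ
  rw [ContinuousMap.norm_le _ (by positivity)]
  intro t
  have hξt : ‖ξ t‖ ≤ ‖ξ‖ := ξ.norm_coe_le_norm t
  have hball : ∀ x ∈ Metric.ball (γ t) δ, ‖f' x - f' (γ t)‖ ≤ c := by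
    intro x hx
    have := @hδ' (γ t) x (by rw [dist_comm]; exact hx) ⟨t, rfl⟩
    simp only [Set.mem_ofPred_eq] at this
    rw [dist_comm, dist_eq_norm] at this
    exact this.le
  have := (convex_ball (γ t) δ).norm_image_sub_le_of_norm_hasFDerivWithin_le'
    (f := f) (f' := f') (φ := f' (γ t)) (fun x _ => (hf x).hasFDerivWithinAt) hball
    (Metric.mem_ball_self hδ) (y := γ t + ξ t)
    (by rw [mem_ball_iff_norm]; simpa using hξt.trans_lt hξ)
  simp only [add_sub_cancel_left] at this
  simpa [applyCurve_apply] using this.trans (by gcongr)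

universe u in
lemma contDiff_postcomp {K : Type*} [TopologicalSpace K] [CompactSpace K]
    {X : Type u} [NormedAddCommGroup X] [NormedSpace ℝ X] (n : ℕ) :
    ∀ {Y : Type u} [NormedAddCommGroup Y] [NormedSpace ℝ Y] (f : C(X, Y)),
      ContDiff ℝ n f → ContDiff ℝ n (fun γ : C(K, X) => f.comp γ) := by
  induction n with
  | zero =>
    intro Y _ _ f _
    simp only [Nat.cast_zero, contDiff_zero]
    exact f.continuous_postcomp
  | succ n ih =>
    intro Y _ _ f hf
    push_cast at hf ⊢
    obtain ⟨f', hf', hd⟩ := (contDiff_succ_iff_hasFDerivAt).1 hf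
    rw [contDiff_succ_iff_hasFDerivAt]
    let g : C(X, X →L[ℝ] Y) := ⟨f', hf'.continuous⟩
    refine ⟨fun γ => applyCurve K X Y (g.comp γ), ?_, fun γ => hasFDerivAt_postcomp f g hd γ⟩
    exact (applyCurve K X Y).contDiff.comp (ih g hf')

/-- Integration from `0` as an operator on curves parametrised by the unit interval. -/
def integrateCurve (X : Type*) [NormedAddCommGroup X] [NormedSpace ℝ X] :
    C(unitInterval, X) →L[ℝ] C(unitInterval, X) :=
  LinearMap.mkContinuous
    { toFun := fun ξ => ⟨fun t => ∫ s in (0 : ℝ)..t, ξ (Set.projIcc 0 1 zero_le_one s), by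
        have h : Continuous fun t : ℝ => ∫ s in (0 : ℝ)..t, ξ (Set.projIcc 0 1 zero_le_one s) :=
          intervalIntegral.continuous_primitive (fun a b => Continuous.intervalIntegrable
            (ξ.continuous.comp continuous_projIcc) a b) 0
        exact h.comp continuous_subtype_val⟩
      map_add' := fun ξ ζ => by
        ext t
        simp only [ContinuousMap.add_apply, ContinuousMap.coe_mk]
        exact intervalIntegral.integral_add
          (Continuous.intervalIntegrable (ξ.continuous.comp continuous_projIcc) _ _)
          (Continuous.intervalIntegrable (ζ.continuous.comp continuous_projIcc) _ _)
      map_smul' := fun c ξ => by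
        ext t
        simp }
    1 (by
      intro ξ
      rw [ContinuousMap.norm_le _ (by positivity)]
      intro t
      have := intervalIntegral.norm_integral_le_of_norm_le_const (a := (0 : ℝ)) (b := t)
        (C := ‖ξ‖) (f := fun s => ξ (Set.projIcc 0 1 zero_le_one s))
        (fun s _ => ξ.norm_coe_le_norm _)
      refine this.trans ?_
      rw [sub_zero, abs_of_nonneg t.2.1, one_mul]
      exact mul_le_of_le_one_right (norm_nonneg _) t.2.2)

lemma integrateCurve_apply {X : Type*} [NormedAddCommGroup X] [NormedSpace ℝ X]
    (ξ : C(unitInterval, X)) (t : unitInterval) :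
    integrateCurve X ξ t = ∫ s in (0 : ℝ)..t, ξ (Set.projIcc 0 1 zero_le_one s) := rfl

lemma integrateCurve_norm_le (X : Type*) [NormedAddCommGroup X] [NormedSpace ℝ X] :
    ‖integrateCurve X‖ ≤ 1 :=
  LinearMap.mkContinuous_norm_le _ zero_le_one _

/-- A global flow of the vector field `f`. -/
def IsFlowOf {X : Type*} [NormedAddCommGroup X] [NormedSpace ℝ X] (f : X → X)
    (Φ : ℝ → X → X) : Prop :=
  (∀ z, Φ 0 z = z) ∧ ∀ z t, HasDerivAt (fun s => Φ s z) (f (Φ t z)) t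

variable {X : Type*} [NormedAddCommGroup X] [NormedSpace ℝ X]

lemma flow_unique {f : X → X} (hf : ContDiff ℝ 1 f) {γ₁ γ₂ : ℝ → X} {T : ℝ}
    (h₁c : ContinuousOn γ₁ (Set.Icc 0 T)) (h₂c : ContinuousOn γ₂ (Set.Icc 0 T))
    (h₁ : ∀ t ∈ Set.Ico 0 T, HasDerivWithinAt γ₁ (f (γ₁ t)) (Set.Ici t) t)
    (h₂ : ∀ t ∈ Set.Ico 0 T, HasDerivWithinAt γ₂ (f (γ₂ t)) (Set.Ici t) t)
    (h0 : γ₁ 0 = γ₂ 0) : Set.EqOn γ₁ γ₂ (Set.Icc 0 T) := by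
  have hloc : LocallyLipschitz f := hf.locallyLipschitz
  set s := γ₁ '' Set.Icc 0 T ∪ γ₂ '' Set.Icc 0 T
  have hs : IsCompact s := (isCompact_Icc.image_of_continuousOn h₁c).union
    (isCompact_Icc.image_of_continuousOn h₂c)
  obtain ⟨K, hK⟩ := hloc.locallyLipschitzOn.exists_lipschitzOnWith_of_compact hs
  exact ODE_solution_unique_of_mem_Icc_right (v := fun _ => f) (s := fun _ => s) (K := K)
    (fun t _ => hK) h₁c h₁ (fun t ht => Or.inl ⟨t, Set.Ico_subset_Icc_self ht, rfl⟩)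
    h₂c h₂ (fun t ht => Or.inr ⟨t, Set.Ico_subset_Icc_self ht, rfl⟩) h0

lemma IsFlowOf.continuous {f : X → X} {Φ : ℝ → X → X} (h : IsFlowOf f Φ) (z : X) :
    Continuous fun t => Φ t z :=
  continuous_iff_continuousAt.2 fun t => (h.2 z t).continuousAt

lemma IsFlowOf.eq_of_nonneg {f : X → X} (hf : ContDiff ℝ 1 f) {Φ : ℝ → X → X}
    (h : IsFlowOf f Φ) {γ : ℝ → X} (hγ : ∀ t, HasDerivAt γ (f (γ t)) t) {t : ℝ} (ht : 0 ≤ t) :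
    γ t = Φ t (γ 0) :=
  flow_unique hf (fun s _ => (hγ s).continuousAt.continuousWithinAt)
    (h.continuous _).continuousOn (fun s _ => (hγ s).hasDerivWithinAt)
    (fun s _ => (h.2 _ s).hasDerivWithinAt) (h.1 _).symm ⟨ht, le_rfl⟩

lemma IsFlowOf.add {f : X → X} (hf : ContDiff ℝ 1 f) {Φ : ℝ → X → X}
    (h : IsFlowOf f Φ) (s : ℝ) {t : ℝ} (ht : 0 ≤ t) (z : X) : Φ (t + s) z = Φ t (Φ s z) := by
  have := h.eq_of_nonneg hf (γ := fun t => Φ (t + s) z)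
    (fun t => by simpa using (h.2 z (t + s)).comp_add_const t s) ht
  simpa using this

end FlowSmooth

section FlowSmooth

open scoped ContDiff

variable {X : Type*} [NormedAddCommGroup X] [NormedSpace ℝ X]

/-- The operator `γ ↦ γ - ε ∫ f ∘ γ` whose level sets consist of solutions of `γ' = ε f γ`. -/
def picardDefect (f : C(X, X)) (ε : ℝ) (γ : C(unitInterval, X)) : C(unitInterval, X) :=
  γ - ε • integrateCurve X (f.comp γ)

lemma IsFlowOf.contDiffAt_of_small [CompleteSpace X] {f : X → X} (hf : ContDiff ℝ ∞ f)
    {Φ : ℝ → X → X} (h : IsFlowOf f Φ) {ε C : ℝ} (hε : 0 ≤ ε) (z₀ : X)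
    (hC : ∀ t ∈ Set.Icc 0 ε, ‖fderiv ℝ f (Φ t z₀)‖ ≤ C) (hεC : ε * C < 1) :
    ContDiffAt ℝ ∞ (Φ ε) z₀ := by
  have hC0 : 0 ≤ C := (norm_nonneg _).trans (hC 0 ⟨le_rfl, hε⟩)
  have hf1 : ContDiff ℝ 1 f := hf.of_le (by simp)
  let fc : C(X, X) := ⟨f, hf.continuous⟩
  let fc' : C(X, X →L[ℝ] X) := ⟨fderiv ℝ f, hf.continuous_fderiv (by simp)⟩
  let γ₀ : C(unitInterval, X) := ⟨fun t => Φ (ε * t) z₀, by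
    have := h.continuous z₀
    fun_prop⟩
  set V : C(unitInterval, X) →L[ℝ] C(unitInterval, X) :=
    ε • (integrateCurve X ∘L applyCurve unitInterval X X (fc'.comp γ₀)) with hV
  have hVnorm : ‖V‖ < 1 := by
    refine lt_of_le_of_lt (ContinuousLinearMap.opNorm_le_bound _ (by positivity) fun ξ => ?_) hεC
    have h1 : ‖applyCurve unitInterval X X (fc'.comp γ₀) ξ‖ ≤ C * ‖ξ‖ := by
      rw [ContinuousMap.norm_le _ (by positivity)]
      intro t
      rw [applyCurve_apply]
      refine ContinuousLinearMap.le_of_opNorm_le_of_le _ (hC _ ⟨?_, ?_⟩) (ξ.norm_coe_le_norm t)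
      · exact mul_nonneg hε t.2.1
      · exact mul_le_of_le_one_right hε t.2.2
    have h2 : ‖integrateCurve X (applyCurve unitInterval X X (fc'.comp γ₀) ξ)‖ ≤ C * ‖ξ‖ := by
      refine ((integrateCurve X).le_of_opNorm_le (integrateCurve_norm_le X) _).trans ?_
      rwa [one_mul]
    have h3 : V ξ = ε • integrateCurve X (applyCurve unitInterval X X (fc'.comp γ₀) ξ) := rfl
    rw [h3, norm_smul, Real.norm_of_nonneg hε, mul_assoc]
    gcongr
  have hG' : HasFDerivAt (picardDefect fc ε) (1 - V) γ₀ := by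
    have h1 := hasFDerivAt_postcomp (K := unitInterval) fc fc'
      (fun x => (hf1.differentiable (by simp) x).hasFDerivAt) γ₀
    have h2 := ((integrateCurve X).hasFDerivAt.comp γ₀ h1).const_smul ε
    exact (hasFDerivAt_id γ₀).sub h2
  have hGn : ContDiff ℝ ∞ (picardDefect fc ε) := by
    rw [contDiff_infty]
    intro n
    have h1 := contDiff_postcomp (K := unitInterval) n fc (hf.of_le (by exact_mod_cast le_top))
    exact contDiff_id.sub (((integrateCurve X).contDiff.comp h1).const_smul ε)
  let e : C(unitInterval, X) ≃L[ℝ] C(unitInterval, X) :=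
    ContinuousLinearEquiv.ofUnit (Units.oneSub V hVnorm)
  have he : HasFDerivAt (picardDefect fc ε) (e : _ →L[ℝ] _) γ₀ := by
    exact hG'
  have hstrict : HasStrictFDerivAt (picardDefect fc ε) (e : _ →L[ℝ] _) γ₀ :=
    hGn.contDiffAt.hasStrictFDerivAt' he (by simp)
  let ψ := hstrict.localInverse
  have hval : picardDefect fc ε γ₀ = ContinuousMap.const _ z₀ := by
    ext t
    have h1 : ∀ s ∈ Set.uIcc (0 : ℝ) t,
        HasDerivAt (fun s => Φ (ε * s) z₀) (ε • f (Φ (ε * s) z₀)) s := by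
      intro s _
      have := (h.2 z₀ (ε * s)).scomp s ((hasDerivAt_id s).const_mul ε)
      simpa [Function.comp_def] using this
    have h2 : ∫ s in (0 : ℝ)..t, ε • f (Φ (ε * s) z₀) = Φ (ε * t) z₀ - z₀ := by
      rw [intervalIntegral.integral_eq_sub_of_hasDerivAt h1]
      · simp [h.1]
      · refine Continuous.intervalIntegrable ?_ _ _
        have := (h.continuous z₀).comp (continuous_const_mul ε)
        exact (hf.continuous.comp this).const_smul ε
    have h3 : ∫ s in (0 : ℝ)..t, fc (γ₀ (Set.projIcc 0 1 zero_le_one s)) =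
        ∫ s in (0 : ℝ)..t, f (Φ (ε * s) z₀) := by
      refine intervalIntegral.integral_congr fun s hs => ?_
      rw [Set.uIcc_of_le t.2.1] at hs
      have : (Set.projIcc (0 : ℝ) 1 zero_le_one s : ℝ) = s := by
        rw [Set.projIcc_of_mem zero_le_one ⟨hs.1, hs.2.trans t.2.2⟩]
      simp [fc, γ₀, this]
    simp only [picardDefect, ContinuousMap.sub_apply, ContinuousMap.smul_apply,
      integrateCurve_apply, ContinuousMap.comp_apply, ContinuousMap.const_apply]
    rw [h3, ← intervalIntegral.integral_smul, h2]
    simp [γ₀]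
  have hψ : ContDiffAt ℝ ∞ ψ (picardDefect fc ε γ₀) := hGn.contDiffAt.to_localInverse he (by simp)
  let K : X →L[ℝ] C(unitInterval, X) := LinearMap.mkContinuous
    { toFun := fun z => ContinuousMap.const _ z
      map_add' := fun _ _ => rfl
      map_smul' := fun _ _ => rfl } 1 (fun z => by
        rw [ContinuousMap.norm_le _ (by positivity)]
        intro t
        rw [one_mul]
        exact le_rfl)
  have hK : ∀ z, K z = ContinuousMap.const _ z := fun _ => rfl
  rw [hval, ← hK] at hψ
  have hmain : ContDiffAt ℝ ∞ (fun z => ContinuousMap.evalCLM ℝ (1 : unitInterval) (ψ (K z))) z₀ := by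
    have h1 : ContDiffAt ℝ ∞ (fun z => ψ (K z)) z₀ := hψ.comp z₀ K.contDiff.contDiffAt
    exact (ContinuousMap.evalCLM (M := X) ℝ (1 : unitInterval)).contDiff.contDiffAt.comp z₀ h1
  refine hmain.congr_of_eventuallyEq ?_
  have hright : ∀ᶠ y in nhds (K z₀), picardDefect fc ε (ψ y) = y := by
    have := hstrict.eventually_right_inverse
    rwa [hval, ← hK] at this
  filter_upwards [K.continuous.continuousAt.eventually hright] with z hz
  set γ := ψ (K z)
  have hγ : ∀ t : unitInterval,
      γ t = z + ε • ∫ s in (0 : ℝ)..t, f (γ (Set.projIcc 0 1 zero_le_one s)) := by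
    intro t
    have := congrArg (fun ξ : C(unitInterval, X) => ξ t) hz
    simp only [picardDefect, ContinuousMap.sub_apply, ContinuousMap.smul_apply,
      integrateCurve_apply, ContinuousMap.comp_apply, hK, ContinuousMap.const_apply] at this
    rw [sub_eq_iff_eq_add] at this
    exact this
  have hcont : Continuous fun s => γ (Set.projIcc (0 : ℝ) 1 zero_le_one s) :=
    γ.continuous.comp continuous_projIcc
  have hcontf : Continuous fun s => f (γ (Set.projIcc (0 : ℝ) 1 zero_le_one s)) :=
    hf.continuous.comp hcont
  have heq : Set.EqOn (fun s => γ (Set.projIcc (0 : ℝ) 1 zero_le_one s))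
      (fun s => Φ (ε * s) z) (Set.Icc 0 1) := by
    refine flow_unique (f := fun x => ε • f x) (hf1.const_smul ε) hcont.continuousOn
      ((h.continuous z).comp (continuous_const_mul ε)).continuousOn ?_ ?_ ?_
    · intro t ht
      have h1 : HasDerivAt (fun t => z + ε • ∫ s in (0 : ℝ)..t,
          f (γ (Set.projIcc 0 1 zero_le_one s)))
          (ε • f (γ (Set.projIcc 0 1 zero_le_one t))) t :=
        ((intervalIntegral.integral_hasDerivAt_right (hcontf.intervalIntegrable _ _)
          (hcontf.stronglyMeasurableAtFilter _ _) hcontf.continuousAt).const_smul ε).const_add z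
      refine h1.hasDerivWithinAt.congr_of_eventuallyEq_of_mem ?_ Set.self_mem_Ici
      filter_upwards [Ico_mem_nhdsGE ht.2] with s hs
      rw [hγ, Set.projIcc_of_mem zero_le_one ⟨ht.1.trans hs.1, hs.2.le⟩]
    · intro t _
      have := (h.2 z (ε * t)).scomp t ((hasDerivAt_id t).const_mul ε)
      simpa [Function.comp_def] using this.hasDerivWithinAt
    · simp only [mul_zero, h.1]
      rw [hγ]
      simp
  have h1 := heq ⟨zero_le_one, le_rfl⟩
  simp only [mul_one] at h1
  rw [← h1]
  simp [ContinuousMap.evalCLM_apply]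

lemma IsFlowOf.contDiff_of_nonneg [CompleteSpace X] {f : X → X} (hf : ContDiff ℝ ∞ f)
    {Φ : ℝ → X → X} (h : IsFlowOf f Φ) {T : ℝ} (hT : 0 ≤ T) : ContDiff ℝ ∞ (Φ T) := by
  have hf1 : ContDiff ℝ 1 f := hf.of_le (by simp)
  rw [contDiff_iff_contDiffAt]
  intro z
  have hcont : ContinuousOn (fun t => ‖fderiv ℝ f (Φ t z)‖) (Set.Icc 0 T) :=
    ((hf.continuous_fderiv (by simp)).comp (h.continuous z)).norm.continuousOn
  obtain ⟨C, hC⟩ := isCompact_Icc.bddAbove_image hcont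
  have hC' : ∀ t ∈ Set.Icc 0 T, ‖fderiv ℝ f (Φ t z)‖ ≤ C := fun t ht => hC ⟨t, ht, rfl⟩
  obtain ⟨N, hN⟩ := exists_nat_gt (T * C)
  have hTC : 0 ≤ T * C :=
    mul_nonneg hT ((norm_nonneg _).trans (hC' 0 ⟨le_rfl, hT⟩))
  have hNpos : (0 : ℝ) < N := hTC.trans_lt hN
  set ε := T / N
  have hε : 0 ≤ ε := by positivity
  have key : ∀ k : ℕ, k ≤ N → ContDiffAt ℝ ∞ (Φ (k * ε)) z := by
    intro k
    induction k with
    | zero =>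
      intro _
      have : Φ (((0 : ℕ) : ℝ) * ε) = id := by
        ext z
        simp [h.1]
      rw [this]
      exact contDiffAt_id
    | succ k ih =>
      intro hk
      have hcast : ((k + 1 : ℕ) : ℝ) * ε = ε + k * ε := by push_cast; ring
      have hfun : Φ (((k + 1 : ℕ) : ℝ) * ε) = Φ ε ∘ Φ (k * ε) := by
        ext w
        rw [hcast, h.add hf1 _ hε]
        rfl
      rw [hfun]
      refine ContDiffAt.comp z ?_ (ih (by omega))
      refine h.contDiffAt_of_small hf (C := C) hε _ ?_ ?_
      · intro t ht
        rw [← h.add hf1 _ ht.1]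
        refine hC' _ ⟨by have := ht.1; positivity, ?_⟩
        have h2 : (t : ℝ) + k * ε ≤ ε + k * ε := by linarith [ht.2]
        refine h2.trans ?_
        have h3 : ε + k * ε ≤ N * ε := by
          rw [← hcast]
          have : ((k + 1 : ℕ) : ℝ) ≤ N := by exact_mod_cast hk
          gcongr
        refine h3.trans (le_of_eq ?_)
        simp only [ε]
        field_simp
      · simp only [ε]
        rw [div_mul_eq_mul_div, div_lt_one hNpos]
        exact hN
  have := key N le_rfl
  have hNε : (N : ℝ) * ε = T := by simp only [ε]; field_simp
  rwa [hNε] at this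

/-- Joint smoothness of a flow in time and initial condition. -/
lemma IsFlowOf.contDiff_uncurry [CompleteSpace X] {f : X → X} (hf : ContDiff ℝ ∞ f)
    {Φ : ℝ → X → X} (h : IsFlowOf f Φ) : ContDiff ℝ ∞ fun q : ℝ × X => Φ q.1 q.2 := by
  let g : ℝ × X → ℝ × X := fun q => (0, q.1 • f q.2)
  have hg : ContDiff ℝ ∞ g := contDiff_const.prodMk (contDiff_fst.smul (hf.comp contDiff_snd))
  have hflow : IsFlowOf g (fun t q => (q.1, Φ (q.1 * t) q.2)) := by
    refine ⟨fun q => by simp [h.1], fun q t => ?_⟩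
    refine HasDerivAt.prodMk (hasDerivAt_const _ _) ?_
    have := (h.2 q.2 (q.1 * t)).scomp t ((hasDerivAt_id t).const_mul q.1)
    simpa [Function.comp_def] using this
  have := contDiff_snd.comp (hflow.contDiff_of_nonneg hg zero_le_one)
  simpa [Function.comp_def] using this

/-- The variational equation along a flow. -/
lemma IsFlowOf.hasDerivAt_fderiv [CompleteSpace X] {f : X → X} (hf : ContDiff ℝ ∞ f)
    {Φ : ℝ → X → X} (h : IsFlowOf f Φ) (z v : X) (t : ℝ) :
    HasDerivAt (fun s => fderiv ℝ (Φ s) z v)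
      (fderiv ℝ f (Φ t z) (fderiv ℝ (Φ t) z v)) t := by
  set Θ : ℝ × X → X := fun q => Φ q.1 q.2 with hΘ
  have hs : ContDiff ℝ ∞ Θ := h.contDiff_uncurry hf
  have hd : Differentiable ℝ Θ := hs.differentiable (by simp)
  have h1 : ∀ s w, fderiv ℝ (Φ s) w v = fderiv ℝ Θ (s, w) (0, v) := by
    intro s w
    have : HasFDerivAt (Φ s) ((fderiv ℝ Θ (s, w)).comp (ContinuousLinearMap.inr ℝ ℝ X)) w :=
      (hd (s, w)).hasFDerivAt.comp w (hasFDerivAt_prodMk_right s w)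
    rw [this.fderiv]
    rfl
  have h2 : ∀ s w, fderiv ℝ Θ (s, w) (1, 0) = f (Φ s w) := by
    intro s w
    have : HasFDerivAt (fun s => Φ s w)
        ((fderiv ℝ Θ (s, w)).comp (ContinuousLinearMap.inl ℝ ℝ X)) s :=
      HasFDerivAt.comp (g := Θ) (f := fun s => (s, w)) s (hd (s, w)).hasFDerivAt
        (hasFDerivAt_prodMk_left s w)
    have h3 := this.hasDerivAt.unique (h.2 w s)
    simpa using h3
  have hdd : Differentiable ℝ (fderiv ℝ Θ) :=
    (hs.fderiv_right (m := ∞) (by simp)).differentiable (by simp)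
  have hsymm : fderiv ℝ (fderiv ℝ Θ) (t, z) (1, 0) (0, v) =
      fderiv ℝ (fderiv ℝ Θ) (t, z) (0, v) (1, 0) :=
    second_derivative_symmetric (f := Θ) (fun y => (hd y).hasFDerivAt) (hdd (t, z)).hasFDerivAt _ _
  have h4 : HasDerivAt (fun s => fderiv ℝ Θ (s, z) (0, v))
      (fderiv ℝ (fderiv ℝ Θ) (t, z) (1, 0) (0, v)) t := by
    have hA := (hdd (t, z)).hasFDerivAt.comp_hasDerivAt t
      ((hasDerivAt_id t).prodMk (hasDerivAt_const t z))
    exact ((ContinuousLinearMap.apply ℝ X ((0 : ℝ), v)).hasFDerivAt.comp_hasDerivAt t hA)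
  have h5 : fderiv ℝ (fderiv ℝ Θ) (t, z) (0, v) (1, 0) =
      fderiv ℝ f (Φ t z) (fderiv ℝ (Φ t) z v) := by
    have hA : HasFDerivAt (fun w => fderiv ℝ Θ (t, w) (1, 0))
        ((ContinuousLinearMap.apply ℝ X ((1 : ℝ), (0 : X))).comp
          ((fderiv ℝ (fderiv ℝ Θ) (t, z)).comp (ContinuousLinearMap.inr ℝ ℝ X))) z := by
      have h0 : HasFDerivAt (fun w => fderiv ℝ Θ (t, w))
          ((fderiv ℝ (fderiv ℝ Θ) (t, z)).comp (ContinuousLinearMap.inr ℝ ℝ X)) z :=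
        (hdd (t, z)).hasFDerivAt.comp z (hasFDerivAt_prodMk_right t z)
      exact (ContinuousLinearMap.apply ℝ X ((1 : ℝ), (0 : X))).hasFDerivAt.comp z h0
    have hΦt : DifferentiableAt ℝ (Φ t) z :=
      (hd (t, z)).comp z (hasFDerivAt_prodMk_right t z).differentiableAt
    have hB : HasFDerivAt (fun w => f (Φ t w)) ((fderiv ℝ f (Φ t z)).comp (fderiv ℝ (Φ t) z)) z :=
      (hf.differentiable (by simp) _).hasFDerivAt.comp z hΦt.hasFDerivAt
    simp only [h2] at hA
    have := congrArg (fun L : X →L[ℝ] X => L v) (hA.unique hB)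
    simpa using this
  simp only [h1 _ z] at h5 ⊢
  rw [← h5, ← hsymm]
  exact h4

end FlowSmooth

section Action

open scoped ContDiff

lemma IsFlowOf.add_period {X : Type*} [NormedAddCommGroup X] [NormedSpace ℝ X] {f : X → X}
    (hf : ContDiff ℝ 1 f) {Φ : ℝ → X → X} (h : IsFlowOf f Φ) {a : X}
    (ha : ∀ y, f (y + a) = f y) {t : ℝ} (ht : 0 ≤ t) (y : X) : Φ t (y + a) = Φ t y + a := by
  have := h.eq_of_nonneg hf (γ := fun t => Φ t y + a)
    (fun t => by simpa [ha] using (h.2 y t).add_const a) ht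
  simpa [h.1] using this.symm

variable {n : ℕ}

/-- The euclidean pairing as a continuous bilinear map. -/
def dotL (n : ℕ) : E n →L[ℝ] E n →L[ℝ] ℝ :=
  ∑ i, (ContinuousLinearMap.mul ℝ ℝ).bilinearComp
    (ContinuousLinearMap.proj (R := ℝ) (φ := fun _ : Fin n => ℝ) i)
    (ContinuousLinearMap.proj (R := ℝ) (φ := fun _ : Fin n => ℝ) i)

lemma dotL_apply (a b : E n) : dotL n a b = dotP n a b := by
  simp [dotL, dotP]

lemma gradP_eq {H : E n × E n → ℝ} (hH : Differentiable ℝ H) (z : E n × E n) (i : Fin n) :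
    gradP n H z.1 z.2 i = fderiv ℝ H z (0, Pi.single i 1) := by
  have : HasFDerivAt (fun p' => H (z.1, p'))
      ((fderiv ℝ H z).comp (ContinuousLinearMap.inr ℝ (E n) (E n))) z.2 :=
    HasFDerivAt.comp (g := H) (f := fun p => (z.1, p)) z.2 (hH (z.1, z.2)).hasFDerivAt
      (hasFDerivAt_prodMk_right z.1 z.2)
  rw [gradP, this.fderiv]
  rfl

lemma gradX_eq {H : E n × E n → ℝ} (hH : Differentiable ℝ H) (z : E n × E n) (i : Fin n) :
    gradX n H z.1 z.2 i = fderiv ℝ H z (Pi.single i 1, 0) := by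
  have : HasFDerivAt (fun x' => H (x', z.2))
      ((fderiv ℝ H z).comp (ContinuousLinearMap.inl ℝ (E n) (E n))) z.1 :=
    HasFDerivAt.comp (g := H) (f := fun x => (x, z.2)) z.1 (hH (z.1, z.2)).hasFDerivAt
      (hasFDerivAt_prodMk_left z.1 z.2)
  rw [gradX, this.fderiv]
  rfl

lemma sum_single_smul (w : E n) : ∑ i, w i • (Pi.single i (1 : ℝ) : E n) = w := by
  ext j
  simp [Finset.sum_apply, Pi.single_apply]

lemma dotP_apply_single (L : E n →L[ℝ] ℝ) (w : E n) :
    dotP n (fun i => L (Pi.single i 1)) w = L w := by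
  conv_rhs => rw [← sum_single_smul w]
  simp [dotP, mul_comm]

lemma dotP_comm (a b : E n) : dotP n a b = dotP n b a := by
  simp [dotP, mul_comm]

lemma dotP_gradP {H : E n × E n → ℝ} (hH : Differentiable ℝ H) (z : E n × E n) (w : E n) :
    dotP n (gradP n H z.1 z.2) w = fderiv ℝ H z (0, w) := by
  have := dotP_apply_single ((fderiv ℝ H z).comp (ContinuousLinearMap.inr ℝ (E n) (E n))) w
  simp only [ContinuousLinearMap.comp_apply, ContinuousLinearMap.inr_apply] at this
  rw [← this]
  congr 1
  ext i
  exact gradP_eq hH z i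

lemma dotP_gradX {H : E n × E n → ℝ} (hH : Differentiable ℝ H) (z : E n × E n) (w : E n) :
    dotP n (gradX n H z.1 z.2) w = fderiv ℝ H z (w, 0) := by
  have := dotP_apply_single ((fderiv ℝ H z).comp (ContinuousLinearMap.inl ℝ (E n) (E n))) w
  simp only [ContinuousLinearMap.comp_apply, ContinuousLinearMap.inl_apply] at this
  rw [← this]
  congr 1
  ext i
  exact gradX_eq hH z i

lemma contDiff_gradP {H : E n × E n → ℝ} (hH : ContDiff ℝ ∞ H) :
    ContDiff ℝ ∞ fun z : E n × E n => gradP n H z.1 z.2 := by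
  rw [contDiff_pi]
  intro i
  simp only [gradP_eq (hH.differentiable (by simp))]
  exact (hH.fderiv_right (m := ∞) (by simp)).clm_apply contDiff_const

lemma contDiff_gradX {H : E n × E n → ℝ} (hH : ContDiff ℝ ∞ H) :
    ContDiff ℝ ∞ fun z : E n × E n => gradX n H z.1 z.2 := by
  rw [contDiff_pi]
  intro i
  simp only [gradX_eq (hH.differentiable (by simp))]
  exact (hH.fderiv_right (m := ∞) (by simp)).clm_apply contDiff_const

lemma contDiff_hamVF {H : E n × E n → ℝ} (hH : ContDiff ℝ ∞ H) :
    ContDiff ℝ ∞ (hamVF n H) :=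
  (contDiff_gradP hH).prodMk (contDiff_gradX hH).neg

lemma contDiff_dotP {X : Type*} [NormedAddCommGroup X] [NormedSpace ℝ X] {f g : X → E n}
    (hf : ContDiff ℝ ∞ f) (hg : ContDiff ℝ ∞ g) : ContDiff ℝ ∞ fun x => dotP n (f x) (g x) := by
  simp only [← dotL_apply]
  exact ((dotL n).contDiff.comp hf).clm_apply hg

lemma hasDerivAt_dotP {f g : ℝ → E n} {f' g' : E n} {t : ℝ} (hf : HasDerivAt f f' t)
    (hg : HasDerivAt g g' t) :
    HasDerivAt (fun t => dotP n (f t) (g t)) (dotP n f' (g t) + dotP n (f t) g') t := by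
  have h1 : HasDerivAt (fun t => dotL n (f t)) (dotL n f') t :=
    (dotL n).hasFDerivAt.comp_hasDerivAt t hf
  simpa only [← dotL_apply] using h1.clm_apply hg

lemma dotP_neg_left (a b : E n) : dotP n (-a) b = -dotP n a b := by
  simp [dotP]

lemma hper_pair {H : E n × E n → ℝ}
    (hHper : ∀ (x p : E n) (m : Fin n → ℤ), H (x + intVec m, p) = H (x, p)) (z : E n × E n)
    (l : Fin n → ℤ) : H (z + (intVec l, 0)) = H z := by
  have h1 : z + (intVec l, 0) = (z.1 + intVec l, z.2) := by ext <;> simp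
  rw [h1, hHper]

lemma hasDerivAt_prod_fst {X Y : Type*} [NormedAddCommGroup X] [NormedSpace ℝ X]
    [NormedAddCommGroup Y] [NormedSpace ℝ Y] {f : ℝ → X × Y} {f' : X × Y} {t : ℝ}
    (hf : HasDerivAt f f' t) : HasDerivAt (fun t => (f t).1) f'.1 t :=
  (ContinuousLinearMap.fst ℝ X Y).hasFDerivAt.comp_hasDerivAt t hf

lemma hasDerivAt_prod_snd {X Y : Type*} [NormedAddCommGroup X] [NormedSpace ℝ X]
    [NormedAddCommGroup Y] [NormedSpace ℝ Y] {f : ℝ → X × Y} {f' : X × Y} {t : ℝ}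
    (hf : HasDerivAt f f' t) : HasDerivAt (fun t => (f t).2) f'.2 t :=
  (ContinuousLinearMap.snd ℝ X Y).hasFDerivAt.comp_hasDerivAt t hf

/-- The Lagrangian `p · ∂H/∂p - H` expressed in Hamiltonian coordinates. -/
def hamLagrangian (n : ℕ) (H : E n × E n → ℝ) (z : E n × E n) : ℝ :=
  dotP n z.2 (gradP n H z.1 z.2) - H z

lemma contDiff_hamLagrangian {H : E n × E n → ℝ} (hH : ContDiff ℝ ∞ H) :
    ContDiff ℝ ∞ (hamLagrangian n H) :=
  (contDiff_dotP contDiff_snd (contDiff_gradP hH)).sub hH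

lemma fderiv_hamLagrangian {H : E n × E n → ℝ} (hH : ContDiff ℝ ∞ H) (z w : E n × E n) :
    fderiv ℝ (hamLagrangian n H) z w =
      dotP n z.2 (fderiv ℝ (fun z : E n × E n => gradP n H z.1 z.2) z w) -
        dotP n (gradX n H z.1 z.2) w.1 := by
  have hd : Differentiable ℝ H := hH.differentiable (by simp)
  have hg := (contDiff_gradP hH).differentiable (by simp) z
  have h1 : HasFDerivAt (fun z : E n × E n => dotL n z.2 (gradP n H z.1 z.2) - H z) _ z :=
    ((((dotL n).hasFDerivAt (x := z.2)).comp z hasFDerivAt_snd).clm_apply hg.hasFDerivAt).sub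
      (hd z).hasFDerivAt
  have h2 : hamLagrangian n H = fun z : E n × E n => dotL n z.2 (gradP n H z.1 z.2) - H z := by
    ext z
    rw [hamLagrangian, dotL_apply]
  rw [h2, h1.fderiv]
  have h3 : fderiv ℝ H z w = fderiv ℝ H z (w.1, 0) + fderiv ℝ H z (0, w.2) := by
    rw [← map_add]
    simp
  simp [dotL_apply, h3, ← dotP_gradX hd, ← dotP_gradP hd, dotP_comm w.2]

lemma IsHamFlow.isFlowOf {H : E n × E n → ℝ} {φ : ℝ → E n × E n → E n × E n}
    (h : IsHamFlow n H φ) : IsFlowOf (hamVF n H) φ := h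

lemma IsHamFlow.contDiff {H : E n × E n → ℝ} (hH : ContDiff ℝ ∞ H)
    {φ : ℝ → E n × E n → E n × E n} (hφ : IsHamFlow n H φ) {T : ℝ} (hT : 0 ≤ T) :
    ContDiff ℝ ∞ (φ T) :=
  hφ.isFlowOf.contDiff_of_nonneg (contDiff_hamVF hH) hT

lemma fderiv_add_period {X Y : Type*} [NormedAddCommGroup X] [NormedSpace ℝ X]
    [NormedAddCommGroup Y] [NormedSpace ℝ Y] {f : X → Y} {a : X} (hf : ∀ x, f (x + a) = f x)
    (x : X) : fderiv ℝ f (x + a) = fderiv ℝ f x := by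
  rw [← fderiv_comp_add_right]
  simp only [hf]

lemma hamVF_add_period {H : E n × E n → ℝ} (hH : Differentiable ℝ H)
    {a : E n × E n} (ha : ∀ z, H (z + a) = H z) (z : E n × E n) :
    hamVF n H (z + a) = hamVF n H z := by
  have h1 : gradP n H (z + a).1 (z + a).2 = gradP n H z.1 z.2 := by
    ext i
    rw [gradP_eq hH, gradP_eq hH, fderiv_add_period ha]
  have h2 : gradX n H (z + a).1 (z + a).2 = gradX n H z.1 z.2 := by
    ext i
    rw [gradX_eq hH, gradX_eq hH, fderiv_add_period ha]
  rw [hamVF, hamVF, h1, h2]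

lemma IsHamFlow.add_intVec {H : E n × E n → ℝ} (hH : ContDiff ℝ ∞ H)
    (hHper : ∀ (x p : E n) (m : Fin n → ℤ), H (x + intVec m, p) = H (x, p))
    {φ : ℝ → E n × E n → E n × E n} (hφ : IsHamFlow n H φ) {T : ℝ} (hT : 0 ≤ T)
    (x p : E n) (l : Fin n → ℤ) : φ T (x + intVec l, p) = φ T (x, p) + (intVec l, 0) := by
  have hd : Differentiable ℝ H := hH.differentiable (by simp)
  have := hφ.isFlowOf.add_period ((contDiff_hamVF hH).of_le (by simp)) (a := (intVec l, 0))
    (hamVF_add_period hd fun z => hper_pair hHper z l) hT (x, p)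
  simpa using this

/-- The time-`T` map of a Hamiltonian flow is exact symplectic, with a periodic primitive. -/
lemma IsHamFlow.exists_action {H : E n × E n → ℝ} (hH : ContDiff ℝ ∞ H)
    (hHper : ∀ (x p : E n) (m : Fin n → ℤ), H (x + intVec m, p) = H (x, p))
    {φ : ℝ → E n × E n → E n × E n} (hφ : IsHamFlow n H φ) {T : ℝ} (hT : 0 ≤ T) :
    ∃ S : E n × E n → ℝ, ContDiff ℝ ∞ S ∧
      (∀ (x p : E n) (l : Fin n → ℤ), S (x + intVec l, p) = S (x, p)) ∧
      ∀ z v, fderiv ℝ S z v =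
        dotP n (φ T z).2 (fderiv ℝ (φ T) z v).1 - dotP n z.2 v.1 := by
  have hd : Differentiable ℝ H := hH.differentiable (by simp)
  have hflow := hφ.isFlowOf
  have hlag := contDiff_hamLagrangian hH
  let F : (E n × E n) × ℝ → (E n × E n) × ℝ := fun y => (hamVF n H y.1, hamLagrangian n H y.1)
  have hF : ContDiff ℝ ∞ F :=
    ((contDiff_hamVF hH).comp contDiff_fst).prodMk (hlag.comp contDiff_fst)
  let Φ : ℝ → (E n × E n) × ℝ → (E n × E n) × ℝ := fun t y =>
    (φ t y.1, y.2 + ∫ s in (0 : ℝ)..t, hamLagrangian n H (φ s y.1))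
  have hΦ : IsFlowOf F Φ := by
    refine ⟨fun y => by simp [Φ, hflow.1], fun y t => ?_⟩
    refine (hflow.2 y.1 t).prodMk ?_
    have hc : Continuous fun s => hamLagrangian n H (φ s y.1) :=
      hlag.continuous.comp (hflow.continuous y.1)
    exact (intervalIntegral.integral_hasDerivAt_right (hc.intervalIntegrable _ _)
      (hc.stronglyMeasurableAtFilter _ _) hc.continuousAt).const_add y.2
  have hΦs : ∀ t, 0 ≤ t → ContDiff ℝ ∞ (Φ t) := fun t ht => hΦ.contDiff_of_nonneg hF ht
  refine ⟨fun z => (Φ T (z, 0)).2, ?_, ?_, ?_⟩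
  · exact contDiff_snd.comp ((hΦs T hT).comp (contDiff_id.prodMk contDiff_const))
  · intro x p l
    have hla : ∀ z, hamLagrangian n H (z + (intVec l, 0)) = hamLagrangian n H z := by
      intro z
      have h0 : ∀ z, H (z + (intVec l, 0)) = H z := fun z => hper_pair hHper z l
      have h1 := congrArg Prod.fst (hamVF_add_period hd h0 z)
      simp only [hamVF] at h1
      simp only [hamLagrangian, h1, h0]
      simp
    refine congrArg (fun c : ℝ => (0 : ℝ) + c) ?_
    refine intervalIntegral.integral_congr fun s hs => ?_
    rw [Set.uIcc_of_le hT] at hs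
    simp only
    rw [hφ.add_intVec hH hHper hs.1, hla]
  · intro z v
    set y : (E n × E n) × ℝ := (z, 0)
    set w : (E n × E n) × ℝ := (v, 0)
    let D : ℝ → (E n × E n) × ℝ := fun t => fderiv ℝ (Φ t) y w
    have hD : ∀ t, HasDerivAt D (fderiv ℝ F (Φ t y) (D t)) t := fun t =>
      hΦ.hasDerivAt_fderiv hF y w t
    have hFd : ∀ y w, fderiv ℝ F y w =
        (fderiv ℝ (hamVF n H) y.1 w.1, fderiv ℝ (hamLagrangian n H) y.1 w.1) := by
      intro y w
      have h1 := ((contDiff_hamVF hH).differentiable (by simp) y.1).hasFDerivAt.comp y hasFDerivAt_fst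
      have h2 := (hlag.differentiable (by simp) y.1).hasFDerivAt.comp y hasFDerivAt_fst
      have h3 : HasFDerivAt F _ y := h1.prodMk h2
      rw [h3.fderiv]
      rfl
    have hVd : ∀ z w, (fderiv ℝ (hamVF n H) z w).1 =
        fderiv ℝ (fun z : E n × E n => gradP n H z.1 z.2) z w := by
      intro z w
      have h1 := (((contDiff_gradP hH).differentiable (by simp) z).hasFDerivAt).prodMk
        ((contDiff_gradX hH).neg.differentiable (by simp) z).hasFDerivAt
      have h2 : HasFDerivAt (hamVF n H) _ z := h1
      rw [h2.fderiv]
      rfl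
    let g : ℝ → ℝ := fun t => dotP n (φ t z).2 (D t).1.1 - (D t).2
    have hg : ∀ t, HasDerivAt g 0 t := by
      intro t
      have h1 := hasDerivAt_prod_snd (hflow.2 z t)
      have h3 := hasDerivAt_prod_fst (hasDerivAt_prod_fst (hD t))
      have h5 := (hasDerivAt_dotP h1 h3).sub (hasDerivAt_prod_snd (hD t))
      refine h5.congr_deriv ?_
      rw [hFd, hVd, fderiv_hamLagrangian hH]
      simp only [hamVF, dotP_neg_left, Φ, y]
      ring
    have hconst := is_const_of_deriv_eq_zero (fun t => (hg t).differentiableAt)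
      (fun t => (hg t).deriv) T 0
    have hD0 : D 0 = w := by
      have : Φ 0 = id := by
        ext1 y
        exact hΦ.1 y
      simp [D, this]
    simp only [g, hD0, hflow.1, w] at hconst
    have hTd : HasFDerivAt (Φ T) (fderiv ℝ (Φ T) y) y :=
      ((hΦs T hT).differentiable (by simp) y).hasFDerivAt
    have h7 : HasFDerivAt (fun z : E n × E n => Φ T (z, 0))
        ((fderiv ℝ (Φ T) y).comp (ContinuousLinearMap.inl ℝ (E n × E n) ℝ)) z :=
      HasFDerivAt.comp (g := Φ T) (f := fun z : E n × E n => (z, (0 : ℝ))) z hTd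
        (hasFDerivAt_prodMk_left z 0)
    have h8 : HasFDerivAt (fun z : E n × E n => (Φ T (z, 0)).2) _ z := hasFDerivAt_snd.comp z h7
    have h9 : HasFDerivAt (fun z : E n × E n => (Φ T (z, 0)).1) _ z := hasFDerivAt_fst.comp z h7
    have h10 : fderiv ℝ (φ T) z v = (D T).1 := by
      have : HasFDerivAt (φ T) _ z := h9
      rw [this.fderiv]
      rfl
    rw [h8.fderiv, h10]
    change (D T).2 = _
    simp only [sub_zero] at hconst
    linarith

end Action

section Hadamard

open scoped ContDiff

lemma contDiff_integral_param {X Y : Type*} [NormedAddCommGroup X] [NormedSpace ℝ X]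
    [CompleteSpace X] [NormedAddCommGroup Y] [NormedSpace ℝ Y] [CompleteSpace Y]
    {g : ℝ × X → Y} (hg : ContDiff ℝ ∞ g) :
    ContDiff ℝ ∞ fun x => ∫ t in (0 : ℝ)..1, g (t, x) := by
  let F : (ℝ × X) × Y → (ℝ × X) × Y := fun y => ((1, 0), g y.1)
  have hF : ContDiff ℝ ∞ F := contDiff_const.prodMk (hg.comp contDiff_fst)
  let Φ : ℝ → (ℝ × X) × Y → (ℝ × X) × Y := fun s y =>
    ((y.1.1 + s, y.1.2), y.2 + ∫ τ in (0 : ℝ)..s, g (y.1.1 + τ, y.1.2))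
  have hΦ : IsFlowOf F Φ := by
    refine ⟨fun y => by simp [Φ], fun y t => ?_⟩
    refine HasDerivAt.prodMk (HasDerivAt.prodMk ?_ (hasDerivAt_const _ _)) ?_
    · exact (hasDerivAt_id t).const_add _
    · have hc : Continuous fun τ => g (y.1.1 + τ, y.1.2) := by
        have := hg.continuous
        fun_prop
      exact (intervalIntegral.integral_hasDerivAt_right (hc.intervalIntegrable _ _)
        (hc.stronglyMeasurableAtFilter _ _) hc.continuousAt).const_add y.2
  have h1 := hΦ.contDiff_of_nonneg hF zero_le_one
  have h2 : ContDiff ℝ ∞ fun x : X => (Φ 1 ((0, x), 0)).2 :=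
    contDiff_snd.comp (h1.comp ((contDiff_const.prodMk contDiff_id).prodMk contDiff_const))
  simpa [Φ] using h2

lemma exists_contDiff_factor {X : Type*} [NormedAddCommGroup X] [NormedSpace ℝ X]
    [CompleteSpace X] {F : ℝ × X → ℝ} (hF : ContDiff ℝ ∞ F) (h0 : ∀ x, F (0, x) = 0) :
    ∃ G : ℝ × X → ℝ, ContDiff ℝ ∞ G ∧ ∀ δ x, F (δ, x) = δ * G (δ, x) := by
  have hd : Differentiable ℝ F := hF.differentiable (by simp)
  let g : ℝ × (ℝ × X) → ℝ := fun q => fderiv ℝ F (q.1 * q.2.1, q.2.2) (1, 0)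
  have hg : ContDiff ℝ ∞ g := by
    refine ContDiff.clm_apply ?_ contDiff_const
    refine (hF.fderiv_right (m := ∞) (by simp)).comp (ContDiff.prodMk ?_ ?_)
    · exact contDiff_fst.mul (contDiff_fst.comp contDiff_snd)
    · exact contDiff_snd.comp contDiff_snd
  refine ⟨_, contDiff_integral_param hg, fun δ x => ?_⟩
  have h1 : ∀ t ∈ Set.uIcc (0 : ℝ) 1, HasDerivAt (fun t => F (t * δ, x)) (δ * g (t, (δ, x))) t := by
    intro t _
    have h2 : HasDerivAt (fun t : ℝ => (t * δ, x)) ((δ, 0) : ℝ × X) t := by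
      refine HasDerivAt.prodMk ?_ (hasDerivAt_const _ _)
      simpa using (hasDerivAt_id t).mul_const δ
    have h3 := (hd (t * δ, x)).hasFDerivAt.comp_hasDerivAt t h2
    refine h3.congr_deriv ?_
    have : ((δ, 0) : ℝ × X) = δ • (1, 0) := by simp
    rw [this, map_smul]
    rfl
  have h4 := intervalIntegral.integral_eq_sub_of_hasDerivAt h1 (by
    refine Continuous.intervalIntegrable ?_ _ _
    have := hg.continuous
    fun_prop)
  rw [intervalIntegral.integral_const_mul] at h4
  simpa [h0] using h4.symm

lemma exists_contDiff_factor_pow {X : Type*} [NormedAddCommGroup X] [NormedSpace ℝ X]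
    [CompleteSpace X] (k : ℕ) : ∀ {F : ℝ × X → ℝ}, ContDiff ℝ ∞ F →
    (∀ x, (fun δ => F (δ, x)) =O[nhds 0] fun δ => δ ^ k) →
    ∃ G : ℝ × X → ℝ, ContDiff ℝ ∞ G ∧ ∀ δ x, F (δ, x) = δ ^ k * G (δ, x) := by
  induction k with
  | zero => exact fun hF _ => ⟨_, hF, fun δ x => by simp⟩
  | succ k ih =>
    intro F hF hO
    have h0 : ∀ x, F (0, x) = 0 := by
      intro x
      obtain ⟨C, hC⟩ := (hO x).bound
      simpa using hC.self_of_nhds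
    obtain ⟨G, hG, hFG⟩ := exists_contDiff_factor hF h0
    obtain ⟨K, hK, hGK⟩ := ih hG (fun x => by
      obtain ⟨C, hC⟩ := (hO x).bound
      refine Asymptotics.IsBigO.of_bound C ?_
      have hne : ∀ δ : ℝ, δ ≠ 0 → ‖F (δ, x)‖ ≤ C * ‖δ ^ (k + 1)‖ → ‖G (δ, x)‖ ≤ C * ‖δ ^ k‖ := by
        intro δ hδ h
        rw [hFG, norm_mul, pow_succ', norm_mul, mul_left_comm] at h
        exact le_of_mul_le_mul_left h (norm_pos_iff.2 hδ)
      obtain ⟨r, hr, hball⟩ := Metric.eventually_nhds_iff_ball.1 hC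
      have hcl : ∀ᶠ δ in nhds (0 : ℝ), δ ∈ Metric.ball (0 : ℝ) r := Metric.ball_mem_nhds _ hr
      filter_upwards [hcl] with δ hδ
      by_cases hδ0 : δ = 0
      · subst hδ0
        have hc1 : Tendsto (fun δ : ℝ => ‖G (δ, x)‖) (nhdsWithin 0 {0}ᶜ) (nhds ‖G (0, x)‖) := by
          have : Continuous fun δ : ℝ => ‖G (δ, x)‖ := by
            have := hG.continuous
            fun_prop
          exact this.continuousAt.tendsto.mono_left nhdsWithin_le_nhds
        have hc2 : Tendsto (fun δ : ℝ => C * ‖δ ^ k‖) (nhdsWithin 0 {0}ᶜ) (nhds (C * ‖(0 : ℝ) ^ k‖)) := by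
          have : Continuous fun δ : ℝ => C * ‖δ ^ k‖ := by fun_prop
          exact this.continuousAt.tendsto.mono_left nhdsWithin_le_nhds
        refine le_of_tendsto_of_tendsto hc1 hc2 ?_
        filter_upwards [self_mem_nhdsWithin, nhdsWithin_le_nhds hcl] with δ h1 h2
        exact hne δ h1 (hball δ h2)
      · exact hne δ hδ0 (hball δ hδ))
    exact ⟨K, hK, fun δ x => by rw [hFG, hGK]; ring⟩

end Hadamard

section LocalInverse

open scoped ContDiff

lemma exists_fiber_inverse {V : Type*} [NormedAddCommGroup V] [NormedSpace ℝ V] [CompleteSpace V]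
    [Nontrivial V] (A : V ≃L[ℝ] V) {R : V × V → V} (hR : ContDiff ℝ ∞ R) {ε C : ℝ} (hε : 0 < ε)
    (hR0 : ∀ x, R (x, 0) = 0) (hRC : ∀ x I, ‖I‖ ≤ ε → ‖fderiv ℝ R (x, I)‖ ≤ C * ‖I‖) :
    ∃ (ρ K : ℝ) (P : V × V → V), 0 < ρ ∧ 0 ≤ K ∧
      (∀ x y, ‖y‖ < ρ → ContDiffAt ℝ ∞ P (x, y)) ∧
      (∀ x y, ‖y‖ < ρ → ‖P (x, y)‖ < ε ∧ ‖P (x, y)‖ ≤ K * ‖y‖ ∧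
        A (P (x, y)) + R (x, P (x, y)) = y) ∧
      ∀ a : V, (∀ x I, R (x + a, I) = R (x, I)) → ∀ x y, ‖y‖ < ρ → P (x + a, y) = P (x, y) := by
  have hC : 0 ≤ C := by
    obtain ⟨v, hv⟩ := exists_ne (0 : V)
    have h1 := hRC 0 ((ε / ‖v‖) • v) (by
      rw [norm_smul, norm_div, norm_norm, Real.norm_of_nonneg hε.le, div_mul_cancel₀ _ (by simpa)])
    have h2 : 0 < ‖(ε / ‖v‖) • v‖ := by
      rw [norm_pos_iff]
      exact smul_ne_zero (div_ne_zero hε.ne' (by simpa)) hv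
    nlinarith [norm_nonneg (fderiv ℝ R (0, (ε / ‖v‖) • v))]
  let A' : (V × V) ≃L[ℝ] V × V := (ContinuousLinearEquiv.refl ℝ V).prodCongr A
  let Θ : V × V → V × V := fun z => (z.1, A z.2 + R z)
  have hΘ : ContDiff ℝ ∞ Θ := contDiff_fst.prodMk ((A.contDiff.comp contDiff_snd).add hR)
  have hΘd : ∀ z, HasFDerivAt Θ ((A' : V × V →L[ℝ] V × V) +
      (ContinuousLinearMap.inr ℝ V V).comp (fderiv ℝ R z)) z := by
    intro z
    have h1 : HasFDerivAt (fun z => A' z + ContinuousLinearMap.inr ℝ V V (R z)) _ z :=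
      (A' : V × V →L[ℝ] V × V).hasFDerivAt.add
        ((ContinuousLinearMap.inr ℝ V V).hasFDerivAt.comp z
          (hR.differentiable (by simp) z).hasFDerivAt)
    refine h1.congr_of_eventuallyEq (Eventually.of_forall fun z => ?_)
    ext <;> simp [Θ, A']
  have hN : 0 < ‖(A'.symm : V × V →L[ℝ] V × V)‖₊ := A'.nnnorm_symm_pos
  set N := ‖(A'.symm : V × V →L[ℝ] V × V)‖₊ with hNdef
  set c : ℝ≥0 := N⁻¹ / 2 with hc
  have hcN : c < N⁻¹ := NNReal.half_lt_self (by positivity)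
  have hcpos : 0 < c := by positivity
  set r : ℝ := min ε (c / (C + 1)) with hr
  have hrpos : 0 < r := lt_min hε (by positivity)
  set s : Set (V × V) := Prod.snd ⁻¹' Metric.ball 0 r with hs
  have hsopen : IsOpen s := Metric.isOpen_ball.preimage continuous_snd
  have hsconv : Convex ℝ s := (convex_ball (0 : V) r).linear_preimage (LinearMap.snd ℝ V V)
  have hmem : ∀ z : V × V, z ∈ s ↔ ‖z.2‖ < r := fun z => by simp [hs]
  have happ : ApproximatesLinearOn Θ (A' : V × V →L[ℝ] V × V) s c := by
    intro z hz w hw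
    refine hsconv.norm_image_sub_le_of_norm_hasFDerivWithin_le' (f := Θ)
      (fun z _ => (hΘd z).hasFDerivWithinAt) (fun z hz => ?_) hw hz
    rw [add_sub_cancel_left]
    have hz' := (hmem z).1 hz
    have h1 : ‖fderiv ℝ R z‖ ≤ c := by
      refine (hRC z.1 z.2 (hz'.le.trans (min_le_left _ _))).trans ?_
      have h2 : ‖z.2‖ ≤ c / (C + 1) := hz'.le.trans (min_le_right _ _)
      rw [le_div_iff₀ (by positivity)] at h2
      nlinarith [norm_nonneg z.2]
    refine ContinuousLinearMap.opNorm_le_bound _ c.2 fun v => ?_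
    simpa using (fderiv ℝ R z).le_of_opNorm_le h1 v
  have hΘ0 : ∀ x, Θ (x, 0) = (x, 0) := fun x => by simp [Θ, hR0]
  let e := happ.toOpenPartialHomeomorph Θ s (Or.inr hcN) hsopen
  have hsurj : ∀ x y : V, ‖y‖ ≤ ((N : ℝ)⁻¹ - c) * (r / 2) → (x, y) ∈ e.target := by
    intro x y hy
    have h1 := happ.surjOn_closedBall_of_nonlinearRightInverse A'.toNonlinearRightInverse
      (b := (x, 0)) (ε := r / 2) (by positivity) (by
        intro z hz
        rw [hmem]
        rw [mem_closedBall_iff_norm] at hz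
        have := (norm_snd_le (z - (x, 0))).trans hz
        simp only [Prod.snd_sub, sub_zero] at this
        linarith)
    rw [hΘ0] at h1
    obtain ⟨z, hz, hzy⟩ := h1 (show (x, y) ∈ Metric.closedBall (x, (0 : V)) _ by
      rw [mem_closedBall_iff_norm]
      have : ‖((x, y) : V × V) - (x, 0)‖ = ‖y‖ := by simp
      rw [this]
      exact hy)
    rw [← hzy]
    refine e.map_source (x := z) ?_
    rw [mem_closedBall_iff_norm] at hz
    have := (norm_snd_le (z - (x, 0))).trans hz
    simp only [Prod.snd_sub, sub_zero] at this
    exact (hmem z).2 (by linarith)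
  have hNc : 0 < (N : ℝ)⁻¹ - c := by
    have : (c : ℝ) < ((N⁻¹ : ℝ≥0) : ℝ) := hcN
    rw [NNReal.coe_inv] at this
    linarith
  have hinv : ∀ x y, ‖y‖ < ((N : ℝ)⁻¹ - c) * (r / 2) →
      e.symm (x, y) ∈ s ∧ Θ (e.symm (x, y)) = (x, y) := fun x y hy =>
    ⟨e.map_target (hsurj x y hy.le), e.right_inv (hsurj x y hy.le)⟩
  have hfst : ∀ x y, ‖y‖ < ((N : ℝ)⁻¹ - c) * (r / 2) → (e.symm (x, y)).1 = x := fun x y hy =>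
    congrArg Prod.fst (hinv x y hy).2
  have hpair : ∀ x y, ‖y‖ < ((N : ℝ)⁻¹ - c) * (r / 2) →
      e.symm (x, y) = (x, (e.symm (x, y)).2) := fun x y hy => by
    rw [Prod.ext_iff]
    exact ⟨hfst x y hy, rfl⟩
  have hinj : Set.InjOn Θ s := happ.injOn (Or.inr hcN)
  refine ⟨((N : ℝ)⁻¹ - c) * (r / 2), ((N⁻¹ - c)⁻¹ : ℝ≥0), fun z => (e.symm z).2, by positivity,
    NNReal.coe_nonneg _, ?_, ?_, ?_⟩
  · intro x y hy
    refine contDiff_snd.contDiffAt.comp (x, y) ?_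
    have hder : ∀ z ∈ s, ∃ f' : (V × V) ≃L[ℝ] V × V,
        HasFDerivAt Θ (f' : V × V →L[ℝ] V × V) z := by
      intro z hz
      have hlin : ApproximatesLinearOn (fderiv ℝ Θ z) (A' : V × V →L[ℝ] V × V) Set.univ c := by
        intro u _ v _
        rw [← map_sub, (hΘd z).fderiv]
        simp only [add_apply, add_sub_cancel_left]
        have hz' := (hmem z).1 hz
        have h1 : ‖fderiv ℝ R z‖ ≤ c := by
          refine (hRC z.1 z.2 (hz'.le.trans (min_le_left _ _))).trans ?_
          have h2 : ‖z.2‖ ≤ c / (C + 1) := hz'.le.trans (min_le_right _ _)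
          rw [le_div_iff₀ (by positivity)] at h2
          nlinarith [norm_nonneg z.2]
        simpa using (fderiv ℝ R z).le_of_opNorm_le h1 (u - v)
      have hsur := hlin.surjective (Or.inr hcN)
      have hin : Function.Injective (fderiv ℝ Θ z) := Set.injOn_univ.1 (hlin.injOn (Or.inr hcN))
      refine ⟨ContinuousLinearEquiv.ofBijective (fderiv ℝ Θ z) (LinearMap.ker_eq_bot.2 hin)
        (LinearMap.range_eq_top.2 hsur), ?_⟩
      rw [ContinuousLinearEquiv.coe_ofBijective]
      exact (hΘ.differentiable (by simp) z).hasFDerivAt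
    obtain ⟨f', hf'⟩ := hder _ (hinv x y hy).1
    exact e.contDiffAt_symm (hsurj x y hy.le) hf' hΘ.contDiffAt
  · intro x y hy
    have h1 := (hmem _).1 (hinv x y hy).1
    have h2 := congrArg Prod.snd (hinv x y hy).2
    refine ⟨h1.trans_le (min_le_left _ _), ?_, ?_⟩
    · have h3 := (happ.antilipschitz (Or.inr hcN)).le_mul_dist ⟨e.symm (x, y), (hinv x y hy).1⟩
        ⟨(x, 0), (hmem _).2 (by simpa using hrpos)⟩
      simp only [Subtype.dist_eq, Set.domRestrict_apply, (hinv x y hy).2, hΘ0] at h3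
      rw [hpair x y hy, dist_eq_norm, dist_eq_norm] at h3
      simpa using h3
    · simp only [Θ] at h2
      rwa [hpair x y hy] at h2
  · intro a ha x y hy
    have h1 : (x, (e.symm (x, y)).2) ∈ s := (hmem _).2 ((hmem _).1 (hinv x y hy).1)
    have h2 : (x + a, (e.symm (x, y)).2) ∈ s := h1
    have h3 : Θ (x + a, (e.symm (x, y)).2) = (x + a, y) := by
      have h4 := (hinv x y hy).2
      rw [hpair x y hy] at h4
      simp only [Θ, Prod.mk.injEq, true_and] at h4
      simp only [Θ, ha, h4]
    have h5 := hinj (hinv (x + a) y hy).1 h2 ((hinv (x + a) y hy).2.trans h3.symm)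
    have h6 := congrArg Prod.snd h5
    exact h6

end LocalInverse

section NormalForm

open scoped ContDiff

variable {n : ℕ}

/-- An invertible matrix as a continuous linear automorphism. -/
def matEquiv (A : Matrix (Fin n) (Fin n) ℝ) (hA : IsUnit A.det) : E n ≃L[ℝ] E n :=
  (LinearEquiv.ofLinearMap (Matrix.toLin' A) (Matrix.toLin' A⁻¹)
    (by rw [← Matrix.toLin'_mul, Matrix.mul_nonsing_inv _ hA, Matrix.toLin'_one])
    (by rw [← Matrix.toLin'_mul, Matrix.nonsing_inv_mul _ hA,
      Matrix.toLin'_one])).toContinuousLinearEquiv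

lemma matEquiv_apply (A : Matrix (Fin n) (Fin n) ℝ) (hA : IsUnit A.det) (v : E n) :
    matEquiv A hA v = A.mulVec v := rfl

lemma matEquiv_symm_apply (A : Matrix (Fin n) (Fin n) ℝ) (hA : IsUnit A.det) (v : E n) :
    (matEquiv A hA).symm v = A⁻¹.mulVec v := rfl

lemma dotP_matEquiv_symm {A : Matrix (Fin n) (Fin n) ℝ} (hA : IsUnit A.det) (hs : A.IsSymm)
    (v w : E n) : dotP n ((matEquiv A hA).symm v) w = dotP n ((matEquiv A hA).symm w) v := by
  have h1 : ∀ a b : E n, dotP n a b = a ⬝ᵥ b := fun a b => rfl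
  have h2 : (A⁻¹).transpose = A⁻¹ := by rw [Matrix.transpose_nonsing_inv, hs.eq]
  rw [matEquiv_symm_apply, matEquiv_symm_apply, h1, h1, dotProduct_comm, Matrix.dotProduct_mulVec,
    ← Matrix.mulVec_transpose, h2]

lemma abs_dotP_le (a b : E n) : |dotP n a b| ≤ n * (‖a‖ * ‖b‖) := by
  refine (Finset.abs_sum_le_sum_abs _ _).trans ?_
  have : ∀ i ∈ Finset.univ, |a i * b i| ≤ ‖a‖ * ‖b‖ := fun i _ => by
    rw [abs_mul]
    exact mul_le_mul (norm_le_pi_norm a i) (norm_le_pi_norm b i) (abs_nonneg _) (norm_nonneg _)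
  refine (Finset.sum_le_sum this).trans ?_
  simp

lemma BigOI.norm_le {s : ℕ} (hs : 0 < s) {R : E n × E n → E n} (h : BigOI n s R) :
    ∃ ε C : ℝ, 0 < ε ∧ 0 ≤ C ∧ ∀ x I : E n, ‖I‖ ≤ ε → ‖R (x, I)‖ ≤ C * ‖I‖ ^ s := by
  obtain ⟨ε, hε, h⟩ := h
  obtain ⟨C, hC⟩ := h 0 0 hs
  refine ⟨ε, max C 0, hε, le_max_right _ _, fun x I hI => ?_⟩
  have := hC x I hI
  rw [norm_iteratedFDeriv_zero, norm_iteratedFDeriv_zero, Nat.sub_zero] at this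
  exact this.trans (by gcongr; exact le_max_left _ _)

lemma BigOI.norm_fderiv_le {R₁ R : E n × E n → E n} (h : BigOI n 2 R₁)
    (hR : ContDiff ℝ ∞ R) {ε₀ : ℝ} (hε₀ : 0 < ε₀)
    (heq : ∀ x I, ‖I‖ < ε₀ → R₁ (x, I) = R (x, I)) :
    ∃ ε C : ℝ, 0 < ε ∧ ∀ x I : E n, ‖I‖ ≤ ε → ‖fderiv ℝ R (x, I)‖ ≤ C * ‖I‖ := by
  obtain ⟨ε, hε, h⟩ := h
  obtain ⟨C₁, hC₁⟩ := h 1 0 (by norm_num)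
  obtain ⟨C₂, hC₂⟩ := h 0 1 (by norm_num)
  set r := min (min ε (ε₀ / 2)) 1
  have hr : 0 < r := by positivity
  have hd : Differentiable ℝ R := hR.differentiable (by simp)
  refine ⟨r, |C₁| + |C₂|, hr, fun x I hI => ?_⟩
  have hIε : ‖I‖ ≤ ε := hI.trans ((min_le_left _ _).trans (min_le_left _ _))
  have hIε₀ : ‖I‖ < ε₀ := by
    have := hI.trans ((min_le_left _ _).trans (min_le_right _ _))
    linarith
  have hI1 : ‖I‖ ≤ 1 := hI.trans (min_le_right _ _)
  have hl : HasFDerivAt (fun x' => R (x', I))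
      ((fderiv ℝ R (x, I)).comp (ContinuousLinearMap.inl ℝ (E n) (E n))) x :=
    HasFDerivAt.comp (g := R) (f := fun x => (x, I)) x (hd (x, I)).hasFDerivAt
      (hasFDerivAt_prodMk_left x I)
  have hr : HasFDerivAt (fun I' => R (x, I'))
      ((fderiv ℝ R (x, I)).comp (ContinuousLinearMap.inr ℝ (E n) (E n))) I :=
    HasFDerivAt.comp (g := R) (f := fun I => (x, I)) I (hd (x, I)).hasFDerivAt
      (hasFDerivAt_prodMk_right x I)
  have h1 : ‖(fderiv ℝ R (x, I)).comp (ContinuousLinearMap.inl ℝ (E n) (E n))‖ ≤ |C₁| * ‖I‖ := by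
    have h2 := hC₁ x I hIε
    have h3 : (fun θ' => (⇑(continuousMultilinearCurryFin0 ℝ (E n) (E n)).symm ∘
        fun I' => R₁ (θ', I')) I) =
        ⇑(continuousMultilinearCurryFin0 ℝ (E n) (E n)).symm ∘ fun θ' => R (θ', I) := by
      ext1 θ
      simp only [Function.comp_apply, heq _ _ hIε₀]
    simp only [iteratedFDeriv_zero_eq_comp] at h2
    rw [h3, LinearIsometryEquiv.norm_iteratedFDeriv_comp_left, norm_iteratedFDeriv_one,
      hl.fderiv] at h2
    refine h2.trans ((mul_le_mul_of_nonneg_right (le_abs_self C₁) (by positivity)).trans ?_)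
    gcongr
    rw [Nat.sub_zero, sq]
    nlinarith [norm_nonneg I]
  have h2 : ‖(fderiv ℝ R (x, I)).comp (ContinuousLinearMap.inr ℝ (E n) (E n))‖ ≤ |C₂| * ‖I‖ := by
    have h2 := hC₂ x I hIε
    rw [norm_iteratedFDeriv_zero, norm_iteratedFDeriv_one] at h2
    have h3 : (fun I' => R₁ (x, I')) =ᶠ[nhds I] fun I' => R (x, I') := by
      filter_upwards [continuous_norm.continuousAt.eventually (gt_mem_nhds hIε₀)] with I' hI'
      exact heq _ _ hI'
    rw [h3.fderiv_eq, hr.fderiv] at h2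
    refine h2.trans ?_
    norm_num
    gcongr
    exact le_abs_self C₂
  refine ContinuousLinearMap.opNorm_le_bound _ (by positivity) fun v => ?_
  have h3 : fderiv ℝ R (x, I) v =
      (fderiv ℝ R (x, I)).comp (ContinuousLinearMap.inl ℝ (E n) (E n)) v.1 +
      (fderiv ℝ R (x, I)).comp (ContinuousLinearMap.inr ℝ (E n) (E n)) v.2 := by
    simp [← map_add]
  rw [h3, add_mul, add_mul]
  exact (norm_add_le _ _).trans (add_le_add
    (ContinuousLinearMap.le_of_opNorm_le_of_le _ h1 (norm_fst_le v))
    (ContinuousLinearMap.le_of_opNorm_le_of_le _ h2 (norm_snd_le v)))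

/-- Every point of `ℝⁿ` is an integer translate of a point of the unit cube. -/
lemma exists_intVec_add (x : E n) :
    ∃ y ∈ Set.Icc (0 : E n) 1, ∃ l : Fin n → ℤ, x = y + intVec l :=
  ⟨fun i => Int.fract (x i), ⟨fun i => Int.fract_nonneg _, fun i => (Int.fract_lt_one _).le⟩,
    fun i => ⌊x i⌋, by ext i; simp [intVec]⟩

lemma norm_iteratedFDeriv_partial_le {X Y Z : Type*} [NormedAddCommGroup X] [NormedSpace ℝ X]
    [NormedAddCommGroup Y] [NormedSpace ℝ Y] [NormedAddCommGroup Z] [NormedSpace ℝ Z]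
    {G : X × Y → Z} (hG : ContDiff ℝ ∞ G) (k : ℕ) (x : X) (y : Y) :
    ‖iteratedFDeriv ℝ k (fun y => G (x, y)) y‖ ≤ ‖iteratedFDeriv ℝ k G (x, y)‖ := by
  have h1 : (fun y => G (x, y)) =
      (fun z => G ((x, 0) + z)) ∘ ContinuousLinearMap.inr ℝ X Y := by
    ext y
    simp
  have hG' : ContDiff ℝ ∞ fun z => G ((x, 0) + z) := hG.comp (contDiff_const.add contDiff_id)
  rw [h1, ContinuousLinearMap.iteratedFDeriv_comp_right _ hG' _ (by exact_mod_cast le_top),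
    iteratedFDeriv_comp_add_left]
  refine (ContinuousMultilinearMap.norm_compContinuousLinearMap_le _ _).trans ?_
  have h2 : (x, (0 : Y)) + ContinuousLinearMap.inr ℝ X Y y = (x, y) := by simp
  rw [h2]
  refine mul_le_of_le_one_right (norm_nonneg _) ?_
  exact Finset.prod_le_one (fun _ _ => norm_nonneg _)
    fun _ _ => ContinuousLinearMap.norm_inr_le_one ℝ X Y

lemma exists_uniform_bound {G : ℝ × (E n × E n) → ℝ} (hG : ContDiff ℝ ∞ G)
    (hper : ∀ δ ∈ Set.Ioc (0 : ℝ) 1, ∀ x Y (l : Fin n → ℤ), G (δ, (x + intVec l, Y)) = G (δ, (x, Y)))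
    {R : ℝ} (hsupp : ∀ δ x Y, R ≤ ‖Y‖ → G (δ, (x, Y)) = 0) (k : ℕ) :
    ∃ C, ∀ δ ∈ Set.Ioc (0 : ℝ) 1, ∀ z, ‖iteratedFDeriv ℝ k (fun z => G (δ, z)) z‖ ≤ C := by
  have hcpt : IsCompact (Set.Icc (0 : ℝ) 1 ×ˢ (Set.Icc (0 : E n) 1 ×ˢ
      Metric.closedBall (0 : E n) (|R| + 1))) :=
    isCompact_Icc.prod (isCompact_Icc.prod (isCompact_closedBall _ _))
  obtain ⟨C, hC⟩ := hcpt.bddAbove_image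
    (hG.continuous_iteratedFDeriv (m := k) (by exact_mod_cast le_top)).norm.continuousOn
  refine ⟨max C 0, fun δ hδ z => ?_⟩
  obtain ⟨x, hx, l, hl⟩ := exists_intVec_add z.1
  have h1 : z = (x, z.2) + (intVec l, 0) := by rw [Prod.ext_iff]; simp [hl]
  have h2 : iteratedFDeriv ℝ k (fun z => G (δ, z)) z =
      iteratedFDeriv ℝ k (fun z => G (δ, z)) (x, z.2) := by
    conv_lhs => rw [h1]
    rw [← iteratedFDeriv_comp_add_right]
    congr 1
    ext w
    have := hper δ hδ w.1 w.2 l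
    rw [← this]
    congr 1
    rw [Prod.ext_iff, Prod.ext_iff]
    simp
  rw [h2]
  by_cases hz : ‖z.2‖ ≤ |R| + 1
  · refine (norm_iteratedFDeriv_partial_le hG k δ _).trans (le_trans ?_ (le_max_left _ _))
    exact hC ⟨(δ, (x, z.2)), ⟨⟨hδ.1.le, hδ.2⟩, hx, by simpa using hz⟩, rfl⟩
  · have h3 : (fun z => G (δ, z)) =ᶠ[nhds (x, z.2)] fun _ => 0 := by
      have h4 : ∀ᶠ w : E n × E n in nhds (x, z.2), |R| + 1 < ‖w.2‖ :=
        (continuous_snd.norm.continuousAt (x := ((x, z.2) : E n × E n))).eventually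
          (lt_mem_nhds (not_le.1 hz))
      filter_upwards [h4] with w hw
      exact hsupp δ w.1 w.2 (by linarith [le_abs_self R])
    rw [(Filter.EventuallyEq.iteratedFDeriv ℝ h3 k).self_of_nhds]
    simp only [iteratedFDeriv_fun_zero]
    simp

end NormalForm

section GeneratingFunction

open scoped ContDiff

variable {n : ℕ}

/-- A generating function, in base coordinates `(x, y) = (x, x' - x)`, of an exact symplectic
twist map which is close to an integrable one. -/
lemma exists_generating_function (hn : 1 ≤ n) {f : E n × E n → E n × E n} (hf : ContDiff ℝ ∞ f)
    (hfper : ∀ (x p : E n) (l : Fin n → ℤ), f (x + intVec l, p) = f (x, p) + (intVec l, 0))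
    {S : E n × E n → ℝ} (hS : ContDiff ℝ ∞ S)
    (hSper : ∀ (x p : E n) (l : Fin n → ℤ), S (x + intVec l, p) = S (x, p))
    (hSd : ∀ z v, fderiv ℝ S z v = dotP n (f z).2 (fderiv ℝ f z v).1 - dotP n z.2 v.1)
    {A : Matrix (Fin n) (Fin n) ℝ} (hA : IsUnit A.det) (hAs : A.IsSymm)
    {R₁ R₂ : E n × E n → E n} {ε : ℝ} (hε : 0 < ε)
    (hnf : ∀ θ I : E n, ‖I‖ < ε → f (θ, I) = (θ + A.mulVec I + R₁ (θ, I), I + R₂ (θ, I)))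
    (hR₁ : BigOI n 2 R₁) (hR₂ : BigOI n 3 R₂) :
    ∃ (ρ C : ℝ) (L : E n × E n → ℝ) (P Q : E n × E n → E n), 0 < ρ ∧
      (∀ x y, ‖y‖ < ρ → ContDiffAt ℝ ∞ L (x, y)) ∧
      (∀ x y, ‖y‖ < ρ → f (x, P (x, y)) = (x + y, Q (x, y))) ∧
      (∀ x y, ‖y‖ < ρ → ∀ v, fderiv ℝ L (x, y) v =
        dotP n (Q (x, y)) (v.1 + v.2) - dotP n (P (x, y)) v.1) ∧
      (∀ x y, ‖y‖ < ρ → ∀ l, L (x + intVec l, y) = L (x, y)) ∧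
      ∀ x y, ‖y‖ < ρ →
        |L (x, y) - 1 / 2 * dotP n ((matEquiv A hA).symm y) y| ≤ C * ‖y‖ ^ 3 := by
  have : Nonempty (Fin n) := ⟨⟨0, hn⟩⟩
  have : Nontrivial (E n) := Function.nontrivial
  let R : E n × E n → E n := fun z => (f z).1 - z.1 - matEquiv A hA z.2
  have hR : ContDiff ℝ ∞ R := ((contDiff_fst.comp hf).sub contDiff_fst).sub
    ((matEquiv A hA).contDiff.comp contDiff_snd)
  have heq : ∀ x I, ‖I‖ < ε → R₁ (x, I) = R (x, I) := by
    intro x I hI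
    simp only [R, hnf x I hI, matEquiv_apply]
    abel
  have hRper : ∀ (l : Fin n → ℤ) x I, R (x + intVec l, I) = R (x, I) := by
    intro l x I
    simp only [R, hfper, Prod.fst_add]
    abel
  obtain ⟨ε₁, C₁, hε₁, hC₁, hb₁⟩ := hR₁.norm_le (by norm_num)
  obtain ⟨ε₂, C₂, hε₂, hC₂, hb₂⟩ := hR₂.norm_le (by norm_num)
  obtain ⟨ε₃, C₃, hε₃, hb₃⟩ := hR₁.norm_fderiv_le hR hε heq
  set r := min (min ε ε₁) (min ε₂ ε₃) with hr
  have hrpos : 0 < r := by positivity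
  have hrε : r ≤ ε := (min_le_left _ _).trans (min_le_left _ _)
  have hrε₁ : r ≤ ε₁ := (min_le_left _ _).trans (min_le_right _ _)
  have hrε₂ : r ≤ ε₂ := (min_le_right _ _).trans (min_le_left _ _)
  have hrε₃ : r ≤ ε₃ := (min_le_right _ _).trans (min_le_right _ _)
  have hR0 : ∀ x, R (x, 0) = 0 := by
    intro x
    have := hb₁ x 0 (by simpa using hε₁.le)
    rw [heq x 0 (by simpa using hε)] at this
    simpa using this
  obtain ⟨ρ, K, P, hρ, hK, hPs, hP, hPper⟩ := exists_fiber_inverse (matEquiv A hA) hR hrpos hR0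
    (fun x I hI => hb₃ x I (hI.trans hrε₃))
  have hfP : ∀ x y, ‖y‖ < ρ → f (x, P (x, y)) = (x + y, P (x, y) + R₂ (x, P (x, y))) := by
    intro x y hy
    obtain ⟨h1, h2, h3⟩ := hP x y hy
    rw [hnf _ _ (h1.trans_le hrε), heq _ _ (h1.trans_le hrε), add_assoc, ← matEquiv_apply A hA, h3]
  have hP0 : ∀ x, P (x, 0) = 0 := by
    intro x
    have := (hP x 0 (by simpa using hρ)).2.1
    simpa using this
  let Q : E n × E n → E n := fun z => (f (z.1, P z)).2
  have hQ : ∀ x y, ‖y‖ < ρ → Q (x, y) = P (x, y) + R₂ (x, P (x, y)) := by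
    intro x y hy
    simp only [Q, hfP x y hy]
  have hnear : ∀ x y : E n, ‖y‖ < ρ → ∀ᶠ z : E n × E n in nhds (x, y), ‖z.2‖ < ρ :=
    fun x y hy => (continuous_snd.norm.continuousAt (x := ((x, y) : E n × E n))).eventually
      (gt_mem_nhds hy)
  let L : E n × E n → ℝ := fun z => S (z.1, P z) - S (0, 0)
  have hΨ : ∀ x y, ‖y‖ < ρ → ContDiffAt ℝ ∞ (fun z : E n × E n => (z.1, P z)) (x, y) :=
    fun x y hy => contDiffAt_fst.prodMk (hPs x y hy)
  have hLs : ∀ x y, ‖y‖ < ρ → ContDiffAt ℝ ∞ L (x, y) := fun x y hy =>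
    ((hS.contDiffAt (x := (x, P (x, y)))).comp (x, y) (hΨ x y hy)).sub contDiffAt_const
  have hLd : ∀ x y, ‖y‖ < ρ → ∀ v, fderiv ℝ L (x, y) v =
        dotP n (Q (x, y)) (v.1 + v.2) - dotP n (P (x, y)) v.1 := by
    intro x y hy v
    have h1 : HasFDerivAt (fun z : E n × E n => (z.1, P z))
        ((ContinuousLinearMap.fst ℝ (E n) (E n)).prod (fderiv ℝ P (x, y))) (x, y) :=
      hasFDerivAt_fst.prodMk ((hPs x y hy).differentiableAt (by simp)).hasFDerivAt
    have h2 : HasFDerivAt L ((fderiv ℝ S (x, P (x, y))).comp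
        ((ContinuousLinearMap.fst ℝ (E n) (E n)).prod (fderiv ℝ P (x, y)))) (x, y) :=
      (HasFDerivAt.comp (g := S) (x, y) (hS.differentiable (by simp) _).hasFDerivAt h1).sub_const _
    have h3 : HasFDerivAt (fun z : E n × E n => (f (z.1, P z)).1)
        ((ContinuousLinearMap.fst ℝ (E n) (E n)).comp ((fderiv ℝ f (x, P (x, y))).comp
        ((ContinuousLinearMap.fst ℝ (E n) (E n)).prod (fderiv ℝ P (x, y))))) (x, y) :=
      (ContinuousLinearMap.fst ℝ (E n) (E n)).hasFDerivAt.comp (x, y)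
        (HasFDerivAt.comp (g := f) (x, y) (hf.differentiable (by simp) _).hasFDerivAt h1)
    have h4 : HasFDerivAt (fun z : E n × E n => z.1 + z.2)
        (ContinuousLinearMap.fst ℝ (E n) (E n) + ContinuousLinearMap.snd ℝ (E n) (E n)) (x, y) :=
      hasFDerivAt_fst.add hasFDerivAt_snd
    have h5 : (fun z : E n × E n => (f (z.1, P z)).1) =ᶠ[nhds (x, y)] fun z => z.1 + z.2 := by
      filter_upwards [hnear x y hy] with z hz
      have := hfP z.1 z.2 hz
      simp only [Prod.mk.eta] at this
      rw [this]
    have h6 := congrArg (fun T : E n × E n →L[ℝ] E n => T v)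
      (h3.unique (h4.congr_of_eventuallyEq h5))
    simp only [ContinuousLinearMap.comp_apply, add_apply,
      ContinuousLinearMap.coe_fst', ContinuousLinearMap.coe_snd'] at h6
    rw [h2.fderiv, ContinuousLinearMap.comp_apply, hSd, h6]
    rfl
  have hPB : ∀ x y, ‖y‖ < ρ →
      P (x, y) - (matEquiv A hA).symm y = -(matEquiv A hA).symm (R (x, P (x, y))) := by
    intro x y hy
    have h1 := congrArg (matEquiv A hA).symm (hP x y hy).2.2
    rw [map_add, ContinuousLinearEquiv.symm_apply_apply] at h1
    rw [← h1]
    abel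
  set b := ‖((matEquiv A hA).symm : E n →L[ℝ] E n)‖ with hb
  have hPK : ∀ x y, ‖y‖ < ρ → ‖R₁ (x, P (x, y))‖ ≤ C₁ * (K * ‖y‖) ^ 2 := by
    intro x y hy
    obtain ⟨h1, h2, _⟩ := hP x y hy
    exact (hb₁ _ _ (h1.le.trans hrε₁)).trans (by gcongr)
  have hQK : ∀ x y, ‖y‖ < ρ → ‖R₂ (x, P (x, y))‖ ≤ C₂ * (K * ‖y‖) ^ 3 := by
    intro x y hy
    obtain ⟨h1, h2, _⟩ := hP x y hy
    exact (hb₂ _ _ (h1.le.trans hrε₂)).trans (by gcongr)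
  set C' : ℝ := n * (b * (C₁ * K ^ 2) + C₂ * K ^ 3 * ρ) with hC'
  have hL0 : ∀ x, L (x, 0) = 0 := by
    have h0 : ‖(0 : E n)‖ < ρ := by simpa using hρ
    have hd : ∀ x, HasFDerivAt (fun x => L (x, 0)) (0 : E n →L[ℝ] ℝ) x := by
      intro x
      have h1 : HasFDerivAt (fun x => L (x, 0))
          ((fderiv ℝ L (x, 0)).comp (ContinuousLinearMap.inl ℝ (E n) (E n))) x :=
        HasFDerivAt.comp (g := L) (f := fun x => (x, 0)) x
          ((hLs x 0 h0).differentiableAt (by simp)).hasFDerivAt (hasFDerivAt_prodMk_left x 0)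
      refine h1.congr_fderiv ?_
      ext1 v
      have h2 : R₂ (x, 0) = 0 := by
        have := hQK x 0 h0
        rw [hP0] at this
        simpa using this
      rw [ContinuousLinearMap.comp_apply, hLd x 0 h0, hQ x 0 h0, hP0, h2]
      simp [dotP]
    intro x
    have := is_const_of_fderiv_eq_zero (𝕜 := ℝ) (fun x => (hd x).differentiableAt)
      (fun x => (hd x).fderiv) x 0
    rw [this]
    simp [L, hP0]
  let g : E n × E n → ℝ := fun z => L z - 1 / 2 * dotP n ((matEquiv A hA).symm z.2) z.2
  have hBq : ∀ y : E n, HasFDerivAt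
      (fun y => 1 / 2 * dotP n ((matEquiv A hA).symm y) y) (dotL n ((matEquiv A hA).symm y)) y := by
    intro y
    have h1 : HasFDerivAt (fun y => dotL n ((matEquiv A hA).symm y)) _ y :=
      (dotL n).hasFDerivAt.comp y
        (((matEquiv A hA).symm : E n →L[ℝ] E n).hasFDerivAt (x := y))
    have h2 := (h1.clm_apply (hasFDerivAt_id y)).const_mul (1 / 2)
    simp only [dotL_apply, id] at h2
    refine h2.congr_fderiv ?_
    ext1 v
    simp [dotL_apply, dotP_matEquiv_symm hA hAs v y]
    ring
  have hgd : ∀ x y, ‖y‖ < ρ → ‖fderiv ℝ (fun y => g (x, y)) y‖ ≤ C' * ‖y‖ ^ 2 ∧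
      DifferentiableAt ℝ (fun y => g (x, y)) y := by
    intro x y hy
    have h1 : HasFDerivAt (fun y => L (x, y))
        ((fderiv ℝ L (x, y)).comp (ContinuousLinearMap.inr ℝ (E n) (E n))) y :=
      HasFDerivAt.comp (g := L) (f := fun y => (x, y)) y
        ((hLs x y hy).differentiableAt (by simp)).hasFDerivAt (hasFDerivAt_prodMk_right x y)
    have h2 : HasFDerivAt (fun y => g (x, y)) _ y := h1.sub (hBq y)
    refine ⟨?_, h2.differentiableAt⟩
    rw [h2.fderiv]
    refine ContinuousLinearMap.opNorm_le_bound _ (by positivity) fun v => ?_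
    have h3 : ((fderiv ℝ L (x, y)).comp (ContinuousLinearMap.inr ℝ (E n) (E n)) -
        dotL n ((matEquiv A hA).symm y)) v =
        dotP n (-(matEquiv A hA).symm (R (x, P (x, y))) + R₂ (x, P (x, y))) v := by
      rw [← hPB x y hy, sub_apply, ContinuousLinearMap.comp_apply, hLd x y hy,
        hQ x y hy]
      simp only [← dotL_apply, map_add, map_sub, add_apply, sub_apply]
      simp
      ring
    rw [h3, Real.norm_eq_abs]
    refine (abs_dotP_le _ _).trans ?_
    have h4 : ‖-(matEquiv A hA).symm (R (x, P (x, y))) + R₂ (x, P (x, y))‖ ≤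
        (b * (C₁ * K ^ 2) + C₂ * K ^ 3 * ρ) * ‖y‖ ^ 2 := by
      refine (norm_add_le _ _).trans ?_
      rw [norm_neg]
      have h5 := ((matEquiv A hA).symm : E n →L[ℝ] E n).le_opNorm (R (x, P (x, y)))
      rw [← heq _ _ ((hP x y hy).1.trans_le hrε)] at h5 ⊢
      have h6 : b * ‖R₁ (x, P (x, y))‖ ≤ b * (C₁ * (K * ‖y‖) ^ 2) := by
        gcongr
        exact hPK x y hy
      have h7 : C₂ * (K * ‖y‖) ^ 3 ≤ C₂ * K ^ 3 * ρ * ‖y‖ ^ 2 := by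
        have : C₂ * (K * ‖y‖) ^ 3 = C₂ * K ^ 3 * ‖y‖ ^ 2 * ‖y‖ := by ring
        rw [this]
        have h8 : C₂ * K ^ 3 * ‖y‖ ^ 2 * ‖y‖ ≤ C₂ * K ^ 3 * ‖y‖ ^ 2 * ρ := by gcongr
        linarith
      have h9 := hQK x y hy
      have h10 : ‖(matEquiv A hA).symm (R₁ (x, P (x, y)))‖ ≤ b * ‖R₁ (x, P (x, y))‖ := h5
      nlinarith
    calc (n : ℝ) * (‖-(matEquiv A hA).symm (R (x, P (x, y))) + R₂ (x, P (x, y))‖ * ‖v‖)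
        ≤ n * ((b * (C₁ * K ^ 2) + C₂ * K ^ 3 * ρ) * ‖y‖ ^ 2 * ‖v‖) := by gcongr
      _ = C' * ‖y‖ ^ 2 * ‖v‖ := by rw [hC']; ring
  refine ⟨ρ, C', L, P, Q, hρ, hLs, fun x y hy => ?_, hLd, ?_, ?_⟩
  · rw [hQ x y hy]
    exact hfP x y hy
  · intro x y hy l
    simp only [L]
    rw [hPper _ (hRper l) x y hy, hSper]
  · intro x y hy
    have h1 := (convex_closedBall (0 : E n) ‖y‖).norm_image_sub_le_of_norm_fderiv_le
      (f := fun y => g (x, y)) (C := C' * ‖y‖ ^ 2) (𝕜 := ℝ) (x := 0) (y := y)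
      (fun z hz => (hgd x z ((mem_closedBall_zero_iff.1 hz).trans_lt hy)).2)
      (fun z hz => by
        have hz' := mem_closedBall_zero_iff.1 hz
        refine (hgd x z (hz'.trans_lt hy)).1.trans ?_
        have : 0 ≤ C' := by positivity
        gcongr)
      (by simp) (by simp)
    have h2 : g (x, 0) = 0 := by simp [g, hL0, dotP]
    simp only [h2, sub_zero, Real.norm_eq_abs] at h1
    refine h1.trans (le_of_eq ?_)
    ring

end GeneratingFunction

section ScaledLagrangian

open scoped ContDiff

variable {n : ℕ}

lemma dotP_ext {a b : E n} (h : ∀ v, dotP n a v = dotP n b v) : a = b := by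
  funext i
  have := h (Pi.single i 1)
  simpa [dotP, Pi.single_apply] using this

/-- The rescaled discrete Lagrangian `½⟨B Y, Y⟩ + δ r(x, Y)`. -/
def scaledLag (B : E n →L[ℝ] E n) (r : E n × E n → ℝ) (δ : ℝ) (z : E n × E n) : ℝ :=
  1 / 2 * dotP n (B z.2) z.2 + δ * r z

lemma contDiff_scaledLag (B : E n →L[ℝ] E n) {r : E n × E n → ℝ} (hr : ContDiff ℝ ∞ r) (δ : ℝ) :
    ContDiff ℝ ∞ (scaledLag B r δ) := by
  unfold scaledLag
  simp only [← dotL_apply]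
  fun_prop

/-- A generating function with an integrable quadratic leading part, rescaled by `y = δ Y`. -/
lemma exists_scaled_lagrangian {f : E n × E n → E n × E n} {B : E n →L[ℝ] E n}
    {ρ C : ℝ} {L : E n × E n → ℝ} {P Q : E n × E n → E n} (hρ : 0 < ρ)
    (hL : ∀ x y, ‖y‖ < ρ → ContDiffAt ℝ ∞ L (x, y))
    (hf : ∀ x y, ‖y‖ < ρ → f (x, P (x, y)) = (x + y, Q (x, y)))
    (hLd : ∀ x y, ‖y‖ < ρ → ∀ v, fderiv ℝ L (x, y) v =
        dotP n (Q (x, y)) (v.1 + v.2) - dotP n (P (x, y)) v.1)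
    (hLper : ∀ x y, ‖y‖ < ρ → ∀ l, L (x + intVec l, y) = L (x, y))
    (hLb : ∀ x y, ‖y‖ < ρ → |L (x, y) - 1 / 2 * dotP n (B y) y| ≤ C * ‖y‖ ^ 3)
    {Rad : ℝ} (hRad : 0 ≤ Rad) :
    ∃ (δ₀ : ℝ) (r : ℝ → E n × E n → ℝ), 0 < δ₀ ∧ δ₀ ≤ 1 ∧ (∀ δ, ContDiff ℝ ∞ (r δ)) ∧
      (∀ k : ℕ, ∃ C, ∀ δ ∈ Set.Ioc 0 δ₀, ∀ z, ‖iteratedFDeriv ℝ k (r δ) z‖ ≤ C) ∧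
      (∀ δ ∈ Set.Ioc 0 δ₀, ∀ x Y l, r δ (x + intVec l, Y) = r δ (x, Y)) ∧
      ∀ δ ∈ Set.Ioc 0 δ₀, ∀ x Y, ‖Y‖ ≤ Rad →
        f (x, δ • gradP n (scaledLag B (r δ) δ) x Y - δ ^ 2 • gradX n (scaledLag B (r δ) δ) x Y) =
          (x + δ • Y, δ • gradP n (scaledLag B (r δ) δ) x Y) := by
  let χ : ContDiffBump (0 : E n) := ⟨ρ / 4, ρ / 2, by positivity, by linarith⟩
  let χ₁ : ContDiffBump (0 : E n) := ⟨Rad + 1, Rad + 2, by positivity, by linarith⟩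
  let g : E n × E n → ℝ := fun z => L z - 1 / 2 * dotP n (B z.2) z.2
  let rt : E n × E n → ℝ := fun z => χ z.2 * g z
  have hquad : ContDiff ℝ ∞ fun z : E n × E n => 1 / 2 * dotP n (B z.2) z.2 := by
    simp only [← dotL_apply]
    fun_prop
  have hχ0 : ∀ y : E n, ρ / 2 ≤ ‖y‖ → χ y = 0 := fun y hy =>
    χ.zero_of_le_dist (by simpa using hy)
  have hrt : ContDiff ℝ ∞ rt := by
    rw [contDiff_iff_contDiffAt]
    rintro ⟨x, y⟩
    by_cases hy : ‖y‖ < ρ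
    · exact (χ.contDiff.comp contDiff_snd).contDiffAt.mul ((hL x y hy).sub hquad.contDiffAt)
    · have : rt =ᶠ[nhds (x, y)] fun _ => 0 := by
        have h1 : ∀ᶠ z : E n × E n in nhds (x, y), ρ / 2 < ‖z.2‖ :=
          (continuous_snd.norm.tendsto (x, y)).eventually (lt_mem_nhds (by
            simp only; linarith))
        filter_upwards [h1] with z hz
        simp [rt, hχ0 z.2 hz.le]
      exact contDiffAt_const.congr_of_eventuallyEq this
  have hrtper : ∀ x y l, rt (x + intVec l, y) = rt (x, y) := by
    intro x y l
    by_cases hy : ‖y‖ < ρ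
    · simp only [rt, g, hLper x y hy l]
    · simp [rt, hχ0 y (by linarith)]
  let F : ℝ × (E n × E n) → ℝ := fun q => rt (q.2.1, q.1 • q.2.2)
  have hF : ContDiff ℝ ∞ F := by
    refine hrt.comp ?_
    fun_prop
  obtain ⟨G, hG, hFG⟩ := exists_contDiff_factor_pow 3 hF (by
    rintro ⟨x, Y⟩
    refine Asymptotics.IsBigO.of_bound (|C| * ‖Y‖ ^ 3) ?_
    have h1 : ∀ᶠ δ : ℝ in nhds 0, ‖δ • Y‖ < ρ := by
      have : Continuous fun δ : ℝ => ‖δ • Y‖ := by fun_prop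
      exact (this.tendsto 0).eventually (gt_mem_nhds (by simpa using hρ))
    filter_upwards [h1] with δ hδ
    simp only [F, rt, g, norm_mul, Real.norm_eq_abs]
    have h2 := hLb x (δ • Y) hδ
    have h3 : |χ (δ • Y)| ≤ 1 := by rw [abs_of_nonneg χ.nonneg]; exact χ.le_one
    have h4 : C * ‖δ • Y‖ ^ 3 ≤ |C| * (|δ| * ‖Y‖) ^ 3 := by
      rw [norm_smul, Real.norm_eq_abs]
      gcongr
      exact le_abs_self C
    calc _ ≤ 1 * (|C| * (|δ| * ‖Y‖) ^ 3) := by gcongr; exact h2.trans h4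
      _ = _ := by rw [abs_pow]; ring)
  have hGper : ∀ δ : ℝ, δ ≠ 0 → ∀ x Y l, G (δ, (x + intVec l, Y)) = G (δ, (x, Y)) := by
    intro δ hδ x Y l
    have h1 := hFG δ (x + intVec l, Y)
    have h2 := hFG δ (x, Y)
    simp only [F, hrtper] at h1 h2
    exact mul_left_cancel₀ (pow_ne_zero 3 hδ) (h1.symm.trans h2)
  let G₁ : ℝ × (E n × E n) → ℝ := fun q => χ₁ q.2.2 * G q
  have hG₁ : ContDiff ℝ ∞ G₁ :=
    (χ₁.contDiff.comp (contDiff_snd.comp contDiff_snd)).mul hG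
  have hG₁per : ∀ δ : ℝ, δ ≠ 0 → ∀ x Y l, G₁ (δ, (x + intVec l, Y)) = G₁ (δ, (x, Y)) := by
    intro δ hδ x Y l
    simp only [G₁, hGper δ hδ]
  have hbd := exists_uniform_bound hG₁ (fun δ hδ => hG₁per δ hδ.1.ne') (R := Rad + 2)
    (fun δ x Y hY => by
      simp only [G₁]
      rw [χ₁.zero_of_le_dist (by simpa [χ₁] using hY), zero_mul])
  have hδ₁ : min 1 (ρ / (4 * (Rad + 2))) ≤ 1 := min_le_left _ _
  refine ⟨min 1 (ρ / (4 * (Rad + 2))), fun δ z => G₁ (δ, z), by positivity, hδ₁, fun δ => ?_,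
    fun k => ?_, fun δ hδ => hG₁per δ hδ.1.ne', ?_⟩
  · exact hG₁.comp (contDiff_const.prodMk contDiff_id)
  · obtain ⟨C, hC⟩ := hbd k
    exact ⟨C, fun δ hδ => hC δ ⟨hδ.1, hδ.2.trans hδ₁⟩⟩
  intro δ hδ x Y hY
  have hδ0 : 0 < δ := hδ.1
  have hδρ : δ * (Rad + 2) ≤ ρ / 4 := by
    have h1 : δ ≤ ρ / (4 * (Rad + 2)) := hδ.2.trans (min_le_right _ _)
    calc δ * (Rad + 2) ≤ ρ / (4 * (Rad + 2)) * (Rad + 2) := by gcongr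
      _ = ρ / 4 := by field_simp
  have hsmall : ∀ Y' : E n, ‖Y'‖ < Rad + 1 → ‖δ • Y'‖ ≤ ρ / 4 := by
    intro Y' hY'
    rw [norm_smul, Real.norm_of_nonneg hδ0.le]
    nlinarith
  set ℓ : E n × E n → ℝ := scaledLag B (fun z => G₁ (δ, z)) δ with hℓ
  have hℓs : ContDiff ℝ ∞ ℓ := contDiff_scaledLag B (hG₁.comp (contDiff_const.prodMk contDiff_id)) δ
  have hev : (fun z : E n × E n => L (z.1, δ • z.2)) =ᶠ[nhds (x, Y)] fun z => δ ^ 2 * ℓ z := by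
    have h1 : ∀ᶠ z : E n × E n in nhds (x, Y), ‖z.2‖ < Rad + 1 :=
      (continuous_snd.norm.tendsto (x, Y)).eventually (gt_mem_nhds (by
        simp only; linarith))
    filter_upwards [h1] with z hz
    have h2 := hFG δ z
    have h3 : χ (δ • z.2) = 1 := χ.one_of_mem_closedBall (by
      simpa [χ] using hsmall z.2 hz)
    have h4 : χ₁ z.2 = 1 := χ₁.one_of_mem_closedBall (by simpa [χ₁] using hz.le)
    simp only [F, rt, g, h3, one_mul] at h2
    have h5 : dotP n (B (δ • z.2)) (δ • z.2) = δ ^ 2 * dotP n (B z.2) z.2 := by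
      simp only [← dotL_apply, map_smul, FunLike.coe_smul, Pi.smul_apply, smul_eq_mul]
      ring
    rw [h5] at h2
    simp only [hℓ, scaledLag, G₁, h4, one_mul]
    linarith
  have hYρ : ‖δ • Y‖ < ρ := (hsmall Y (by linarith)).trans_lt (by linarith)
  have hLdiff : DifferentiableAt ℝ L (x, δ • Y) := (hL x _ hYρ).differentiableAt (by simp)
  have hmap : HasFDerivAt (fun z : E n × E n => (z.1, δ • z.2))
      ((ContinuousLinearMap.fst ℝ (E n) (E n)).prod (δ • ContinuousLinearMap.snd ℝ (E n) (E n)))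
      (x, Y) :=
    hasFDerivAt_fst.prodMk (hasFDerivAt_snd.const_smul δ)
  have hd : HasFDerivAt (fun z : E n × E n => L (z.1, δ • z.2)) _ (x, Y) :=
    HasFDerivAt.comp (g := L) (x, Y) hLdiff.hasFDerivAt hmap
  have hd' : HasFDerivAt (fun z : E n × E n => δ ^ 2 * ℓ z) (δ ^ 2 • fderiv ℝ ℓ (x, Y)) (x, Y) :=
    ((hℓs.differentiable (by simp)) (x, Y)).hasFDerivAt.const_mul _
  have hkey := (hd.congr_of_eventuallyEq hev.symm).unique hd'
  have hkey' : ∀ v : E n × E n, dotP n (Q (x, δ • Y)) (v.1 + δ • v.2)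
      - dotP n (P (x, δ • Y)) v.1 = δ ^ 2 * fderiv ℝ ℓ (x, Y) v := by
    intro v
    have := congrArg (fun T => T v) hkey
    simp only [ContinuousLinearMap.comp_apply, ContinuousLinearMap.prod_apply] at this
    rw [hLd x _ hYρ] at this
    simpa using this
  have hdiffℓ : Differentiable ℝ ℓ := hℓs.differentiable (by simp)
  have hQ : Q (x, δ • Y) = δ • gradP n ℓ x Y := by
    refine dotP_ext fun w => ?_
    have h1 := hkey' (0, w)
    have h2 := dotP_gradP hdiffℓ (x, Y) w
    simp only at h2
    simp only [← dotL_apply, map_smul, FunLike.coe_smul, Pi.smul_apply, smul_eq_mul,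
      zero_add, map_zero, sub_zero] at h1 h2 ⊢
    rw [h2]
    apply mul_left_cancel₀ hδ0.ne'
    linarith
  have hP : P (x, δ • Y) = δ • gradP n ℓ x Y - δ ^ 2 • gradX n ℓ x Y := by
    rw [← hQ]
    refine dotP_ext fun w => ?_
    have h1 := hkey' (w, 0)
    have h2 := dotP_gradX hdiffℓ (x, Y) w
    simp only at h2
    simp only [← dotL_apply, map_smul, map_sub, sub_apply, FunLike.coe_smul, Pi.smul_apply, smul_eq_mul,
      add_zero, smul_zero] at h1 h2 ⊢
    rw [h2]
    linarith
  rw [← hP, hf x _ hYρ, hQ]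

end ScaledLagrangian

section TorusMean

open scoped ContDiff

variable {n : ℕ} {F G : Type*} [NormedAddCommGroup F] [NormedSpace ℝ F]
  [NormedAddCommGroup G] [NormedSpace ℝ G]

/-- `ℤⁿ`-periodicity. -/
def IsPer {α : Type*} (f : E n → α) : Prop := ∀ (x : E n) (l : Fin n → ℤ), f (x + intVec l) = f x

lemma IsPer.shift {α : Type*} {f : E n → α} (hf : IsPer f) (h : E n) : IsPer fun x => f (x + h) := by
  intro x l
  simp only
  rw [add_right_comm, hf]

lemma IsPer.comp {α β : Type*} {f : E n → α} (hf : IsPer f) (g : α → β) : IsPer fun x => g (f x) :=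
  fun x l => congrArg g (hf x l)

lemma IsPer.comp₂ {α β γ : Type*} {f : E n → α} {f' : E n → β} (hf : IsPer f) (hf' : IsPer f')
    (g : α → β → γ) : IsPer fun x => g (f x) (f' x) :=
  fun x l => by simp only [hf x l, hf' x l]

lemma IsPer.fderiv {f : E n → F} (hf : IsPer f) : IsPer (fderiv ℝ f) := by
  intro x l
  have h : (fun x => f (x + intVec l)) = f := funext fun x => hf x l
  conv_rhs => rw [← h]
  rw [fderiv_comp_add_right]

lemma IsPer.bounded {f : E n → F} (hf : IsPer f) (hc : Continuous f) : ∃ C, ∀ x, ‖f x‖ ≤ C := by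
  obtain ⟨C, hC⟩ := (isCompact_Icc (a := (0 : E n)) (b := 1)).exists_bound_of_continuousOn
    hc.continuousOn
  refine ⟨C, fun x => ?_⟩
  obtain ⟨y, hy, l, rfl⟩ := exists_intVec_add x
  rw [hf]
  exact hC y hy

def torusProj (n : ℕ) (x : E n) : UnitAddTorus (Fin n) := fun i => (x i : UnitAddCircle)

def torusSec (n : ℕ) (t : UnitAddTorus (Fin n)) : E n := fun i => (AddCircle.equivIoc 1 0 (t i)).1

def torusMeas (n : ℕ) : Measure (UnitAddTorus (Fin n)) :=
  Measure.pi fun _ => (AddCircle.haarAddCircle : Measure UnitAddCircle)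

instance : IsProbabilityMeasure (torusMeas n) := by
  unfold torusMeas
  infer_instance

instance : (torusMeas n).IsAddHaarMeasure := by
  unfold torusMeas
  infer_instance

lemma torusProj_sec (t : UnitAddTorus (Fin n)) : torusProj n (torusSec n t) = t := by
  funext i
  exact (AddCircle.equivIoc (1 : ℝ) 0).symm_apply_apply (t i)

lemma torusProj_add (x y : E n) : torusProj n (x + y) = torusProj n x + torusProj n y := by
  funext i
  simp [torusProj]

lemma isOpenQuotientMap_torusProj : IsOpenQuotientMap (torusProj n) :=
  IsOpenQuotientMap.piMap (f := fun _ (x : ℝ) => (x : UnitAddCircle))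
    fun _ => QuotientAddGroup.isOpenQuotientMap_mk

lemma exists_of_torusProj_eq {x y : E n} (h : torusProj n x = torusProj n y) :
    ∃ l, x = y + intVec l := by
  have h1 : ∀ i, ∃ l : ℤ, x i = y i + l := by
    intro i
    have h2 : ((x i : ℝ) : UnitAddCircle) = (y i : ℝ) := congrFun h i
    rw [← sub_eq_zero, ← AddCircle.coe_sub, AddCircle.coe_eq_zero_iff] at h2
    obtain ⟨l, hl⟩ := h2
    refine ⟨l, ?_⟩
    simp only [zsmul_eq_mul, mul_one] at hl
    linarith
  choose l hl using h1
  exact ⟨l, funext hl⟩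

lemma IsPer.sec_proj {α : Type*} {f : E n → α} (hf : IsPer f) (x : E n) :
    f (torusSec n (torusProj n x)) = f x := by
  obtain ⟨l, hl⟩ := exists_of_torusProj_eq (torusProj_sec (torusProj n x))
  rw [hl, hf]

lemma IsPer.continuous_sec {F : Type*} [NormedAddCommGroup F] {f : E n → F} (hf : IsPer f) (hc : Continuous f) :
    Continuous fun t => f (torusSec n t) := by
  rw [isOpenQuotientMap_torusProj.isQuotientMap.continuous_iff]
  convert hc using 1
  exact funext hf.sec_proj

lemma IsPer.integrable_sec {F : Type*} [NormedAddCommGroup F] {f : E n → F} (hf : IsPer f) (hc : Continuous f) :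
    Integrable (fun t => f (torusSec n t)) (torusMeas n) :=
  (hf.continuous_sec hc).integrable_of_hasCompactSupport
    (HasCompactSupport.of_compactSpace _)

/-- The mean value of a periodic function. -/
def torusMean (f : E n → F) : F := ∫ t, f (torusSec n t) ∂torusMeas n

lemma torusMean_shift {f : E n → F} (hf : IsPer f) (h : E n) :
    torusMean (fun x => f (x + h)) = torusMean f := by
  have h1 : ∀ t, f (torusSec n t + h) = f (torusSec n (t + torusProj n h)) := by
    intro t
    rw [← hf.sec_proj (torusSec n t + h), torusProj_add, torusProj_sec]
  simp only [torusMean, h1]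
  exact integral_add_right_eq_self (fun t => f (torusSec n t)) (torusProj n h)

lemma torusMean_const [CompleteSpace F] (c : F) : torusMean (fun _ : E n => c) = c := by
  simp [torusMean]

lemma torusMean_add {f g : E n → F} (hf : IsPer f) (hfc : Continuous f) (hg : IsPer g)
    (hgc : Continuous g) : torusMean (fun x => f x + g x) = torusMean f + torusMean g :=
  integral_add (hf.integrable_sec hfc) (hg.integrable_sec hgc)

lemma torusMean_sub {f g : E n → F} (hf : IsPer f) (hfc : Continuous f) (hg : IsPer g)
    (hgc : Continuous g) : torusMean (fun x => f x - g x) = torusMean f - torusMean g :=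
  integral_sub (hf.integrable_sec hfc) (hg.integrable_sec hgc)

lemma torusMean_smul (c : ℝ) (f : E n → F) : torusMean (fun x => c • f x) = c • torusMean f :=
  integral_smul c _

lemma torusMean_clm [CompleteSpace F] [CompleteSpace G] (T : F →L[ℝ] G) {f : E n → F}
    (hf : IsPer f) (hc : Continuous f) : torusMean (fun x => T (f x)) = T (torusMean f) :=
  T.integral_comp_comm (hf.integrable_sec hc)

lemma norm_torusMean_le {f : E n → F} {C : ℝ} (hC : ∀ x, ‖f x‖ ≤ C) : ‖torusMean f‖ ≤ C := by
  have := norm_integral_le_of_norm_le_const (μ := torusMeas n)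
    (Eventually.of_forall fun t => hC (torusSec n t))
  simpa [torusMean] using this

lemma torusMean_fderiv [CompleteSpace F] {f : E n → F} (hf : IsPer f) (hs : ContDiff ℝ ∞ f)
    (v : E n) : torusMean (fun x => fderiv ℝ f x v) = 0 := by
  have hdc : Continuous fun x => fderiv ℝ f x v :=
    (hs.continuous_fderiv (by simp)).clm_apply continuous_const
  have hdp : IsPer fun x => fderiv ℝ f x v := hf.fderiv.comp fun T => T v
  obtain ⟨C, hC⟩ := hdp.bounded hdc
  have h1 : HasDerivAt (fun s : ℝ => ∫ t, f (torusSec n t + s • v) ∂torusMeas n)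
      (∫ t, fderiv ℝ f (torusSec n t + (0 : ℝ) • v) v ∂torusMeas n) 0 := by
    refine (hasDerivAt_integral_of_dominated_loc_of_deriv_le (μ := torusMeas n)
      (F' := fun s t => fderiv ℝ f (torusSec n t + s • v) v) (bound := fun _ => C)
      (s := Set.univ) Filter.univ_mem ?_ ?_ ?_ ?_ ?_ ?_).2
    · exact Eventually.of_forall fun s =>
        ((hf.shift (s • v)).integrable_sec (by fun_prop)).aestronglyMeasurable
    · exact (hf.shift ((0 : ℝ) • v)).integrable_sec (by fun_prop)
    · exact ((hdp.shift ((0 : ℝ) • v)).integrable_sec (by fun_prop)).aestronglyMeasurable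
    · exact Eventually.of_forall fun t s _ => hC _
    · exact integrable_const C
    · refine Eventually.of_forall fun t s _ => ?_
      have h2 : HasDerivAt (fun s : ℝ => torusSec n t + s • v) v s := by
        simpa using ((hasDerivAt_id s).smul_const v).const_add (torusSec n t)
      exact ((hs.differentiable (by simp)) _).hasFDerivAt.comp_hasDerivAt s h2
  have h3 : (fun s : ℝ => ∫ t, f (torusSec n t + s • v) ∂torusMeas n) = fun _ => torusMean f :=
    funext fun s => torusMean_shift hf (s • v)
  rw [h3] at h1
  have := h1.unique (hasDerivAt_const 0 _)
  simpa [torusMean] using this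

end TorusMean

section FourierOperator

open scoped ContDiff

variable {n : ℕ} {F : Type*} [NormedAddCommGroup F] [NormedSpace ℝ F]

/-- The linear phase `x ↦ 2π ⟨k, x⟩`. -/
def phase (k : Fin n → ℤ) : E n →L[ℝ] ℝ := (2 * Real.pi) • dotL n (intVec k)

lemma phase_apply (k : Fin n → ℤ) (x : E n) : phase k x = 2 * Real.pi * dotP n (intVec k) x := by
  simp [phase, dotL_apply]

lemma phase_intVec (k l : Fin n → ℤ) :
    phase k (intVec l) = ((∑ i, k i * l i : ℤ) : ℝ) * (2 * Real.pi) := by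
  simp [phase_apply, dotP, intVec, mul_comm]

lemma norm_phase_le (k : Fin n → ℤ) : ‖phase k‖ ≤ 2 * Real.pi * n * ‖intVec k‖ := by
  refine ContinuousLinearMap.opNorm_le_bound _ (by positivity) fun x => ?_
  rw [phase_apply, norm_mul, Real.norm_of_nonneg (by positivity), Real.norm_eq_abs]
  have := abs_dotP_le (intVec k) x
  calc 2 * Real.pi * |dotP n (intVec k) x| ≤ 2 * Real.pi * (n * (‖intVec k‖ * ‖x‖)) := by gcongr
    _ = _ := by ring

lemma isPer_cos_phase (k : Fin n → ℤ) : IsPer fun x => Real.cos (phase k x) := by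
  intro x l
  simp only
  rw [map_add, phase_intVec, Real.cos_add_int_mul_two_pi]

lemma isPer_sin_phase (k : Fin n → ℤ) : IsPer fun x => Real.sin (phase k x) := by
  intro x l
  simp only
  rw [map_add, phase_intVec, Real.sin_add_int_mul_two_pi]

def cosC (k : Fin n → ℤ) (f : E n → F) : F := torusMean fun x => Real.cos (phase k x) • f x

def sinC (k : Fin n → ℤ) (f : E n → F) : F := torusMean fun x => Real.sin (phase k x) • f x

lemma cosC_zero (f : E n → F) : cosC 0 f = torusMean f := by
  simp [cosC, phase_apply, dotP, intVec]

lemma sinC_zero (f : E n → F) : sinC 0 f = 0 := by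
  simp [sinC, torusMean, phase_apply, dotP, intVec]

lemma norm_cosC_le (k : Fin n → ℤ) {f : E n → F} {C : ℝ} (hC : ∀ x, ‖f x‖ ≤ C) :
    ‖cosC k f‖ ≤ C := by
  refine norm_torusMean_le fun x => ?_
  rw [norm_smul]
  exact (mul_le_of_le_one_left (norm_nonneg _) (Real.abs_cos_le_one _)).trans (hC x)

lemma norm_sinC_le (k : Fin n → ℤ) {f : E n → F} {C : ℝ} (hC : ∀ x, ‖f x‖ ≤ C) :
    ‖sinC k f‖ ≤ C := by
  refine norm_torusMean_le fun x => ?_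
  rw [norm_smul]
  exact (mul_le_of_le_one_left (norm_nonneg _) (Real.abs_sin_le_one _)).trans (hC x)

lemma cosC_fderiv [CompleteSpace F] (k : Fin n → ℤ) {f : E n → F} (hf : IsPer f)
    (hs : ContDiff ℝ ∞ f) (v : E n) :
    cosC k (fun x => fderiv ℝ f x v) = phase k v • sinC k f := by
  have hc : ContDiff ℝ ∞ fun x : E n => Real.cos (phase k x) := by fun_prop
  have hd : ∀ x, fderiv ℝ (fun x => Real.cos (phase k x) • f x) x v =
      Real.cos (phase k x) • fderiv ℝ f x v - phase k v • (Real.sin (phase k x) • f x) := by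
    intro x
    have h1 : HasFDerivAt (fun x : E n => Real.cos (phase k x))
        (-Real.sin (phase k x) • phase k) x := (phase k).hasFDerivAt.cos
    rw [(h1.fun_smul ((hs.differentiable (by simp)) x).hasFDerivAt).fderiv]
    simp only [add_apply, FunLike.coe_smul, Pi.smul_apply,
      ContinuousLinearMap.smulRight_apply, smul_eq_mul]
    module
  have h0 := torusMean_fderiv ((isPer_cos_phase k).comp₂ hf (· • ·)) (hc.smul hs) v
  simp only [hd] at h0
  have hfc := hs.continuous
  have hdc : Continuous fun x => fderiv ℝ f x v :=
    (hs.continuous_fderiv (by simp)).clm_apply continuous_const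
  rw [torusMean_sub, torusMean_smul, sub_eq_zero] at h0
  · exact h0
  · exact (isPer_cos_phase k).comp₂ (hf.fderiv.comp fun T => T v) (· • ·)
  · fun_prop
  · exact (((isPer_sin_phase k).comp₂ hf (· • ·))).comp fun y => phase k v • y
  · fun_prop

lemma sinC_fderiv [CompleteSpace F] (k : Fin n → ℤ) {f : E n → F} (hf : IsPer f)
    (hs : ContDiff ℝ ∞ f) (v : E n) :
    sinC k (fun x => fderiv ℝ f x v) = -(phase k v • cosC k f) := by
  have hc : ContDiff ℝ ∞ fun x : E n => Real.sin (phase k x) := by fun_prop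
  have hd : ∀ x, fderiv ℝ (fun x => Real.sin (phase k x) • f x) x v =
      Real.sin (phase k x) • fderiv ℝ f x v + phase k v • (Real.cos (phase k x) • f x) := by
    intro x
    have h1 : HasFDerivAt (fun x : E n => Real.sin (phase k x))
        (Real.cos (phase k x) • phase k) x := (phase k).hasFDerivAt.sin
    rw [(h1.fun_smul ((hs.differentiable (by simp)) x).hasFDerivAt).fderiv]
    simp [smul_smul, mul_comm]
  have h0 := torusMean_fderiv ((isPer_sin_phase k).comp₂ hf (· • ·)) (hc.smul hs) v
  simp only [hd] at h0
  have hfc := hs.continuous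
  have hdc : Continuous fun x => fderiv ℝ f x v :=
    (hs.continuous_fderiv (by simp)).clm_apply continuous_const
  rw [torusMean_add, torusMean_smul] at h0
  · exact eq_neg_of_add_eq_zero_left h0
  · exact (isPer_sin_phase k).comp₂ (hf.fderiv.comp fun T => T v) (· • ·)
  · fun_prop
  · exact (((isPer_cos_phase k).comp₂ hf (· • ·))).comp fun y => phase k v • y
  · fun_prop

lemma exists_abs_eq_norm_intVec {k : Fin n → ℤ} (hk : k ≠ 0) :
    ∃ i, ‖intVec k‖ = |(k i : ℝ)| ∧ 1 ≤ |(k i : ℝ)| := by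
  obtain ⟨i₀, hi₀⟩ := Function.ne_iff.1 hk
  have : Nonempty (Fin n) := ⟨i₀⟩
  obtain ⟨i, hi⟩ := Finite.exists_max fun i => ‖intVec k i‖
  have h1 : ‖intVec k‖ = ‖intVec k i‖ :=
    le_antisymm ((pi_norm_le_iff_of_nonneg (norm_nonneg _)).2 hi) (norm_le_pi_norm _ i)
  refine ⟨i, h1, le_trans ?_ (hi i₀)⟩
  have h2 : (1 : ℤ) ≤ |k i₀| := Int.one_le_abs hi₀
  have h3 : ((1 : ℤ) : ℝ) ≤ |(k i₀ : ℝ)| := by rw [← Int.cast_abs]; exact_mod_cast h2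
  simpa [intVec] using h3

lemma norm_pow_mul_coeff_le [CompleteSpace F] {k : Fin n → ℤ} (hk : k ≠ 0) (p : ℕ) :
    ∀ {f : E n → F}, IsPer f → ContDiff ℝ ∞ f → ∀ {D : ℝ},
    (∀ x, ‖iteratedFDeriv ℝ p f x‖ ≤ D) →
    ‖intVec k‖ ^ p * ‖cosC k f‖ ≤ D ∧ ‖intVec k‖ ^ p * ‖sinC k f‖ ≤ D := by
  obtain ⟨i, hi, hi1⟩ := exists_abs_eq_norm_intVec hk
  have hph : ∀ c : F, ‖intVec k‖ * ‖c‖ ≤ ‖phase k (Pi.single i 1) • c‖ := by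
    intro c
    rw [norm_smul, hi]
    gcongr
    have : dotP n (intVec k) (Pi.single i 1) = k i := by simp [dotP, intVec, Pi.single_apply]
    rw [phase_apply, this, norm_mul, Real.norm_of_nonneg (by positivity), Real.norm_eq_abs]
    have := Real.pi_gt_three
    nlinarith [abs_nonneg (k i : ℝ)]
  induction p with
  | zero =>
    intro f hf hs D hD
    simp only [norm_iteratedFDeriv_zero] at hD
    simpa using ⟨norm_cosC_le k hD, norm_sinC_le k hD⟩
  | succ p ih =>
    intro f hf hs D hD
    have h1 : ContDiff ℝ ∞ fun x => fderiv ℝ f x (Pi.single i 1) :=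
      (hs.fderiv_right (m := ∞) (by simp)).clm_apply contDiff_const
    obtain ⟨h2, h3⟩ := ih (f := fun x => fderiv ℝ f x (Pi.single i 1))
      (hf.fderiv.comp fun T => T (Pi.single i 1)) h1 (D := D) fun x => by
        refine (norm_iteratedFDeriv_clm_apply_const (N := ∞)
          (hs.fderiv_right (m := ∞) (by simp)).contDiffAt (by exact_mod_cast le_top)).trans ?_
        rw [norm_iteratedFDeriv_fderiv]
        have : ‖(Pi.single i 1 : E n)‖ = 1 := by rw [Pi.norm_single, norm_one]
        rw [this, one_mul]
        exact hD x
    rw [cosC_fderiv k hf hs] at h2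
    rw [sinC_fderiv k hf hs, norm_neg] at h3
    have h4 : 0 ≤ ‖intVec k‖ ^ p := by positivity
    constructor
    · rw [pow_succ, mul_assoc]
      exact (mul_le_mul_of_nonneg_left (hph _) h4).trans h3
    · rw [pow_succ, mul_assoc]
      exact (mul_le_mul_of_nonneg_left (hph _) h4).trans h2

lemma one_add_norm_pow_mul_coeff_le [CompleteSpace F] (k : Fin n → ℤ) (p : ℕ) {f : E n → F}
    (hf : IsPer f) (hs : ContDiff ℝ ∞ f) {D₀ D : ℝ} (hD₀ : ∀ x, ‖f x‖ ≤ D₀)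
    (hD : ∀ x, ‖iteratedFDeriv ℝ p f x‖ ≤ D) :
    (1 + ‖intVec k‖) ^ p * (‖cosC k f‖ + ‖sinC k f‖) ≤ 2 ^ (p + 1) * (D₀ + D) := by
  have hD₀' : 0 ≤ D₀ := (norm_nonneg _).trans (hD₀ 0)
  have hD' : 0 ≤ D := (norm_nonneg _).trans (hD 0)
  have h2 : (1 : ℝ) ≤ 2 ^ p := one_le_pow₀ (by norm_num)
  by_cases hk : k = 0
  · subst hk
    have h0 : ‖intVec (0 : Fin n → ℤ)‖ = 0 := by
      rw [norm_eq_zero]; funext i; simp [intVec]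
    have h1 := norm_cosC_le 0 hD₀
    rw [sinC_zero, h0]
    simp only [norm_zero, add_zero, one_pow, one_mul]
    rw [pow_succ]
    nlinarith
  · obtain ⟨i, hi, hi1⟩ := exists_abs_eq_norm_intVec hk
    obtain ⟨h3, h4⟩ := norm_pow_mul_coeff_le hk p hf hs hD
    have h5 : (1 + ‖intVec k‖) ^ p ≤ (2 * ‖intVec k‖) ^ p := by
      gcongr
      rw [hi]
      linarith
    calc (1 + ‖intVec k‖) ^ p * (‖cosC k f‖ + ‖sinC k f‖)
        ≤ (2 * ‖intVec k‖) ^ p * (‖cosC k f‖ + ‖sinC k f‖) := by gcongr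
      _ = 2 ^ p * (‖intVec k‖ ^ p * ‖cosC k f‖ + ‖intVec k‖ ^ p * ‖sinC k f‖) := by
        rw [mul_pow]; ring
      _ ≤ 2 ^ p * (D + D) := by gcongr
      _ ≤ 2 ^ (p + 1) * (D₀ + D) := by rw [pow_succ]; nlinarith

/-- The circular motion with complex amplitude `μ` in the plane spanned by `a` and `b`. -/
def circ (a b : F) (μ : ℂ) (t : ℝ) : F :=
  (μ * Complex.exp (t * Complex.I)).re • a + (μ * Complex.exp (t * Complex.I)).im • b

lemma hasDerivAt_circ (a b : F) (μ : ℂ) (t : ℝ) :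
    HasDerivAt (circ a b μ) (circ a b (Complex.I * μ) t) t := by
  have h1 : HasDerivAt (fun t : ℝ => μ * Complex.exp (t * Complex.I))
      (Complex.I * μ * Complex.exp (t * Complex.I)) t := by
    have h2 : HasDerivAt (fun t : ℝ => (t : ℂ) * Complex.I) Complex.I t := by
      simpa using (Complex.ofRealCLM.hasDerivAt (x := t)).mul_const Complex.I
    have h3 := h2.cexp.const_mul μ
    rwa [show μ * (Complex.exp (t * Complex.I) * Complex.I) =
      Complex.I * μ * Complex.exp (t * Complex.I) by ring] at h3
  have hre := Complex.reCLM.hasFDerivAt.comp_hasDerivAt t h1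
  have him := Complex.imCLM.hasFDerivAt.comp_hasDerivAt t h1
  exact (hre.smul_const a).add (him.smul_const b)

lemma contDiff_circ (a b : F) (μ : ℂ) : ContDiff ℝ ∞ (circ a b μ) := by
  have h1 : ContDiff ℝ ∞ fun t : ℝ => μ * Complex.exp (t * Complex.I) := by
    have : ContDiff ℝ ∞ fun t : ℝ => (t : ℂ) := Complex.ofRealCLM.contDiff
    exact contDiff_const.mul ((this.mul contDiff_const).cexp)
  exact ((Complex.reCLM.contDiff.comp h1).smul contDiff_const).add
    ((Complex.imCLM.contDiff.comp h1).smul contDiff_const)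

lemma iteratedDeriv_circ (a b : F) (j : ℕ) :
    ∀ μ : ℂ, iteratedDeriv j (circ a b μ) = circ a b (Complex.I ^ j * μ) := by
  induction j with
  | zero => intro μ; simp
  | succ j ih =>
    intro μ
    rw [iteratedDeriv_succ', show deriv (circ a b μ) = circ a b (Complex.I * μ) from
      funext fun t => (hasDerivAt_circ a b μ t).deriv, ih, pow_succ, mul_assoc]

lemma norm_circ_le (a b : F) (μ : ℂ) (t : ℝ) : ‖circ a b μ t‖ ≤ ‖μ‖ * (‖a‖ + ‖b‖) := by
  have h1 : ‖μ * Complex.exp (t * Complex.I)‖ = ‖μ‖ := by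
    rw [norm_mul, Complex.norm_exp_ofReal_mul_I, mul_one]
  refine (norm_add_le _ _).trans ?_
  rw [norm_smul, norm_smul, mul_add, ← h1]
  gcongr
  · exact Complex.abs_re_le_norm _
  · exact Complex.abs_im_le_norm _

/-- The `k`-th Fourier mode of `f`, multiplied by `μ`. -/
def fmode (μ : ℂ) (k : Fin n → ℤ) (f : E n → F) (x : E n) : F :=
  circ (cosC k f) (sinC k f) μ (phase k x)

lemma contDiff_fmode (μ : ℂ) (k : Fin n → ℤ) (f : E n → F) : ContDiff ℝ ∞ (fmode μ k f) :=
  (contDiff_circ _ _ _).comp (phase k).contDiff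

lemma norm_iteratedFDeriv_fmode_le (μ : ℂ) (k : Fin n → ℤ) (f : E n → F) (j : ℕ) (x : E n) :
    ‖iteratedFDeriv ℝ j (fmode μ k f) x‖ ≤
      (2 * Real.pi * n) ^ j * (‖μ‖ * (1 + ‖intVec k‖) ^ j * (‖cosC k f‖ + ‖sinC k f‖)) := by
  have h1 := (phase k).iteratedFDeriv_comp_right
    (contDiff_circ (cosC k f) (sinC k f) μ) x (i := j) (by exact_mod_cast le_top)
  have h2 : fmode μ k f = circ (cosC k f) (sinC k f) μ ∘ phase k := rfl
  rw [h2, h1]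
  refine (ContinuousMultilinearMap.norm_compContinuousLinearMap_le _ _).trans ?_
  rw [norm_iteratedFDeriv_eq_norm_iteratedDeriv, iteratedDeriv_circ, Finset.prod_const,
    Finset.card_univ, Fintype.card_fin]
  have h3 := norm_circ_le (cosC k f) (sinC k f) (Complex.I ^ j * μ) (phase k x)
  rw [norm_mul, norm_pow, Complex.norm_I, one_pow, one_mul] at h3
  calc _ ≤ ‖μ‖ * (‖cosC k f‖ + ‖sinC k f‖) * (2 * Real.pi * n * (1 + ‖intVec k‖)) ^ j := by
        gcongr
        refine (norm_phase_le k).trans ?_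
        gcongr
        linarith
    _ = _ := by rw [mul_pow]; ring

lemma fmode_add_right (μ : ℂ) (k : Fin n → ℤ) (f : E n → F) (x h : E n) :
    fmode μ k f (x + h) = fmode (μ * Complex.exp (phase k h * Complex.I)) k f x := by
  simp only [fmode, circ, map_add, Complex.ofReal_add, add_mul, Complex.exp_add]
  rw [mul_comm (Complex.exp (phase k x * Complex.I)), ← mul_assoc]

lemma isPer_fmode (μ : ℂ) (k : Fin n → ℤ) (f : E n → F) : IsPer (fmode μ k f) := by
  intro x l
  rw [fmode_add_right, phase_intVec]
  congr 1
  have : Complex.exp ((((∑ i, k i * l i : ℤ) : ℝ) * (2 * Real.pi) : ℝ) * Complex.I) = 1 := by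
    rw [Complex.exp_eq_one_iff]
    exact ⟨∑ i, k i * l i, by push_cast; ring⟩
  rw [this, mul_one]

lemma cosC_shift (k : Fin n → ℤ) {f : E n → F} (hf : IsPer f) (hc : Continuous f) (h : E n) :
    cosC k (fun x => f (x + h)) =
      Real.cos (phase k h) • cosC k f + Real.sin (phase k h) • sinC k f := by
  have h1 : (fun x => Real.cos (phase k x) • f (x + h)) =
      fun x => (fun y => Real.cos (phase k h) • Real.cos (phase k y) • f y
        + Real.sin (phase k h) • Real.sin (phase k y) • f y) (x + h) := by
    funext x
    simp only [smul_smul, ← add_smul]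
    congr 1
    rw [map_add, ← Real.cos_sub]
    rw [← Real.cos_neg]
    congr 1
    ring
  have hp1 := ((isPer_cos_phase k).comp₂ hf (· • ·)).comp fun y => Real.cos (phase k h) • y
  have hp2 := ((isPer_sin_phase k).comp₂ hf (· • ·)).comp fun y => Real.sin (phase k h) • y
  rw [cosC, h1, torusMean_shift (hp1.comp₂ hp2 (· + ·)), torusMean_add hp1 (by fun_prop) hp2
    (by fun_prop), torusMean_smul, torusMean_smul]
  rfl

lemma sinC_shift (k : Fin n → ℤ) {f : E n → F} (hf : IsPer f) (hc : Continuous f) (h : E n) :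
    sinC k (fun x => f (x + h)) =
      Real.cos (phase k h) • sinC k f - Real.sin (phase k h) • cosC k f := by
  have h1 : (fun x => Real.sin (phase k x) • f (x + h)) =
      fun x => (fun y => Real.cos (phase k h) • Real.sin (phase k y) • f y
        - Real.sin (phase k h) • Real.cos (phase k y) • f y) (x + h) := by
    funext x
    simp only [smul_smul, ← sub_smul]
    congr 1
    rw [map_add, mul_comm, mul_comm (Real.sin (phase k h)), ← Real.sin_sub]
    congr 1
    ring
  have hp1 := ((isPer_sin_phase k).comp₂ hf (· • ·)).comp fun y => Real.cos (phase k h) • y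
  have hp2 := ((isPer_cos_phase k).comp₂ hf (· • ·)).comp fun y => Real.sin (phase k h) • y
  rw [sinC, h1, torusMean_shift (hp1.comp₂ hp2 (· - ·)), torusMean_sub hp1 (by fun_prop) hp2
    (by fun_prop), torusMean_smul, torusMean_smul]
  rfl

lemma fmode_shift (μ : ℂ) (k : Fin n → ℤ) {f : E n → F} (hf : IsPer f) (hc : Continuous f)
    (h x : E n) : fmode μ k (fun x => f (x + h)) x = fmode μ k f (x + h) := by
  rw [fmode_add_right]
  simp only [fmode, circ, cosC_shift k hf hc, sinC_shift k hf hc]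
  have h1 : μ * Complex.exp (phase k h * Complex.I) * Complex.exp (phase k x * Complex.I) =
      μ * Complex.exp (phase k x * Complex.I) * Complex.exp (phase k h * Complex.I) := by ring
  rw [h1]
  generalize μ * Complex.exp (phase k x * Complex.I) = z
  rw [Complex.mul_re, Complex.mul_im, Complex.exp_ofReal_mul_I_re, Complex.exp_ofReal_mul_I_im]
  module

end FourierOperator

section FourierSeries

open scoped ContDiff

variable {n : ℕ} {F G : Type*} [NormedAddCommGroup F] [NormedSpace ℝ F]
  [NormedAddCommGroup G] [NormedSpace ℝ G]

lemma summable_intVec : Summable fun k : Fin n → ℤ => ((1 + ‖intVec k‖) ^ (n + 1))⁻¹ := by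
  let b := Pi.basisFun ℝ (Fin n)
  let L := Submodule.span ℤ (Set.range b)
  have hmem : ∀ k : Fin n → ℤ, intVec k ∈ L := by
    intro k
    have : intVec k = ∑ i, k i • b i := by
      funext j
      simp [intVec, b, Finset.sum_apply, Pi.single_apply]
    rw [this]
    exact Submodule.sum_mem _ fun i _ => Submodule.smul_mem _ _ (Submodule.subset_span ⟨i, rfl⟩)
  have hr : Module.finrank ℤ L = n := by
    rw [ZLattice.rank ℝ L]
    simp
  have h1 := ZLattice.summable_norm_rpow L (-((n + 1 : ℕ) : ℝ)) (by rw [hr]; push_cast; linarith)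
  have h2 : Summable fun k : Fin n → ℤ => ‖intVec k‖ ^ (-((n + 1 : ℕ) : ℝ)) := by
    refine h1.comp_injective (i := fun k : Fin n → ℤ => (⟨intVec k, hmem k⟩ : L)) ?_
    intro k l hkl
    funext i
    have := congrFun (Subtype.ext_iff.1 hkl) i
    simpa [intVec] using this
  refine Summable.of_norm_bounded_eventually h2 ?_
  have h3 : ∀ᶠ k : Fin n → ℤ in cofinite, k ≠ 0 := by
    simp [Filter.eventually_cofinite]
  filter_upwards [h3] with k hk
  obtain ⟨i, hi, hi1⟩ := exists_abs_eq_norm_intVec hk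
  rw [Real.rpow_neg (norm_nonneg _), Real.rpow_natCast, Real.norm_of_nonneg (by positivity)]
  have : 0 < ‖intVec k‖ := by rw [hi]; linarith
  gcongr
  linarith

def latSum (n : ℕ) : ℝ := ∑' k : Fin n → ℤ, ((1 + ‖intVec k‖) ^ (n + 1))⁻¹

lemma latSum_nonneg : 0 ≤ latSum n := tsum_nonneg fun _ => by positivity

/-- The Fourier multiplier with symbol `μ`. -/
def fop (μ : (Fin n → ℤ) → ℂ) (f : E n → F) (x : E n) : F := ∑' k, fmode (μ k) k f x

def SlowGrowth (μ : (Fin n → ℤ) → ℂ) (Λ : ℝ) (q : ℕ) : Prop :=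
  ∀ k, ‖μ k‖ ≤ Λ * (1 + ‖intVec k‖) ^ q

lemma fop_aux [CompleteSpace F] {μ : (Fin n → ℤ) → ℂ} {f : E n → F} {c : ℕ → ℝ}
    (h : ∀ j k, ‖μ k‖ * (‖cosC k f‖ + ‖sinC k f‖) * (1 + ‖intVec k‖) ^ (j + (n + 1)) ≤ c j) :
    ContDiff ℝ ∞ (fop μ f) ∧ (∀ x, Summable fun k => fmode (μ k) k f x) ∧
      ∀ j x, ‖iteratedFDeriv ℝ j (fop μ f) x‖ ≤ (2 * Real.pi * n) ^ j * latSum n * c j := by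
  let v : ℕ → (Fin n → ℤ) → ℝ := fun j k =>
    (2 * Real.pi * n) ^ j * c j * ((1 + ‖intVec k‖) ^ (n + 1))⁻¹
  have hv : ∀ j, Summable (v j) := fun j => summable_intVec.mul_left _
  have hb : ∀ j k x, ‖iteratedFDeriv ℝ j (fmode (μ k) k f) x‖ ≤ v j k := by
    intro j k x
    refine (norm_iteratedFDeriv_fmode_le _ _ _ _ _).trans ?_
    simp only [v]
    rw [mul_assoc _ (c j)]
    refine mul_le_mul_of_nonneg_left ?_ (by positivity)
    rw [← div_eq_mul_inv, le_div_iff₀ (by positivity)]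
    refine le_trans (le_of_eq ?_) (h j k)
    rw [pow_add]
    ring
  have hs : ∀ k, ContDiff ℝ ∞ (fmode (μ k) k f) := fun k => contDiff_fmode _ _ _
  refine ⟨contDiff_tsum (v := v) hs (fun j _ => hv j) fun j k x _ => hb j k x, fun x => ?_, ?_⟩
  · refine Summable.of_norm_bounded (hv 0) fun k => ?_
    have := hb 0 k x
    rwa [norm_iteratedFDeriv_zero] at this
  · intro j x
    have h1 : iteratedFDeriv ℝ j (fop μ f) x = ∑' k, iteratedFDeriv ℝ j (fmode (μ k) k f) x :=
      iteratedFDeriv_tsum_apply (v := v) hs (fun j _ => hv j) (fun j k x _ => hb j k x)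
        (by exact_mod_cast le_top) x
    rw [h1]
    refine (tsum_of_norm_bounded (hv j).hasSum fun k => hb j k x).trans (le_of_eq ?_)
    simp only [v]
    rw [tsum_mul_left, latSum]
    ring

lemma fop_bound [CompleteSpace F] {μ : (Fin n → ℤ) → ℂ} {Λ : ℝ} {q : ℕ}
    (hμ : SlowGrowth μ Λ q) {f : E n → F} (hf : IsPer f) (hs : ContDiff ℝ ∞ f) {D : ℕ → ℝ}
    (hD : ∀ p x, ‖iteratedFDeriv ℝ p f x‖ ≤ D p) :
    ContDiff ℝ ∞ (fop μ f) ∧ (∀ x, Summable fun k => fmode (μ k) k f x) ∧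
      ∀ j x, ‖iteratedFDeriv ℝ j (fop μ f) x‖ ≤ (2 * Real.pi * n) ^ j * latSum n *
        (Λ * (2 ^ (j + (n + 1) + q + 1) * (D 0 + D (j + (n + 1) + q)))) := by
  refine fop_aux fun j k => ?_
  have h1 := one_add_norm_pow_mul_coeff_le k (j + (n + 1) + q) hf hs (D₀ := D 0)
    (fun x => by simpa using hD 0 x) (hD _)
  have hΛ : 0 ≤ Λ := by
    have := (norm_nonneg _).trans (hμ k)
    exact nonneg_of_mul_nonneg_left this (by positivity)
  calc _ ≤ Λ * (1 + ‖intVec k‖) ^ q * (‖cosC k f‖ + ‖sinC k f‖)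
        * (1 + ‖intVec k‖) ^ (j + (n + 1)) := by gcongr; exact hμ k
    _ = Λ * ((1 + ‖intVec k‖) ^ (j + (n + 1) + q) * (‖cosC k f‖ + ‖sinC k f‖)) := by ring
    _ ≤ _ := by gcongr

lemma exists_iteratedFDeriv_bound {f : E n → F} (hf : IsPer f) (hs : ContDiff ℝ ∞ f) :
    ∃ D : ℕ → ℝ, ∀ p x, ‖iteratedFDeriv ℝ p f x‖ ≤ D p := by
  have h : ∀ p, ∃ D, ∀ x, ‖iteratedFDeriv ℝ p f x‖ ≤ D := by
    intro p
    refine IsPer.bounded (fun x l => ?_) (hs.continuous_iteratedFDeriv (by exact_mod_cast le_top))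
    have h : (fun x => f (x + intVec l)) = f := funext fun x => hf x l
    conv_rhs => rw [← h]
    rw [iteratedFDeriv_comp_add_right]
  choose D hD using h
  exact ⟨D, hD⟩

lemma contDiff_fop [CompleteSpace F] {μ : (Fin n → ℤ) → ℂ} {Λ : ℝ} {q : ℕ}
    (hμ : SlowGrowth μ Λ q) {f : E n → F} (hf : IsPer f) (hs : ContDiff ℝ ∞ f) :
    ContDiff ℝ ∞ (fop μ f) := by
  obtain ⟨D, hD⟩ := exists_iteratedFDeriv_bound hf hs
  exact (fop_bound hμ hf hs hD).1

lemma summable_fmode [CompleteSpace F] {μ : (Fin n → ℤ) → ℂ} {Λ : ℝ} {q : ℕ}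
    (hμ : SlowGrowth μ Λ q) {f : E n → F} (hf : IsPer f) (hs : ContDiff ℝ ∞ f) (x : E n) :
    Summable fun k => fmode (μ k) k f x := by
  obtain ⟨D, hD⟩ := exists_iteratedFDeriv_bound hf hs
  exact (fop_bound hμ hf hs hD).2.1 x

lemma isPer_fop (μ : (Fin n → ℤ) → ℂ) (f : E n → F) : IsPer (fop μ f) := by
  intro x l
  simp only [fop, isPer_fmode _ _ _ x l]

/-- The sharp low-pass filter at frequency `M`. -/
def lowSym (n : ℕ) (M : ℝ) (k : Fin n → ℤ) : ℂ := if ‖intVec k‖ ≤ M then 1 else 0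

lemma lowSym_slowGrowth (M : ℝ) : SlowGrowth (lowSym n M) 1 0 := by
  intro k
  unfold lowSym
  split_ifs <;> simp

lemma one_sub_lowSym_slowGrowth {M : ℝ} (hM : 1 ≤ M) (q : ℕ) :
    SlowGrowth (fun k => 1 - lowSym n M k) ((M ^ q)⁻¹) q := by
  intro k
  simp only [lowSym]
  split_ifs with h
  · simp only [sub_self, norm_zero]; positivity
  · simp only [sub_zero, norm_one]
    rw [← div_eq_inv_mul, one_le_div (by positivity)]
    gcongr
    linarith

lemma fop_lowSym_bound [CompleteSpace F] {M : ℝ} (hM : 1 ≤ M) {f : E n → F} {D : ℝ}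
    (hD : ∀ x, ‖f x‖ ≤ D) (j : ℕ) (x : E n) :
    ‖iteratedFDeriv ℝ j (fop (lowSym n M) f) x‖ ≤
      (2 * Real.pi * n) ^ j * latSum n * (2 ^ (j + (n + 1) + 1)) * (M ^ (j + (n + 1)) * D) := by
  have hD0 : 0 ≤ D := (norm_nonneg _).trans (hD 0)
  have h := (fop_aux (μ := lowSym n M) (f := f)
    (c := fun j => 2 ^ (j + (n + 1) + 1) * (M ^ (j + (n + 1)) * D)) fun j k => ?_).2.2 j x
  · refine h.trans (le_of_eq ?_)
    ring
  · unfold lowSym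
    split_ifs with h
    · have h1 := norm_cosC_le k hD
      have h2 := norm_sinC_le k hD
      rw [norm_one, one_mul]
      calc _ ≤ (D + D) * (2 * M) ^ (j + (n + 1)) := by
            gcongr
            linarith
        _ = _ := by rw [mul_pow, pow_succ]; ring
    · simp only [norm_zero, zero_mul]
      positivity

lemma clm_fmode [CompleteSpace F] [CompleteSpace G] (T : F →L[ℝ] G) (μ : ℂ) (k : Fin n → ℤ)
    {f : E n → F} (hf : IsPer f) (hc : Continuous f) (x : E n) :
    T (fmode μ k f x) = fmode μ k (fun x => T (f x)) x := by
  have h1 : cosC k (fun x => T (f x)) = T (cosC k f) := by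
    unfold cosC
    rw [← torusMean_clm T ((isPer_cos_phase k).comp₂ hf (· • ·)) (by fun_prop)]
    simp
  have h2 : sinC k (fun x => T (f x)) = T (sinC k f) := by
    unfold sinC
    rw [← torusMean_clm T ((isPer_sin_phase k).comp₂ hf (· • ·)) (by fun_prop)]
    simp
  simp [fmode, circ, h1, h2]

lemma mFourier_torusProj (k : Fin n → ℤ) (x : E n) :
    UnitAddTorus.mFourier k (torusProj n x) = Complex.exp (phase k x * Complex.I) := by
  simp only [UnitAddTorus.mFourier, ContinuousMap.coe_mk, torusProj, fourier_coe_apply]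
  rw [← Complex.exp_sum]
  congr 1
  rw [phase_apply]
  simp only [dotP, intVec]
  push_cast
  rw [Finset.mul_sum, Finset.sum_mul]
  refine Finset.sum_congr rfl fun i _ => ?_
  simp only [div_one]
  ring

lemma slowGrowth_one : SlowGrowth (fun _ : Fin n → ℤ => 1) 1 0 := fun k => by simp

lemma fop_one_real {f : E n → ℝ} (hf : IsPer f) (hs : ContDiff ℝ ∞ f) (x : E n) :
    fop (fun _ => 1) f x = f x := by
  let G : C(UnitAddTorus (Fin n), ℂ) := ⟨fun t => ((f (torusSec n t) : ℝ) : ℂ),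
    Complex.continuous_ofReal.comp (hf.continuous_sec hs.continuous)⟩
  have hcoef : ∀ k, UnitAddTorus.mFourierCoeff G k = cosC k f - sinC k f * Complex.I := by
    intro k
    have h1 : ∀ t, UnitAddTorus.mFourier (-k) t • G t =
        ((Real.cos (phase k (torusSec n t)) • f (torusSec n t) : ℝ) : ℂ)
        - ((Real.sin (phase k (torusSec n t)) • f (torusSec n t) : ℝ) : ℂ) * Complex.I := by
      intro t
      conv_lhs => rw [← torusProj_sec t]
      rw [torusProj_sec, UnitAddTorus.mFourier_neg, ← torusProj_sec t, mFourier_torusProj,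
        torusProj_sec, Complex.exp_mul_I, ← Complex.ofReal_cos, ← Complex.ofReal_sin]
      simp only [map_add, map_mul, Complex.conj_ofReal, Complex.conj_I, smul_eq_mul, G,
        ContinuousMap.coe_mk, Complex.ofReal_mul]
      ring
    have h2 : UnitAddTorus.mFourierCoeff G k =
        ∫ t, UnitAddTorus.mFourier (-k) t • G t ∂torusMeas n := rfl
    rw [h2]
    simp only [h1]
    have hi1 := ((isPer_cos_phase k).comp₂ hf (· • ·)).integrable_sec
      (by have := hs.continuous; fun_prop)
    have hi2 := ((isPer_sin_phase k).comp₂ hf (· • ·)).integrable_sec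
      (by have := hs.continuous; fun_prop)
    rw [integral_sub hi1.ofReal (hi2.ofReal.mul_const _), integral_mul_const,
      integral_complex_ofReal, integral_complex_ofReal]
    rfl
  obtain ⟨D, hD⟩ := exists_iteratedFDeriv_bound hf hs
  have hsum : Summable (UnitAddTorus.mFourierCoeff G) := by
    refine Summable.of_norm_bounded
      (summable_intVec.mul_left (2 ^ (n + 1 + 1) * (D 0 + D (n + 1)))) fun k => ?_
    have h1 := one_add_norm_pow_mul_coeff_le k (n + 1) hf hs (D₀ := D 0)
      (fun x => by simpa using hD 0 x) (hD _)
    rw [hcoef, ← div_eq_mul_inv, le_div_iff₀ (by positivity), mul_comm]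
    refine le_trans ?_ h1
    gcongr
    refine (norm_sub_le _ _).trans (le_of_eq ?_)
    simp
  have h3 := UnitAddTorus.hasSum_mFourier_series_apply_of_summable hsum (torusProj n x)
  have h4 := (Complex.hasSum_re h3).tsum_eq
  have h5 : G (torusProj n x) = f x := by simp [G, hf.sec_proj x]
  rw [h5, Complex.ofReal_re] at h4
  rw [← h4]
  refine tsum_congr fun k => ?_
  rw [hcoef, mFourier_torusProj, fmode, circ]
  simp [Complex.exp_ofReal_mul_I_re, Complex.exp_ofReal_mul_I_im]
  ring

lemma fop_one [CompleteSpace F] {f : E n → F} (hf : IsPer f) (hs : ContDiff ℝ ∞ f) (x : E n) :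
    fop (fun _ => 1) f x = f x := by
  refine (SeparatingDual.eq_iff_forall_dual_eq (R := ℝ)).2 fun ψ => ?_
  have h1 := summable_fmode slowGrowth_one hf hs x
  rw [fop, ψ.map_tsum h1]
  simp only [clm_fmode ψ _ _ hf hs.continuous]
  exact fop_one_real (hf.comp ψ) (ψ.contDiff.comp hs) x

end FourierSeries

section DifferenceQuotient

open scoped ContDiff

variable {n : ℕ} {F G : Type*} [NormedAddCommGroup F] [NormedSpace ℝ F]
  [NormedAddCommGroup G] [NormedSpace ℝ G]

lemma fmode_sub_symbol (μ ν : ℂ) (k : Fin n → ℤ) (f : E n → F) (x : E n) :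
    fmode (μ - ν) k f x = fmode μ k f x - fmode ν k f x := by
  simp only [fmode, circ, sub_mul, Complex.sub_re, Complex.sub_im]
  module

lemma fmode_real_mul_symbol (c : ℝ) (μ : ℂ) (k : Fin n → ℤ) (f : E n → F) (x : E n) :
    fmode (c * μ) k f x = c • fmode μ k f x := by
  simp only [fmode, circ, mul_assoc, Complex.re_ofReal_mul, Complex.im_ofReal_mul]
  module

lemma fmode_zero_symbol (k : Fin n → ℤ) (f : E n → F) (x : E n) : fmode 0 k f x = 0 := by
  simp [fmode, circ]

lemma fmode_one_zero (f : E n → F) (x : E n) : fmode 1 0 f x = torusMean f := by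
  simp [fmode, circ, cosC_zero, sinC_zero, phase_apply, dotP, intVec]

lemma fmode_sub (μ : ℂ) (k : Fin n → ℤ) {f g : E n → F} (hf : IsPer f) (hfc : Continuous f)
    (hg : IsPer g) (hgc : Continuous g) (x : E n) :
    fmode μ k (fun x => f x - g x) x = fmode μ k f x - fmode μ k g x := by
  have h1 : cosC k (fun x => f x - g x) = cosC k f - cosC k g := by
    unfold cosC
    rw [← torusMean_sub ((isPer_cos_phase k).comp₂ hf (· • ·)) (by fun_prop)
      ((isPer_cos_phase k).comp₂ hg (· • ·)) (by fun_prop)]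
    simp only [smul_sub]
  have h2 : sinC k (fun x => f x - g x) = sinC k f - sinC k g := by
    unfold sinC
    rw [← torusMean_sub ((isPer_sin_phase k).comp₂ hf (· • ·)) (by fun_prop)
      ((isPer_sin_phase k).comp₂ hg (· • ·)) (by fun_prop)]
    simp only [smul_sub]
  simp only [fmode, circ, h1, h2]
  module

lemma fmode_smul (μ : ℂ) (k : Fin n → ℤ) (c : ℝ) (f : E n → F) (x : E n) :
    fmode μ k (fun x => c • f x) x = c • fmode μ k f x := by
  have h1 : cosC k (fun x => c • f x) = c • cosC k f := by
    unfold cosC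
    rw [← torusMean_smul]
    simp only [smul_comm c]
  have h2 : sinC k (fun x => c • f x) = c • sinC k f := by
    unfold sinC
    rw [← torusMean_smul]
    simp only [smul_comm c]
  simp only [fmode, circ, h1, h2]
  module

/-- The difference quotient with step `δ` in direction `Ω`. -/
def dd (δ : ℝ) (Ω : E n) (f : E n → F) (x : E n) : F := δ⁻¹ • (f (x + δ • Ω) - f x)

def ddSym (δ : ℝ) (Ω : E n) (k : Fin n → ℤ) : ℂ :=
  (δ⁻¹ : ℝ) * (Complex.exp (phase k (δ • Ω) * Complex.I) - 1)

def ddInvSym (δ : ℝ) (Ω : E n) (k : Fin n → ℤ) : ℂ := if k = 0 then 0 else (ddSym δ Ω k)⁻¹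

/-- The right inverse of `dd` on functions of mean zero. -/
def ddInv (δ : ℝ) (Ω : E n) (f : E n → F) : E n → F := fop (ddInvSym δ Ω) f

lemma IsPer.dd {f : E n → F} (hf : IsPer f) (δ : ℝ) (Ω : E n) : IsPer (dd δ Ω f) :=
  (hf.shift _).comp₂ hf fun a b => δ⁻¹ • (a - b)

lemma contDiff_dd {f : E n → F} (hf : ContDiff ℝ ∞ f) (δ : ℝ) (Ω : E n) :
    ContDiff ℝ ∞ (dd δ Ω f) := by
  unfold dd
  fun_prop

lemma dd_fmode (δ : ℝ) (Ω : E n) (μ : ℂ) (k : Fin n → ℤ) (f : E n → F) (x : E n) :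
    dd δ Ω (fmode μ k f) x = fmode (ddSym δ Ω k * μ) k f x := by
  unfold dd
  rw [fmode_add_right, ← fmode_sub_symbol, ← fmode_real_mul_symbol, ddSym]
  congr 1
  ring

/-- `ddInv δ Ω` is a Fourier multiplier of polynomial growth inverting `dd δ Ω`. -/
structure SmallDivisor (δ : ℝ) (Ω : E n) (Λ : ℝ) (q : ℕ) : Prop where
  slowGrowth : SlowGrowth (ddInvSym δ Ω) Λ q
  ne_zero : ∀ k, k ≠ 0 → ddSym δ Ω k ≠ 0

variable [CompleteSpace F] {δ Λ : ℝ} {Ω : E n} {q : ℕ}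

lemma fop_single (f : E n → F) (x : E n) :
    fop (fun k => if k = 0 then 1 else 0) f x = torusMean f := by
  unfold fop
  rw [tsum_eq_single 0 fun k hk => by simp only [if_neg hk, fmode_zero_symbol]]
  simp only [if_pos, fmode_one_zero]

lemma slowGrowth_single : SlowGrowth (fun k : Fin n → ℤ => if k = 0 then 1 else 0) 1 0 := by
  intro k
  simp only
  split_ifs <;> simp

lemma fop_one_sub_single {f : E n → F} (hf : IsPer f) (hs : ContDiff ℝ ∞ f) (x : E n) :
    fop (fun k => 1 - if k = 0 then 1 else 0) f x = f x - torusMean f := by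
  rw [← fop_single f x, ← fop_one hf hs x]
  unfold fop
  rw [← (summable_fmode slowGrowth_one hf hs x).tsum_sub
    (summable_fmode slowGrowth_single hf hs x)]
  simp only [fmode_sub_symbol]

lemma sub_fop_lowSym (M : ℝ) {f : E n → F} (hf : IsPer f) (hs : ContDiff ℝ ∞ f) (x : E n) :
    f x - fop (lowSym n M) f x = fop (fun k => 1 - lowSym n M k) f x := by
  rw [← fop_one hf hs x]
  unfold fop
  rw [← (summable_fmode slowGrowth_one hf hs x).tsum_sub
    (summable_fmode (lowSym_slowGrowth M) hf hs x)]
  simp only [fmode_sub_symbol]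

lemma dd_ddInv (h : SmallDivisor δ Ω Λ q) {f : E n → F} (hf : IsPer f) (hs : ContDiff ℝ ∞ f)
    (x : E n) : dd δ Ω (ddInv δ Ω f) x = f x - torusMean f := by
  rw [← fop_one_sub_single hf hs]
  have hs1 := fun x => summable_fmode h.slowGrowth hf hs x
  have h1 : dd δ Ω (ddInv δ Ω f) x = ∑' k, dd δ Ω (fmode (ddInvSym δ Ω k) k f) x := by
    unfold dd ddInv fop
    rw [← (hs1 _).tsum_sub (hs1 x), ← ((hs1 _).sub (hs1 x)).tsum_const_smul]
  rw [h1, fop]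
  refine tsum_congr fun k => ?_
  rw [dd_fmode]
  congr 1
  unfold ddInvSym
  split_ifs with hk
  · simp
  · rw [mul_inv_cancel₀ (h.ne_zero k hk), sub_zero]

lemma fop_dd (h : SlowGrowth (fun k => ddInvSym δ Ω k) Λ q) {f : E n → F} (hf : IsPer f)
    (hs : ContDiff ℝ ∞ f) (x : E n) : ddInv δ Ω (dd δ Ω f) x = dd δ Ω (ddInv δ Ω f) x := by
  have hs1 := fun x => summable_fmode h hf hs x
  have h1 : dd δ Ω (ddInv δ Ω f) x = ∑' k, dd δ Ω (fmode (ddInvSym δ Ω k) k f) x := by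
    unfold dd ddInv fop
    rw [← (hs1 _).tsum_sub (hs1 x), ← ((hs1 _).sub (hs1 x)).tsum_const_smul]
  rw [h1, ddInv, fop]
  refine tsum_congr fun k => ?_
  unfold dd
  rw [fmode_smul, fmode_sub _ _ (hf.shift _) (by have := hs.continuous; fun_prop) hf hs.continuous,
    fmode_shift _ _ hf hs.continuous]

lemma ddInv_dd (h : SmallDivisor δ Ω Λ q) {f : E n → F} (hf : IsPer f) (hs : ContDiff ℝ ∞ f)
    (x : E n) : ddInv δ Ω (dd δ Ω f) x = f x - torusMean f := by
  rw [fop_dd h.slowGrowth hf hs, dd_ddInv h hf hs]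

lemma isPer_ddInv (f : E n → F) : IsPer (ddInv δ Ω f) := isPer_fop _ _

lemma contDiff_ddInv (h : SmallDivisor δ Ω Λ q) {f : E n → F} (hf : IsPer f)
    (hs : ContDiff ℝ ∞ f) : ContDiff ℝ ∞ (ddInv δ Ω f) := contDiff_fop h.slowGrowth hf hs

lemma torusMean_dd {f : E n → F} (hf : IsPer f) (hc : Continuous f) :
    torusMean (dd δ Ω f) = 0 := by
  unfold dd
  rw [torusMean_smul, torusMean_sub (hf.shift _) (by fun_prop) hf hc, torusMean_shift hf, sub_self,
    smul_zero]

lemma four_mul_abs_sub_round_le (y : ℝ) :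
    4 * |y - round y| ≤ ‖Complex.exp ((2 * Real.pi * y : ℝ) * Complex.I) - 1‖ := by
  set d := y - round y with hd
  have h1 : Complex.exp ((2 * Real.pi * y : ℝ) * Complex.I) =
      Complex.exp (Complex.I * (2 * Real.pi * d : ℝ)) := by
    rw [Complex.exp_eq_exp_iff_exists_int]
    refine ⟨round y, ?_⟩
    rw [hd]
    push_cast
    ring
  rw [h1, Complex.norm_exp_I_mul_ofReal_sub_one, show 2 * Real.pi * d / 2 = Real.pi * d by ring,
    norm_mul, Real.norm_ofNat, Real.norm_eq_abs]
  have hd2 : |d| ≤ 1 / 2 := abs_sub_round y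
  have h2 : 2 * |d| ≤ |Real.sin (Real.pi * d)| := by
    have h3 : |Real.sin (Real.pi * d)| = |Real.sin (Real.pi * |d|)| := by
      rcases abs_cases d with ⟨h, _⟩ | ⟨h, _⟩ <;> rw [h]
      rw [mul_neg, Real.sin_neg, abs_neg]
    rw [h3]
    have h4 := Real.mul_le_sin (x := Real.pi * |d|) (by positivity)
      (by nlinarith [Real.pi_pos])
    refine le_trans (le_of_eq ?_) (h4.trans (le_abs_self _))
    field_simp
  linarith

lemma exists_smallDivisor {Ω : E n} (hΩ : StronglyDiophantine n Ω) :
    ∃ (Λ : ℝ) (q : ℕ), 0 < Λ ∧ ∀ m : ℕ, 0 < m → SmallDivisor (1 / (m : ℝ)) Ω Λ q := by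
  obtain ⟨γ, hγ, τ, h⟩ := hΩ
  obtain ⟨q, hq⟩ := exists_nat_ge τ
  have key : ∀ m : ℕ, 0 < m → ∀ k : Fin n → ℤ, k ≠ 0 →
      4 * γ / (1 + ‖intVec k‖) ^ q ≤ ‖ddSym (1 / (m : ℝ)) Ω k‖ := by
    intro m hm k hk
    have hm' : (0 : ℝ) < m := by exact_mod_cast hm
    set y := (1 / (m : ℝ)) * dotP n (intVec k) Ω with hy
    have h1 : phase k ((1 / (m : ℝ)) • Ω) = 2 * Real.pi * y := by
      rw [map_smul, phase_apply, smul_eq_mul, hy]; ring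
    rw [ddSym, norm_mul, h1, Complex.norm_real, one_div, inv_inv, Real.norm_of_nonneg hm'.le]
    have h2 := four_mul_abs_sub_round_le y
    have h3 := h k hk (-(m * round y))
    have h4 : |dotP n (intVec k) Ω + ((-(m * round y) : ℤ) : ℝ)| = m * |y - round y| := by
      have : (m : ℝ) * |y - round y| = |m * (y - round y)| := by rw [abs_mul, abs_of_pos hm']
      rw [this]
      congr 1
      rw [hy]
      push_cast
      field_simp
      ring
    rw [h4] at h3
    obtain ⟨i, hi, hi1⟩ := exists_abs_eq_norm_intVec hk
    have hk1 : 1 ≤ ‖intVec k‖ := by rw [hi]; exact hi1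
    have h5 : ‖intVec k‖ ^ τ ≤ (1 + ‖intVec k‖) ^ q := by
      calc ‖intVec k‖ ^ τ ≤ ‖intVec k‖ ^ (q : ℝ) := Real.rpow_le_rpow_of_exponent_le hk1 hq
        _ = ‖intVec k‖ ^ q := Real.rpow_natCast _ _
        _ ≤ _ := by gcongr; linarith
    have h6 : γ / (1 + ‖intVec k‖) ^ q ≤ γ / ‖intVec k‖ ^ τ := by
      gcongr
    calc 4 * γ / (1 + ‖intVec k‖) ^ q = 4 * (γ / (1 + ‖intVec k‖) ^ q) := by ring
      _ ≤ 4 * (m * |y - round y|) := by linarith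
      _ = m * (4 * |y - round y|) := by ring
      _ ≤ _ := by gcongr
  refine ⟨(4 * γ)⁻¹, q, by positivity, fun m hm => ⟨fun k => ?_, fun k hk h0 => ?_⟩⟩
  · unfold ddInvSym
    split_ifs with hk
    · rw [norm_zero]; positivity
    · rw [norm_inv]
      refine (inv_anti₀ (by positivity) (key m hm k hk)).trans (le_of_eq ?_)
      field_simp
  · have := key m hm k hk
    rw [h0, norm_zero] at this
    have h7 : 0 < 4 * γ / (1 + ‖intVec k‖) ^ q := by positivity
    linarith

end DifferenceQuotient

section Tame

open scoped ContDiff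

variable {ι : Type*} {n : ℕ} {X F G H : Type*} [NormedAddCommGroup X] [NormedSpace ℝ X]
  [NormedAddCommGroup F] [NormedSpace ℝ F] [NormedAddCommGroup G] [NormedSpace ℝ G]
  [NormedAddCommGroup H] [NormedSpace ℝ H]

/-- A family of smooth functions whose `k`-th derivatives are of size `s * N ^ (c + k)`, uniformly
in the index. The size `s` depends on an auxiliary integer parameter; the exponent `c` does not. -/
structure Tame (c : ℕ) (s : ℕ → ι → ℝ) (N : ι → ℝ) (f : ι → X → F) : Prop where
  smooth : ∀ i, ContDiff ℝ ∞ (f i)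
  size_nonneg : ∀ q i, 0 ≤ s q i
  one_le : ∀ i, 1 ≤ N i
  bound : ∀ q k, ∃ C, 0 ≤ C ∧ ∀ i x, ‖iteratedFDeriv ℝ k (f i) x‖ ≤ C * (s q i * N i ^ (c + k))

variable {c c' : ℕ} {s s' : ℕ → ι → ℝ} {N N' : ι → ℝ} {f : ι → X → F} {g : ι → X → G}

lemma Tame.mono (h : Tame c s N f) {a : ℕ → ℝ} (hs : ∀ q i, s q i ≤ a q * s' q i)
    (hs' : ∀ q i, 0 ≤ s' q i) (hN : ∀ i, N i ≤ N' i) (hc : c ≤ c') : Tame c' s' N' f where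
  smooth := h.smooth
  size_nonneg := hs'
  one_le i := (h.one_le i).trans (hN i)
  bound q k := by
    obtain ⟨C, hC, hb⟩ := h.bound q k
    refine ⟨C * |a q|, by positivity, fun i x => (hb i x).trans ?_⟩
    have h1 := h.one_le i
    have h2 := hN i
    have h3 := hs' q i
    have h4 := h.size_nonneg q i
    have h5 : s q i ≤ |a q| * s' q i :=
      (hs q i).trans (mul_le_mul_of_nonneg_right (le_abs_self _) h3)
    calc C * (s q i * N i ^ (c + k)) ≤ C * (|a q| * s' q i * N' i ^ (c' + k)) := by
          refine mul_le_mul_of_nonneg_left ?_ hC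
          refine mul_le_mul h5 ?_ (by positivity) (by positivity)
          calc N i ^ (c + k) ≤ N i ^ (c' + k) := pow_le_pow_right₀ h1 (by omega)
            _ ≤ _ := by gcongr
      _ = _ := by ring

lemma Tame.mono_size (h : Tame c s N f) (hs : ∀ q i, s q i ≤ s' q i) : Tame c s' N f :=
  h.mono (a := fun _ => 1) (fun q i => by simpa using hs q i)
    (fun q i => (h.size_nonneg q i).trans (hs q i)) (fun _ => le_rfl) le_rfl

lemma Tame.mono_loss (h : Tame c s N f) (hc : c ≤ c') : Tame c' s N f :=
  h.mono (a := fun _ => 1) (fun q i => by simp) h.size_nonneg (fun _ => le_rfl) hc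

lemma Tame.mono_freq (h : Tame c s N f) (hN : ∀ i, N i ≤ N' i) : Tame c s N' f :=
  h.mono (a := fun _ => 1) (fun q i => by simp) h.size_nonneg hN le_rfl

lemma Tame.congr (h : Tame c s N f) {f' : ι → X → F} (hf : ∀ i x, f' i x = f i x) :
    Tame c s N f' := by
  have : f' = f := funext fun i => funext (hf i)
  rwa [this]

lemma Tame.add (hf : Tame c s N f) {f' : ι → X → F} (hf' : Tame c' s' N f') :
    Tame (max c c') (fun q i => s q i + s' q i) N (fun i x => f i x + f' i x) where
  smooth i := (hf.smooth i).add (hf'.smooth i)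
  size_nonneg q i := add_nonneg (hf.size_nonneg q i) (hf'.size_nonneg q i)
  one_le := hf.one_le
  bound q k := by
    obtain ⟨C, hC, hb⟩ := hf.bound q k
    obtain ⟨C', hC', hb'⟩ := hf'.bound q k
    refine ⟨C + C', by positivity, fun i x => ?_⟩
    have h1 : iteratedFDeriv ℝ k (fun x => f i x + f' i x) x =
        iteratedFDeriv ℝ k (f i) x + iteratedFDeriv ℝ k (f' i) x :=
      iteratedFDeriv_add_apply ((hf.smooth i).contDiffAt.of_le (by exact_mod_cast le_top))
        ((hf'.smooth i).contDiffAt.of_le (by exact_mod_cast le_top))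
    rw [h1]
    refine (norm_add_le _ _).trans ((add_le_add (hb i x) (hb' i x)).trans ?_)
    have h2 := hf.one_le i
    have h3 := hf.size_nonneg q i
    have h4 := hf'.size_nonneg q i
    have h5 : N i ^ (c + k) ≤ N i ^ (max c c' + k) := pow_le_pow_right₀ h2 (by omega)
    have h6 : N i ^ (c' + k) ≤ N i ^ (max c c' + k) := pow_le_pow_right₀ h2 (by omega)
    have h7 : 0 ≤ N i ^ (max c c' + k) := by positivity
    calc _ ≤ C * (s q i * N i ^ (max c c' + k)) + C' * (s' q i * N i ^ (max c c' + k)) := by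
          gcongr
      _ ≤ _ := by
          have := mul_nonneg (mul_nonneg hC h4) h7
          have := mul_nonneg (mul_nonneg hC' h3) h7
          nlinarith

lemma Tame.add_self (hf : Tame c s N f) {f' : ι → X → F} (hf' : Tame c' s N f') :
    Tame (max c c') s N (fun i x => f i x + f' i x) :=
  (hf.add hf').mono (a := fun _ => 2) (fun q i => by linarith) hf.size_nonneg (fun _ => le_rfl)
    le_rfl

lemma Tame.clm (hf : Tame c s N f) (L : F →L[ℝ] G) : Tame c s N (fun i x => L (f i x)) where
  smooth i := L.contDiff.comp (hf.smooth i)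
  size_nonneg := hf.size_nonneg
  one_le := hf.one_le
  bound q k := by
    obtain ⟨C, hC, hb⟩ := hf.bound q k
    refine ⟨‖L‖ * C, by positivity, fun i x => ?_⟩
    refine (L.norm_iteratedFDeriv_comp_left (n := k) (hf.smooth i).contDiffAt
      (by exact_mod_cast le_top)).trans ?_
    rw [mul_assoc]
    gcongr
    exact hb i x

lemma Tame.neg (hf : Tame c s N f) : Tame c s N (fun i x => -f i x) :=
  (hf.clm (-ContinuousLinearMap.id ℝ F)).congr fun i x => by simp

lemma Tame.sub_self (hf : Tame c s N f) {f' : ι → X → F} (hf' : Tame c' s N f') :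
    Tame (max c c') s N (fun i x => f i x - f' i x) :=
  (hf.add_self hf'.neg).congr fun _ _ => sub_eq_add_neg _ _

lemma Tame.bilin (hf : Tame c s N f) (hg : Tame c' s' N g) (L : F →L[ℝ] G →L[ℝ] H) :
    Tame (c + c') (fun q i => s q i * s' q i) N (fun i x => L (f i x) (g i x)) where
  smooth i := (L.contDiff.comp (hf.smooth i)).clm_apply (hg.smooth i)
  size_nonneg q i := mul_nonneg (hf.size_nonneg q i) (hg.size_nonneg q i)
  one_le := hf.one_le
  bound q k := by
    choose C hC hb using hf.bound q
    choose C' hC' hb' using hg.bound q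
    refine ⟨‖L‖ * ∑ j ∈ Finset.range (k + 1), (k.choose j : ℝ) * C j * C' (k - j),
      ?_, fun i x => ?_⟩
    · have := Finset.sum_nonneg (s := Finset.range (k + 1))
        (f := fun j => (k.choose j : ℝ) * C j * C' (k - j)) fun j _ =>
          mul_nonneg (mul_nonneg (by positivity) (hC _)) (hC' _)
      positivity
    refine (L.norm_iteratedFDeriv_le_of_bilinear (hf.smooth i) (hg.smooth i) x
      (n := k) (by exact_mod_cast le_top)).trans ?_
    rw [mul_assoc, Finset.sum_mul]
    refine mul_le_mul_of_nonneg_left (Finset.sum_le_sum fun j hj => ?_) (by positivity)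
    have hj' : j ≤ k := Nat.lt_succ_iff.1 (Finset.mem_range.1 hj)
    have h2 := hf.one_le i
    have h3 := hf.size_nonneg q i
    have h4 := hg.size_nonneg q i
    have h5 := hC j
    calc _ ≤ (k.choose j : ℝ) * (C j * (s q i * N i ^ (c + j)))
          * (C' (k - j) * (s' q i * N i ^ (c' + (k - j)))) := by
          gcongr
          · exact hb j i x
          · exact hb' (k - j) i x
      _ = (k.choose j : ℝ) * C j * C' (k - j) *
          (s q i * s' q i * N i ^ ((c + j) + (c' + (k - j)))) := by
          rw [pow_add]; ring
      _ = _ := by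
          rw [show (c + j) + (c' + (k - j)) = c + c' + k by omega]

lemma Tame.smul_param (hf : Tame c s N f) (a : ι → ℝ) :
    Tame c (fun q i => |a i| * s q i) N (fun i x => a i • f i x) where
  smooth i := contDiff_const.smul (hf.smooth i)
  size_nonneg q i := mul_nonneg (abs_nonneg _) (hf.size_nonneg q i)
  one_le := hf.one_le
  bound q k := by
    obtain ⟨C, hC, hb⟩ := hf.bound q k
    refine ⟨C, hC, fun i x => ?_⟩
    have h1 : iteratedFDeriv ℝ k (fun x => a i • f i x) x = a i • iteratedFDeriv ℝ k (f i) x :=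
      iteratedFDeriv_const_smul_apply ((hf.smooth i).contDiffAt.of_le (by exact_mod_cast le_top))
    rw [h1, norm_smul, Real.norm_eq_abs]
    calc |a i| * ‖iteratedFDeriv ℝ k (f i) x‖ ≤ |a i| * (C * (s q i * N i ^ (c + k))) := by
          gcongr; exact hb i x
      _ = _ := by ring

lemma tame_const (hN : ∀ i, 1 ≤ N i) (b : ι → F) (hs : ∀ q i, 0 ≤ s q i) {a : ℝ}
    (hb : ∀ q i, ‖b i‖ ≤ a * s q i) : Tame 0 s N (fun i (_ : X) => b i) where
  smooth i := contDiff_const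
  size_nonneg := hs
  one_le := hN
  bound q k := by
    refine ⟨|a|, abs_nonneg _, fun i x => ?_⟩
    have h1 := hN i
    have h2 := hs q i
    rcases k.eq_zero_or_pos with rfl | hk
    · rw [norm_iteratedFDeriv_zero]
      refine (hb q i).trans ?_
      simp only [add_zero, pow_zero, mul_one]
      exact mul_le_mul_of_nonneg_right (le_abs_self _) h2
    · rw [iteratedFDeriv_const_of_ne hk.ne']
      simp only [Pi.zero_apply, norm_zero]
      positivity

lemma Tame.fderiv (hf : Tame c s N f) : Tame (c + 1) s N (fun i => fderiv ℝ (f i)) where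
  smooth i := (hf.smooth i).fderiv_right (by simp)
  size_nonneg := hf.size_nonneg
  one_le := hf.one_le
  bound q k := by
    obtain ⟨C, hC, hb⟩ := hf.bound q (k + 1)
    refine ⟨C, hC, fun i x => ?_⟩
    rw [norm_iteratedFDeriv_fderiv, add_assoc, add_comm 1 k]
    exact hb i x

lemma Tame.shift (hf : Tame c s N f) (h : ι → X) : Tame c s N (fun i x => f i (x + h i)) where
  smooth i := (hf.smooth i).comp (by fun_prop)
  size_nonneg := hf.size_nonneg
  one_le := hf.one_le
  bound q k := by
    obtain ⟨C, hC, hb⟩ := hf.bound q k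
    refine ⟨C, hC, fun i x => ?_⟩
    rw [iteratedFDeriv_comp_add_right]
    exact hb i _

lemma norm_iteratedFDeriv_dd_le {δ : ℝ} (hδ : 0 < δ) (Ω : E n) {f : E n → F}
    (hf : ContDiff ℝ ∞ f) {k : ℕ} {C : ℝ} (hC : ∀ x, ‖iteratedFDeriv ℝ (k + 1) f x‖ ≤ C) (x : E n) :
    ‖iteratedFDeriv ℝ k (dd δ Ω f) x‖ ≤ C * ‖Ω‖ := by
  have h1 : iteratedFDeriv ℝ k (dd δ Ω f) x =
      δ⁻¹ • (iteratedFDeriv ℝ k f (x + δ • Ω) - iteratedFDeriv ℝ k f x) := by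
    have hs : ContDiff ℝ ∞ fun x => f (x + δ • Ω) := by fun_prop
    have h2 : iteratedFDeriv ℝ k (fun x => δ⁻¹ • (f (x + δ • Ω) - f x)) x =
        δ⁻¹ • iteratedFDeriv ℝ k (fun x => f (x + δ • Ω) - f x) x :=
      iteratedFDeriv_const_smul_apply ((hs.sub hf).contDiffAt.of_le (by exact_mod_cast le_top))
    have h3 : iteratedFDeriv ℝ k (fun x => f (x + δ • Ω) - f x) x =
        iteratedFDeriv ℝ k (fun x => f (x + δ • Ω)) x - iteratedFDeriv ℝ k f x :=
      iteratedFDeriv_sub_apply (hs.contDiffAt.of_le (by exact_mod_cast le_top))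
        (hf.contDiffAt.of_le (by exact_mod_cast le_top))
    unfold dd
    rw [h2, h3, iteratedFDeriv_comp_add_right]
  have h4 := Convex.norm_image_sub_le_of_norm_fderiv_le (f := iteratedFDeriv ℝ k f) (C := C)
    (𝕜 := ℝ) (s := Set.univ) (x := x) (y := x + δ • Ω)
    (fun y _ => hf.differentiable_iteratedFDeriv (by exact_mod_cast ENat.natCast_lt_top k) y)
    (fun y _ => by rw [norm_fderiv_iteratedFDeriv]; exact hC y) convex_univ trivial trivial
  rw [add_sub_cancel_left, norm_smul, Real.norm_of_nonneg hδ.le] at h4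
  rw [h1, norm_smul, norm_inv, Real.norm_of_nonneg hδ.le, ← div_eq_inv_mul, div_le_iff₀ hδ]
  linarith

lemma Tame.dd {f : ι → E n → F} (hf : Tame c s N f) {δ : ι → ℝ} (hδ : ∀ i, 0 < δ i) (Ω : E n) :
    Tame (c + 1) s N (fun i => dd (δ i) Ω (f i)) where
  smooth i := contDiff_dd (hf.smooth i) _ _
  size_nonneg := hf.size_nonneg
  one_le := hf.one_le
  bound q k := by
    obtain ⟨C, hC, hb⟩ := hf.bound q (k + 1)
    refine ⟨C * ‖Ω‖, by positivity, fun i x => ?_⟩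
    refine (norm_iteratedFDeriv_dd_le (hδ i) Ω (hf.smooth i) (hb i) x).trans (le_of_eq ?_)
    rw [show c + 1 + k = c + (k + 1) by ring]
    ring

lemma Tame.torusMean {f : ι → E n → F} (hf : Tame c s N f) :
    Tame c s N (fun i (_ : X) => torusMean (f i)) where
  smooth i := contDiff_const
  size_nonneg := hf.size_nonneg
  one_le := hf.one_le
  bound q k := by
    obtain ⟨C, hC, hb⟩ := hf.bound q 0
    refine ⟨C, hC, fun i x => ?_⟩
    have h1 := hf.one_le i
    have h2 := hf.size_nonneg q i
    rcases k.eq_zero_or_pos with rfl | hk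
    · rw [norm_iteratedFDeriv_zero]
      refine norm_torusMean_le fun x => ?_
      simpa using hb i x
    · rw [iteratedFDeriv_const_of_ne hk.ne']
      simp only [Pi.zero_apply, norm_zero]
      positivity

lemma Tame.multiplier_aux [CompleteSpace F] {f : ι → E n → F} (hf : Tame c s N f)
    (hper : ∀ i, IsPer (f i)) {μ : ι → (Fin n → ℤ) → ℂ} {Λ : ℕ → ι → ℝ} {p : ℕ → ℕ}
    {t : ℕ → ι → ℝ} (hμ : ∀ q i, SlowGrowth (μ i) (Λ q i) (p q)) (hΛ : ∀ q i, 0 ≤ Λ q i)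
    (ht : ∀ q i, t q i = Λ q i * (s q i * N i ^ p q)) :
    Tame (c + (n + 1)) t N (fun i => fop (μ i) (f i)) where
  smooth i := contDiff_fop (hμ 0 i) (hper i) (hf.smooth i)
  size_nonneg q i := by
    have h1 := hf.one_le i
    have h2 := hf.size_nonneg q i
    have h3 := hΛ q i
    rw [ht]
    positivity
  one_le := hf.one_le
  bound q k := by
    choose C hC hb using hf.bound q
    refine ⟨(2 * Real.pi * n) ^ k * latSum n * (2 ^ (k + (n + 1) + p q + 1) *
      (C 0 + C (k + (n + 1) + p q))), ?_, fun i x => ?_⟩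
    · have h0 := hC 0
      have h1 := hC (k + (n + 1) + p q)
      have h2 := latSum_nonneg (n := n)
      positivity
    · refine ((fop_bound (hμ q i) (hper i) (hf.smooth i)
        (D := fun p => C p * (s q i * N i ^ (c + p))) fun p x => hb p i x).2.2 k x).trans ?_
      have h1 := hf.one_le i
      have h2 := hf.size_nonneg q i
      have h3 := hΛ q i
      have h4 := latSum_nonneg (n := n)
      have h5 : N i ^ (c + 0) ≤ N i ^ (c + (k + (n + 1) + p q)) :=
        pow_le_pow_right₀ h1 (by omega)
      have h6 := hC 0
      calc _ ≤ (2 * Real.pi * n) ^ k * latSum n * (Λ q i * (2 ^ (k + (n + 1) + p q + 1) *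
            (C 0 * (s q i * N i ^ (c + (k + (n + 1) + p q))) +
              C (k + (n + 1) + p q) * (s q i * N i ^ (c + (k + (n + 1) + p q)))))) := by
            gcongr
        _ = _ := by
            rw [ht, show c + (k + (n + 1) + p q) = p q + (c + (n + 1) + k) by omega,
              pow_add _ (p q)]
            ring

lemma Tame.multiplier [CompleteSpace F] {f : ι → E n → F} (hf : Tame c s N f)
    (hper : ∀ i, IsPer (f i)) {μ : ι → (Fin n → ℤ) → ℂ} {Λ : ℝ} {p : ℕ}
    (hμ : ∀ i, SlowGrowth (μ i) Λ p) (hΛ : 0 ≤ Λ) :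
    Tame (c + p + (n + 1)) s N (fun i => fop (μ i) (f i)) := by
  have h1 : Tame (c + p) s N f := hf.mono_loss (by omega)
  have h := hf.multiplier_aux hper (Λ := fun _ _ => Λ) (p := fun _ => p) (fun _ i => hμ i)
    (fun _ _ => hΛ) (fun _ _ => rfl)
  refine ⟨h.smooth, hf.size_nonneg, hf.one_le, fun q k => ?_⟩
  obtain ⟨C, hC, hb⟩ := h.bound q k
  refine ⟨C * Λ, by positivity, fun i x => (hb i x).trans (le_of_eq ?_)⟩
  rw [show c + p + (n + 1) + k = p + (c + (n + 1) + k) by omega, pow_add _ p]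
  ring

lemma Tame.high [CompleteSpace F] {a : ι → ℝ} {f : ι → E n → F} (hf : Tame c (fun _ => a) N f)
    (hper : ∀ i, IsPer (f i)) {M : ι → ℝ} (hM : ∀ i, 1 ≤ M i) :
    Tame (c + (n + 1)) (fun q i => a i * (N i / M i) ^ q) N
      (fun i x => f i x - fop (lowSym n (M i)) (f i) x) := by
  refine (hf.multiplier_aux hper (μ := fun i k => 1 - lowSym n (M i) k) (Λ := fun q i => (M i ^ q)⁻¹)
    (p := fun q => q) (fun q i => one_sub_lowSym_slowGrowth (hM i) q) (fun q i => ?_)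
    (fun q i => ?_)).congr fun i x => sub_fop_lowSym (M i) (hper i) (hf.smooth i) x
  · have := hM i
    positivity
  · rw [div_pow]
    ring

lemma tame_low [CompleteSpace F] {f : ι → E n → F} {M : ι → ℝ} (hM : ∀ i, 1 ≤ M i)
    (hs : ∀ q i, 0 ≤ s q i) {a : ℕ → ℝ} (hf : ∀ q i x, ‖f i x‖ ≤ a q * s q i)
    (hper : ∀ i, IsPer (f i)) (hsm : ∀ i, ContDiff ℝ ∞ (f i)) :
    Tame (n + 1) s M (fun i => fop (lowSym n (M i)) (f i)) where
  smooth i := contDiff_fop (lowSym_slowGrowth _) (hper i) (hsm i)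
  size_nonneg := hs
  one_le := hM
  bound q k := by
    refine ⟨(2 * Real.pi * n) ^ k * latSum n * 2 ^ (k + (n + 1) + 1) * |a q|, ?_, fun i x => ?_⟩
    · have h2 := latSum_nonneg (n := n)
      positivity
    · have h2 := latSum_nonneg (n := n)
      have h3 := hM i
      have h4 := hs q i
      refine (fop_lowSym_bound (hM i) (D := |a q| * s q i) (fun x => (hf q i x).trans
        (mul_le_mul_of_nonneg_right (le_abs_self _) h4)) k x).trans (le_of_eq ?_)
      rw [show k + (n + 1) = n + 1 + k by omega]
      ring

/-- Composition of a uniformly bounded family with a family of frequency `N`. -/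
lemma Tame.comp {Y : Type*} [NormedAddCommGroup Y] [NormedSpace ℝ Y] {g : ι → Y → F}
    {f : ι → X → Y} (hg : Tame 0 (fun _ _ => 1) (fun _ => 1) g)
    (hf : Tame 1 (fun _ _ => 1) N (fun i => _root_.fderiv ℝ (f i))) (hsm : ∀ i, ContDiff ℝ ∞ (f i)) :
    Tame 0 (fun _ _ => 1) N (fun i x => g i (f i x)) where
  smooth i := (hg.smooth i).comp (hsm i)
  size_nonneg _ _ := zero_le_one
  one_le := hf.one_le
  bound q k := by
    choose C hC hb using hg.bound q
    choose D hD hb' using hf.bound q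
    let C' := ∑ j ∈ Finset.range (k + 1), C j
    let D' := 1 + ∑ j ∈ Finset.range (k + 1), D j
    have hC' : 0 ≤ C' := Finset.sum_nonneg fun j _ => hC j
    have hD0 : 0 ≤ ∑ j ∈ Finset.range (k + 1), D j := Finset.sum_nonneg fun j _ => hD j
    have hD' : 1 ≤ D' := by simp only [D']; linarith
    refine ⟨k.factorial * C' * D' ^ k, by positivity, fun i x => ?_⟩
    have hN := hf.one_le i
    have h1 : ∀ j ≤ k, ‖iteratedFDeriv ℝ j (g i) (f i x)‖ ≤ C' := by
      intro j hj
      refine (hb j i _).trans ?_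
      simp only [one_pow, mul_one]
      exact Finset.single_le_sum (f := C) (fun j _ => hC j) (Finset.mem_range.2 (by omega))
    have h2 : ∀ j, 1 ≤ j → j ≤ k → ‖iteratedFDeriv ℝ j (f i) x‖ ≤ (D' * N i) ^ j := by
      intro j hj1 hjk
      obtain ⟨l, rfl⟩ : ∃ l, j = l + 1 := ⟨j - 1, by omega⟩
      have h3 := hb' l i x
      rw [norm_iteratedFDeriv_fderiv] at h3
      refine h3.trans ?_
      have h4 : D l ≤ D' := by
        have := Finset.single_le_sum (f := D) (fun j _ => hD j)
          (Finset.mem_range.2 (show l < k + 1 by omega))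
        simp only [D']
        linarith
      rw [mul_pow, one_mul, add_comm 1 l]
      have h5 : D' ≤ D' ^ (l + 1) := le_self_pow₀ hD' (by omega)
      gcongr
      exact h4.trans h5
    have h3 := norm_iteratedFDeriv_comp_le (hg.smooth i) (hsm i) (n := k)
      (by exact_mod_cast le_top) x h1 h2
    refine h3.trans (le_of_eq ?_)
    rw [mul_pow, one_mul, zero_add]
    ring

end Tame

section TameInverse

open scoped ContDiff

variable {ι : Type*} {n : ℕ} {X F G H : Type*} [NormedAddCommGroup X] [NormedSpace ℝ X]
  [NormedAddCommGroup F] [NormedSpace ℝ F] [NormedAddCommGroup G] [NormedSpace ℝ G]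
  [NormedAddCommGroup H] [NormedSpace ℝ H]
  {c c' : ℕ} {s s' : ℕ → ι → ℝ} {N N' : ι → ℝ} {f : ι → X → F} {g : ι → X → G}

lemma Tame.of_size (h : Tame c s N f) (hs : ∀ q i, s q i = s' q i) : Tame c s' N f :=
  h.mono_size fun q i => (hs q i).le

lemma Tame.coef_bilin (hf : Tame c (fun _ _ => 1) N f) (hg : Tame c' s' N g)
    (L : F →L[ℝ] G →L[ℝ] H) : Tame (c + c') s' N (fun i x => L (f i x) (g i x)) :=
  (hf.bilin hg L).of_size fun _ _ => one_mul _

lemma Tame.bilin_coef (hf : Tame c s N f) (hg : Tame c' (fun _ _ => 1) N g)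
    (L : F →L[ℝ] G →L[ℝ] H) : Tame (c + c') s N (fun i x => L (f i x) (g i x)) :=
  (hf.bilin hg L).of_size fun _ _ => mul_one _

lemma Tame.coef_apply {f : ι → X → F →L[ℝ] G} {g : ι → X → F} (hf : Tame c (fun _ _ => 1) N f)
    (hg : Tame c' s' N g) : Tame (c + c') s' N (fun i x => f i x (g i x)) :=
  hf.coef_bilin hg (ContinuousLinearMap.id ℝ (F →L[ℝ] G))

lemma Tame.comp_coef {f : ι → X → G →L[ℝ] H} {g : ι → X → F →L[ℝ] G} (hf : Tame c s N f)
    (hg : Tame c' (fun _ _ => 1) N g) : Tame (c + c') s N (fun i x => (f i x).comp (g i x)) :=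
  hf.bilin_coef hg (ContinuousLinearMap.compL ℝ F G H)

lemma Tame.coef_comp {f : ι → X → G →L[ℝ] H} {g : ι → X → F →L[ℝ] G}
    (hf : Tame c (fun _ _ => 1) N f) (hg : Tame c' s' N g) :
    Tame (c + c') s' N (fun i x => (f i x).comp (g i x)) :=
  hf.coef_bilin hg (ContinuousLinearMap.compL ℝ F G H)

lemma Tame.norm_le (hf : Tame c s N f) (q : ℕ) :
    ∃ C, 0 ≤ C ∧ ∀ i x, ‖f i x‖ ≤ C * (s q i * N i ^ c) := by
  obtain ⟨C, hC, h⟩ := hf.bound q 0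
  exact ⟨C, hC, fun i x => by simpa using h i x⟩

/-- A uniform family of norm-bounded derivatives. -/
lemma tame_of_bound {f : ι → X → F} (hf : ∀ i, ContDiff ℝ ∞ (f i))
    (hb : ∀ k, ∃ C, ∀ i x, ‖iteratedFDeriv ℝ k (f i) x‖ ≤ C) :
    Tame 0 (fun _ _ => 1) (fun _ => 1) f where
  smooth := hf
  size_nonneg _ _ := zero_le_one
  one_le _ := le_rfl
  bound q k := by
    obtain ⟨C, hC⟩ := hb k
    exact ⟨|C|, abs_nonneg _, fun i x => by simpa using (hC i x).trans (le_abs_self _)⟩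

lemma isUnit_of_norm_sub_one_lt {A : E n →L[ℝ] E n} (hA : ‖A - 1‖ < 1) : IsUnit A := by
  have := isUnit_one_sub_of_norm_lt_one (x := 1 - A) (by rwa [norm_sub_rev])
  rwa [sub_sub_cancel] at this

lemma norm_ringInverse_sub_one_le {A : E n →L[ℝ] E n} (hA : ‖A - 1‖ ≤ 1 / 4) :
    ‖Ring.inverse A - 1‖ ≤ 1 / 3 := by
  have hu := isUnit_of_norm_sub_one_lt (hA.trans_lt (by norm_num))
  have h1 : Ring.inverse A - 1 = Ring.inverse A * (1 - A) := by
    rw [mul_sub, Ring.inverse_mul_cancel _ hu, mul_one]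
  have h2 : ‖Ring.inverse A‖ ≤ ‖Ring.inverse A - 1‖ + 1 := by
    calc ‖Ring.inverse A‖ = ‖(Ring.inverse A - 1) + 1‖ := by rw [sub_add_cancel]
      _ ≤ ‖Ring.inverse A - 1‖ + ‖(1 : E n →L[ℝ] E n)‖ := norm_add_le _ _
      _ ≤ _ := by gcongr; exact ContinuousLinearMap.norm_id_le
  have h3 : ‖Ring.inverse A - 1‖ ≤ ‖Ring.inverse A‖ * ‖1 - A‖ := by
    conv_lhs => rw [h1]
    exact norm_mul_le _ _
  rw [norm_sub_rev] at hA
  nlinarith [norm_nonneg (Ring.inverse A), norm_nonneg (1 - A)]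

lemma exists_inverse_cutoff : ∃ g : (E n →L[ℝ] E n) → (E n →L[ℝ] E n),
    ContDiff ℝ ∞ g ∧ (∀ k, ∃ C, ∀ A, ‖iteratedFDeriv ℝ k g A‖ ≤ C) ∧
    ∀ A, ‖A - 1‖ ≤ 1 / 4 → g A = Ring.inverse A := by
  let χ : ContDiffBump (1 : E n →L[ℝ] E n) := ⟨1 / 2, 3 / 4, by norm_num, by norm_num⟩
  have hs : ContDiff ℝ ∞ fun A => χ A • Ring.inverse A := by
    rw [contDiff_iff_contDiffAt]
    intro A
    by_cases hA : ‖A - 1‖ < 1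
    · obtain ⟨u, rfl⟩ := isUnit_of_norm_sub_one_lt hA
      exact χ.contDiffAt.smul (contDiffAt_ringInverse ℝ u)
    · have h0 : (fun A => χ A • Ring.inverse A) =ᶠ[nhds A] fun _ => 0 := by
        have : A ∉ tsupport χ := by
          rw [χ.tsupport_eq, Metric.mem_closedBall, dist_eq_norm]
          simp only [χ]
          linarith
        filter_upwards [notMem_tsupport_iff_eventuallyEq.1 this] with B hB
        simp [hB]
      exact contDiffAt_const.congr_of_eventuallyEq h0
  have hc : HasCompactSupport fun A => χ A • Ring.inverse A := χ.hasCompactSupport.smul_right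
  refine ⟨_, hs, fun k => ?_, fun A hA => ?_⟩
  · obtain ⟨C, hC⟩ := (hs.continuous_iteratedFDeriv (m := k) (by exact_mod_cast le_top)).bounded_above_of_compact_support
      (hc.iteratedFDeriv k)
    exact ⟨C, hC⟩
  · have : χ A = 1 := χ.one_of_mem_closedBall (by
      rw [Metric.mem_closedBall, dist_eq_norm]
      simp only [χ]
      linarith)
    simp [this]

lemma Tame.ringInverse {A : ι → X → E n →L[ℝ] E n} (hA : Tame 0 (fun _ _ => 1) N A)
    (hA1 : ∀ i x, ‖A i x - 1‖ ≤ 1 / 4) :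
    Tame 0 (fun _ _ => 1) N (fun i x => Ring.inverse (A i x)) := by
  obtain ⟨g, hg, hgb, hge⟩ := exists_inverse_cutoff (n := n)
  have h1 : Tame 0 (fun _ _ => 1) (fun _ => 1) (fun _ : ι => g) :=
    tame_of_bound (fun _ => hg) fun k => (hgb k).imp fun C hC _ => hC
  exact (h1.comp hA.fderiv hA.smooth).congr fun i x => (hge _ (hA1 i x)).symm

end TameInverse

section DiscreteEulerLagrange

open scoped ContDiff

variable {n : ℕ}

/-- Positions and discrete velocities of the torus `x ↦ x + u x`. -/
def zmap (δ : ℝ) (Ω : E n) (u : E n → E n) (x : E n) : E n × E n := (x + u x, Ω + dd δ Ω u x)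

def jac (u : E n → E n) (x : E n) : E n →L[ℝ] E n := 1 + fderiv ℝ u x

def zjac (δ : ℝ) (Ω : E n) (u : E n → E n) (x : E n) : E n →L[ℝ] E n × E n :=
  (jac u x).prod (dd δ Ω (fderiv ℝ u) x)

/-- The error in the discrete Euler-Lagrange equation. -/
def elErr (L : E n × E n → ℝ) (δ : ℝ) (Ω : E n) (u : E n → E n) (x : E n) : E n →L[ℝ] ℝ :=
  (fderiv ℝ L (zmap δ Ω u (x + δ • Ω))).comp (ContinuousLinearMap.inl ℝ (E n) (E n)) -
    dd δ Ω (fun y => (fderiv ℝ L (zmap δ Ω u y)).comp (ContinuousLinearMap.inr ℝ (E n) (E n))) x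

def hess (L : E n × E n → ℝ) (δ : ℝ) (Ω : E n) (u : E n → E n) (x : E n) :
    E n × E n →L[ℝ] E n × E n →L[ℝ] ℝ := fderiv ℝ (fderiv ℝ L) (zmap δ Ω u x)

/-- The linearization of `elErr` at `u`. -/
def linErr (L : E n × E n → ℝ) (δ : ℝ) (Ω : E n) (u w : E n → E n) (x : E n) : E n →L[ℝ] ℝ :=
  (hess L δ Ω u (x + δ • Ω) (w (x + δ • Ω), dd δ Ω w (x + δ • Ω))).comp
      (ContinuousLinearMap.inl ℝ (E n) (E n)) -
    dd δ Ω (fun y => (hess L δ Ω u y (w y, dd δ Ω w y)).comp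
      (ContinuousLinearMap.inr ℝ (E n) (E n))) x

def bform {P : Type*} [NormedAddCommGroup P] [NormedSpace ℝ P] (T : E n →L[ℝ] P →L[ℝ] ℝ)
    (S : E n →L[ℝ] P) : E n →L[ℝ] E n →L[ℝ] ℝ :=
  ((ContinuousLinearMap.compL ℝ (E n) P ℝ).flip S).comp T

/-- The twist of the torus. -/
def twist (L : E n × E n → ℝ) (δ : ℝ) (Ω : E n) (u : E n → E n) (x : E n) :
    E n →L[ℝ] E n →L[ℝ] ℝ :=
  bform ((hess L δ Ω u x).comp ((ContinuousLinearMap.inr ℝ (E n) (E n)).comp (jac u (x + δ • Ω))))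
    ((-(δ • jac u x)).prod (jac u x))

/-- The pullback of the symplectic form to the torus, up to scaling. -/
def lagForm (L : E n × E n → ℝ) (δ : ℝ) (Ω : E n) (u : E n → E n) (x : E n) :
    E n →L[ℝ] E n →L[ℝ] ℝ :=
  bform ((hess L δ Ω u x).comp (zjac δ Ω u x))
      ((ContinuousLinearMap.inr ℝ (E n) (E n)).comp (jac u (x + δ • Ω))) -
    (bform ((hess L δ Ω u x).comp (zjac δ Ω u x))
      ((ContinuousLinearMap.inr ℝ (E n) (E n)).comp (jac u (x + δ • Ω)))).flip

variable {L : E n × E n → ℝ} {δ : ℝ} {Ω : E n} {u w : E n → E n}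

lemma twist_apply (x a b : E n) : twist L δ Ω u x a b =
    hess L δ Ω u x (0, jac u (x + δ • Ω) a) (-(δ • jac u x b), jac u x b) := rfl

lemma lagForm_apply (x a b : E n) : lagForm L δ Ω u x a b =
    hess L δ Ω u x (zjac δ Ω u x a) (0, jac u (x + δ • Ω) b) -
      hess L δ Ω u x (zjac δ Ω u x b) (0, jac u (x + δ • Ω) a) := rfl

lemma zjac_apply (x a : E n) : zjac δ Ω u x a =
    (jac u x a, δ⁻¹ • (jac u (x + δ • Ω) a - jac u x a)) := by
  simp [zjac, jac, dd]

lemma hess_symm (hL : ContDiff ℝ ∞ L) (x : E n) (p q : E n × E n) :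
    hess L δ Ω u x p q = hess L δ Ω u x q p :=
  (hL.contDiffAt.isSymmSndFDerivAt (by simpa using (WithTop.coe_le_coe.2 (le_top : (2 : ℕ∞) ≤ ⊤)))).eq p q

lemma HasFDerivAt.comp_shift {X F : Type*} [NormedAddCommGroup X] [NormedSpace ℝ X]
    [NormedAddCommGroup F] [NormedSpace ℝ F] {f : X → F} {f' : X →L[ℝ] F} {x h : X}
    (hf : HasFDerivAt f f' (x + h)) : HasFDerivAt (fun y => f (y + h)) f' x :=
  (hasFDerivAt_comp_add_right h).2 hf

lemma hasFDerivAt_zmap (hu : ContDiff ℝ ∞ u) (x : E n) :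
    HasFDerivAt (zmap δ Ω u) (zjac δ Ω u x) x := by
  have h1 : ∀ y, HasFDerivAt u (fderiv ℝ u y) y := fun y =>
    (hu.differentiable (by simp) y).hasFDerivAt
  have h2 : HasFDerivAt (fun y => u (y + δ • Ω)) (fderiv ℝ u (x + δ • Ω)) x :=
    HasFDerivAt.comp_shift (h1 _)
  have h3 : HasFDerivAt (dd δ Ω u) (dd δ Ω (fderiv ℝ u) x) x := (h2.sub (h1 x)).const_smul δ⁻¹
  have h4 : HasFDerivAt (fun y => y + u y) (jac u x) x := (hasFDerivAt_id x).add (h1 x)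
  exact h4.prodMk (h3.const_add Ω)

lemma contDiff_zmap (hu : ContDiff ℝ ∞ u) : ContDiff ℝ ∞ (zmap δ Ω u) :=
  (contDiff_id.add hu).prodMk (contDiff_const.add (contDiff_dd hu δ Ω))

lemma hasFDerivAt_fderiv_zmap (hL : ContDiff ℝ ∞ L) (hu : ContDiff ℝ ∞ u) (x : E n) :
    HasFDerivAt (fun y => fderiv ℝ L (zmap δ Ω u y)) ((hess L δ Ω u x).comp (zjac δ Ω u x)) x := by
  have h1 : ContDiff ℝ ∞ (fderiv ℝ L) := hL.fderiv_right (by simp)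
  exact HasFDerivAt.comp (g := fderiv ℝ L) (f := zmap δ Ω u) x
    (h1.differentiable (by simp) _).hasFDerivAt (hasFDerivAt_zmap hu x)

lemma fderiv_elErr_apply (hL : ContDiff ℝ ∞ L) (hu : ContDiff ℝ ∞ u) (x e b : E n) :
    fderiv ℝ (elErr L δ Ω u) x e b =
      hess L δ Ω u (x + δ • Ω) (zjac δ Ω u (x + δ • Ω) e) (b, 0) -
      δ⁻¹ * (hess L δ Ω u (x + δ • Ω) (zjac δ Ω u (x + δ • Ω) e) (0, b) -
        hess L δ Ω u x (zjac δ Ω u x e) (0, b)) := by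
  have h0 := fun y => hasFDerivAt_fderiv_zmap (δ := δ) (Ω := Ω) hL hu y
  have h1 := HasFDerivAt.comp_shift (h0 (x + δ • Ω))
  let cl := (ContinuousLinearMap.compL ℝ (E n) (E n × E n) ℝ).flip
    (ContinuousLinearMap.inl ℝ (E n) (E n))
  let cr := (ContinuousLinearMap.compL ℝ (E n) (E n × E n) ℝ).flip
    (ContinuousLinearMap.inr ℝ (E n) (E n))
  have h2 := (cl.hasFDerivAt.comp x h1).sub
    (((cr.hasFDerivAt.comp x h1).sub (cr.hasFDerivAt.comp x (h0 x))).const_smul δ⁻¹)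
  have h3 : HasFDerivAt (elErr L δ Ω u) _ x := h2
  rw [h3.fderiv]
  rfl

lemma isPer_zmap_fst (hu : IsPer u) (x : E n) (l : Fin n → ℤ) :
    zmap δ Ω u (x + intVec l) = ((zmap δ Ω u x).1 + intVec l, (zmap δ Ω u x).2) := by
  unfold zmap
  rw [hu x l, hu.dd δ Ω x l]
  rw [add_right_comm]

lemma isPer_comp_zmap
    (hLper : ∀ (x y : E n) (l : Fin n → ℤ), L (x + intVec l, y) = L (x, y))
    (hu : IsPer u) : IsPer fun x => L (zmap δ Ω u x) := by
  intro x l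
  simp only
  rw [isPer_zmap_fst hu, hLper]

lemma fderiv_lag_per
    (hLper : ∀ (x y : E n) (l : Fin n → ℤ), L (x + intVec l, y) = L (x, y))
    (z : E n × E n) (l : Fin n → ℤ) :
    fderiv ℝ L (z.1 + intVec l, z.2) = fderiv ℝ L z := by
  have h : (fun z : E n × E n => L (z + (intVec l, 0))) = L := by
    funext z
    have := hLper z.1 z.2 l
    simpa [Prod.add_def] using this
  conv_rhs => rw [← h]
  rw [fderiv_comp_add_right]
  congr 1
  ext <;> simp

lemma hess_lag_per
    (hLper : ∀ (x y : E n) (l : Fin n → ℤ), L (x + intVec l, y) = L (x, y))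
    (z : E n × E n) (l : Fin n → ℤ) :
    fderiv ℝ (fderiv ℝ L) (z.1 + intVec l, z.2) = fderiv ℝ (fderiv ℝ L) z := by
  have h : (fun z : E n × E n => fderiv ℝ L (z + (intVec l, 0))) = fderiv ℝ L := by
    funext z
    have := fderiv_lag_per hLper z l
    simpa [Prod.add_def] using this
  conv_rhs => rw [← h]
  rw [fderiv_comp_add_right]
  congr 1
  ext <;> simp

lemma isPer_fderiv_zmap
    (hLper : ∀ (x y : E n) (l : Fin n → ℤ), L (x + intVec l, y) = L (x, y))
    (hu : IsPer u) : IsPer fun x => fderiv ℝ L (zmap δ Ω u x) := by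
  intro x l
  simp only
  rw [isPer_zmap_fst hu, fderiv_lag_per hLper]

lemma isPer_hess
    (hLper : ∀ (x y : E n) (l : Fin n → ℤ), L (x + intVec l, y) = L (x, y))
    (hu : IsPer u) : IsPer (hess L δ Ω u) := by
  intro x l
  simp only [hess]
  rw [isPer_zmap_fst hu, hess_lag_per hLper]

lemma IsPer.jac (hu : IsPer u) : IsPer (jac u) := hu.fderiv.comp (1 + ·)

lemma IsPer.zjac (hu : IsPer u) : IsPer (zjac δ Ω u) :=
  hu.jac.comp₂ (hu.fderiv.dd δ Ω) (·.prod ·)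

lemma isPer_elErr
    (hLper : ∀ (x y : E n) (l : Fin n → ℤ), L (x + intVec l, y) = L (x, y))
    (hu : IsPer u) : IsPer (elErr L δ Ω u) :=
  (((isPer_fderiv_zmap hLper hu).comp (·.comp (ContinuousLinearMap.inl ℝ (E n) (E n)))).shift
    (δ • Ω)).comp₂ (((isPer_fderiv_zmap hLper hu).comp
      (·.comp (ContinuousLinearMap.inr ℝ (E n) (E n)))).dd δ Ω) (· - ·)

lemma isPer_twist
    (hLper : ∀ (x y : E n) (l : Fin n → ℤ), L (x + intVec l, y) = L (x, y))
    (hu : IsPer u) : IsPer (twist L δ Ω u) := by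
  intro x l
  have hj : jac u (x + intVec l + δ • Ω) = jac u (x + δ • Ω) := hu.jac.shift (δ • Ω) x l
  ext a b
  rw [twist_apply, twist_apply, isPer_hess hLper hu x l, hu.jac x l, hj]

lemma isPer_lagForm
    (hLper : ∀ (x y : E n) (l : Fin n → ℤ), L (x + intVec l, y) = L (x, y))
    (hu : IsPer u) : IsPer (lagForm L δ Ω u) := by
  intro x l
  have hj : jac u (x + intVec l + δ • Ω) = jac u (x + δ • Ω) := hu.jac.shift (δ • Ω) x l
  ext a b
  rw [lagForm_apply, lagForm_apply, isPer_hess hLper hu x l, hu.zjac x l, hj]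

lemma contDiff_fderiv_zmap (hL : ContDiff ℝ ∞ L) (hu : ContDiff ℝ ∞ u) :
    ContDiff ℝ ∞ fun x => fderiv ℝ L (zmap δ Ω u x) :=
  (hL.fderiv_right (by simp)).comp (contDiff_zmap hu)

lemma contDiff_hess (hL : ContDiff ℝ ∞ L) (hu : ContDiff ℝ ∞ u) : ContDiff ℝ ∞ (hess L δ Ω u) := by
  have h1 : ContDiff ℝ ∞ (fderiv ℝ L) := hL.fderiv_right (by simp)
  exact (h1.fderiv_right (by simp)).comp (contDiff_zmap hu)

lemma contDiff_jac (hu : ContDiff ℝ ∞ u) : ContDiff ℝ ∞ (jac u) :=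
  contDiff_const.add (hu.fderiv_right (by simp))

lemma contDiff_zjac (hu : ContDiff ℝ ∞ u) : ContDiff ℝ ∞ (zjac δ Ω u) := by
  have h1 : ContDiff ℝ ∞ (fderiv ℝ u) := hu.fderiv_right (by simp)
  have : zjac δ Ω u = fun x => (ContinuousLinearMap.inl ℝ (E n) (E n)).comp (jac u x) +
      (ContinuousLinearMap.inr ℝ (E n) (E n)).comp (dd δ Ω (fderiv ℝ u) x) := by
    funext x
    ext a <;> simp [zjac]
  rw [this]
  exact (contDiff_const.clm_comp (contDiff_jac hu)).add
    (contDiff_const.clm_comp (contDiff_dd h1 δ Ω))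

lemma contDiff_elErr (hL : ContDiff ℝ ∞ L) (hu : ContDiff ℝ ∞ u) :
    ContDiff ℝ ∞ (elErr L δ Ω u) := by
  have h1 := contDiff_fderiv_zmap (δ := δ) (Ω := Ω) hL hu
  have h2 : ContDiff ℝ ∞ fun x => fderiv ℝ L (zmap δ Ω u (x + δ • Ω)) :=
    h1.comp (g := fun x => fderiv ℝ L (zmap δ Ω u x)) (by fun_prop)
  exact (h2.clm_comp contDiff_const).sub (contDiff_dd (h1.clm_comp contDiff_const) δ Ω)

end DiscreteEulerLagrange

section NewtonIdentities

open scoped ContDiff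

variable {n : ℕ} {L : E n × E n → ℝ} {δ : ℝ} {Ω : E n} {u : E n → E n}

lemma dd_jac_apply (z : E n → E n) (x : E n) :
    (jac u x (z x), dd δ Ω (fun y => jac u y (z y)) x) =
      zjac δ Ω u x (z x) + ((0 : E n), jac u (x + δ • Ω) (dd δ Ω z x)) := by
  rw [zjac_apply]
  ext1
  · simp
  · simp only [Prod.snd_add, dd, map_smul, map_sub]
    module

lemma shift_eq_add_dd {F : Type*} [NormedAddCommGroup F] [NormedSpace ℝ F] (hδ : δ ≠ 0)
    (z : E n → F) (x : E n) : z (x + δ • Ω) = z x + δ • dd δ Ω z x := by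
  simp [dd, smul_smul, hδ]

lemma linErr_apply (w : E n → E n) (x c : E n) : linErr L δ Ω u w x c =
    hess L δ Ω u (x + δ • Ω) (w (x + δ • Ω), dd δ Ω w (x + δ • Ω)) (c, 0) -
      δ⁻¹ * (hess L δ Ω u (x + δ • Ω) (w (x + δ • Ω), dd δ Ω w (x + δ • Ω)) (0, c) -
        hess L δ Ω u x (w x, dd δ Ω w x) (0, c)) := rfl

lemma pairing_twist (T : E n × E n →L[ℝ] ℝ) (c : E n) :
    T (-(δ • c), c) = T (0, c) - δ * T (c, 0) := by
  rw [← smul_eq_mul, ← map_smul, ← map_sub]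
  simp

lemma pairing_zjac (T : E n × E n →L[ℝ] ℝ) (x b : E n) :
    T (zjac δ Ω u x b) =
      T (jac u x b, 0) + δ⁻¹ * (T (0, jac u (x + δ • Ω) b) - T (0, jac u x b)) := by
  rw [← smul_eq_mul, ← map_sub, ← map_smul, ← map_add, zjac_apply]
  simp

lemma linErr_jac (hδ : δ ≠ 0) (hL : ContDiff ℝ ∞ L) (hu : ContDiff ℝ ∞ u) (z : E n → E n)
    (x b : E n) :
    linErr L δ Ω u (fun y => jac u y (z y)) x (jac u (x + δ • Ω) b) =
      fderiv ℝ (elErr L δ Ω u) x (z (x + δ • Ω)) (jac u (x + δ • Ω) b) -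
      dd δ Ω (fun y => twist L δ Ω u y (dd δ Ω z y) b) x - lagForm L δ Ω u x (dd δ Ω z x) b := by
  rw [fderiv_elErr_apply hL hu, linErr_apply, dd_jac_apply, dd_jac_apply, lagForm_apply,
    hess_symm hL x (zjac δ Ω u x b)]
  simp only [dd.eq_1 δ Ω (fun y => twist L δ Ω u y (dd δ Ω z y) b), smul_eq_mul]
  rw [twist_apply, twist_apply, pairing_twist, pairing_twist, pairing_zjac _ x b]
  have hz : hess L δ Ω u x (zjac δ Ω u x (z (x + δ • Ω))) (0, jac u (x + δ • Ω) b) =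
      hess L δ Ω u x (zjac δ Ω u x (z x)) (0, jac u (x + δ • Ω) b) +
      δ * hess L δ Ω u x (zjac δ Ω u x (dd δ Ω z x)) (0, jac u (x + δ • Ω) b) := by
    rw [shift_eq_add_dd hδ z x]
    simp [-smul_eq_mul]
    simp
  rw [hz]
  simp only [map_add, add_apply]
  field_simp
  ring

lemma dd_lagForm (hδ : δ ≠ 0) (hL : ContDiff ℝ ∞ L) (hu : ContDiff ℝ ∞ u) (x a b : E n) :
    dd δ Ω (lagForm L δ Ω u) x a b =
      fderiv ℝ (elErr L δ Ω u) x b (jac u (x + δ • Ω) a) -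
        fderiv ℝ (elErr L δ Ω u) x a (jac u (x + δ • Ω) b) := by
  rw [fderiv_elErr_apply hL hu, fderiv_elErr_apply hL hu]
  simp only [dd, smul_apply, sub_apply, smul_eq_mul, lagForm_apply]
  have h1 := pairing_zjac (δ := δ) (Ω := Ω) (u := u)
    (hess L δ Ω u (x + δ • Ω) (zjac δ Ω u (x + δ • Ω) a)) (x + δ • Ω) b
  have h2 := pairing_zjac (δ := δ) (Ω := Ω) (u := u)
    (hess L δ Ω u (x + δ • Ω) (zjac δ Ω u (x + δ • Ω) b)) (x + δ • Ω) a
  rw [hess_symm hL] at h2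
  rw [h1] at h2
  field_simp at h2 ⊢
  linarith

lemma elErr_jac_apply (hL : ContDiff ℝ ∞ L) (hu : ContDiff ℝ ∞ u) (x b : E n) :
    elErr L δ Ω u x (jac u (x + δ • Ω) b) =
      fderiv ℝ (fun y => L (zmap δ Ω u y)) (x + δ • Ω) b -
        dd δ Ω (fun y => fderiv ℝ L (zmap δ Ω u y) (0, jac u (y + δ • Ω) b)) x := by
  have h1 : HasFDerivAt (fun y => L (zmap δ Ω u y))
      ((fderiv ℝ L (zmap δ Ω u (x + δ • Ω))).comp (zjac δ Ω u (x + δ • Ω))) (x + δ • Ω) :=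
    HasFDerivAt.comp (g := L) (f := zmap δ Ω u) _ (hL.differentiable (by simp) _).hasFDerivAt
      (hasFDerivAt_zmap hu _)
  rw [h1.fderiv, ContinuousLinearMap.comp_apply, pairing_zjac]
  simp only [elErr, dd, smul_apply, sub_apply, smul_eq_mul, ContinuousLinearMap.comp_apply,
    ContinuousLinearMap.inl_apply, ContinuousLinearMap.inr_apply]
  ring

lemma lagForm_apply_eq (hL : ContDiff ℝ ∞ L) (hu : ContDiff ℝ ∞ u) (x a b : E n) :
    lagForm L δ Ω u x a b =
      fderiv ℝ (fun y => fderiv ℝ L (zmap δ Ω u y) (0, jac u (y + δ • Ω) b)) x a -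
        fderiv ℝ (fun y => fderiv ℝ L (zmap δ Ω u y) (0, jac u (y + δ • Ω) a)) x b := by
  have h0 := hasFDerivAt_fderiv_zmap (δ := δ) (Ω := Ω) hL hu x
  have hj : HasFDerivAt (fun y => jac u (y + δ • Ω)) (fderiv ℝ (fderiv ℝ u) (x + δ • Ω)) x := by
    have h1 : ContDiff ℝ ∞ (fderiv ℝ u) := hu.fderiv_right (by simp)
    exact ((h1.differentiable (by simp) (x + δ • Ω)).hasFDerivAt.comp_shift).const_add 1
  have key : ∀ c e, fderiv ℝ (fun y => fderiv ℝ L (zmap δ Ω u y) (0, jac u (y + δ • Ω) c)) x e =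
      hess L δ Ω u x (zjac δ Ω u x e) (0, jac u (x + δ • Ω) c) +
        fderiv ℝ L (zmap δ Ω u x) (0, fderiv ℝ (fderiv ℝ u) (x + δ • Ω) e c) := by
    intro c e
    have h2 : HasFDerivAt (fun y => ContinuousLinearMap.inr ℝ (E n) (E n) (jac u (y + δ • Ω) c)) _ x :=
      (ContinuousLinearMap.inr ℝ (E n) (E n)).hasFDerivAt.comp x (hj.clm_apply (hasFDerivAt_const c x))
    have h3 := h0.clm_apply h2
    have h4 := h3.fderiv
    simp only [ContinuousLinearMap.inr_apply] at h4
    rw [h4]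
    simp
    ring
  rw [key, key, lagForm_apply]
  have hs : fderiv ℝ (fderiv ℝ u) (x + δ • Ω) a b = fderiv ℝ (fderiv ℝ u) (x + δ • Ω) b a :=
    (hu.contDiffAt.isSymmSndFDerivAt
      (by simpa using (WithTop.coe_le_coe.2 (le_top : (2 : ℕ∞) ≤ ⊤)))).eq a b
  rw [hs]
  ring

section Periodic

lemma contDiff_momentum (hL : ContDiff ℝ ∞ L) (hu : ContDiff ℝ ∞ u) (b : E n) :
    ContDiff ℝ ∞ fun y => fderiv ℝ L (zmap δ Ω u y) (0, jac u (y + δ • Ω) b) := by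
  have h1 : ContDiff ℝ ∞ fun y => jac u (y + δ • Ω) :=
    (contDiff_jac hu).comp (g := jac u) (by fun_prop)
  exact (contDiff_fderiv_zmap hL hu).clm_apply
    (contDiff_const.prodMk (h1.clm_apply contDiff_const))

lemma isPer_momentum
    (hLper : ∀ (x y : E n) (l : Fin n → ℤ), L (x + intVec l, y) = L (x, y))
    (hu : IsPer u) (b : E n) :
    IsPer fun y => fderiv ℝ L (zmap δ Ω u y) (0, jac u (y + δ • Ω) b) :=
  (isPer_fderiv_zmap hLper hu).comp₂ (hu.jac.shift (δ • Ω)) fun T J => T (0, J b)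

lemma torusMean_elErr_jac
    (hLper : ∀ (x y : E n) (l : Fin n → ℤ), L (x + intVec l, y) = L (x, y))
    (hL : ContDiff ℝ ∞ L) (hu : ContDiff ℝ ∞ u) (hp : IsPer u) :
    torusMean (fun x => (elErr L δ Ω u x).comp (jac u (x + δ • Ω))) = 0 := by
  have hLz : ContDiff ℝ ∞ fun y => L (zmap δ Ω u y) := hL.comp (contDiff_zmap hu)
  have hLp : IsPer fun y => L (zmap δ Ω u y) := isPer_comp_zmap hLper hp
  have hj : ContDiff ℝ ∞ fun y => jac u (y + δ • Ω) :=
    (contDiff_jac hu).comp (g := jac u) (by fun_prop)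
  ext b
  rw [← ContinuousLinearMap.apply_apply (𝕜 := ℝ) b (torusMean _), ← torusMean_clm]
  · simp only [ContinuousLinearMap.apply_apply, ContinuousLinearMap.comp_apply,
      elErr_jac_apply hL hu]
    have hd : ContDiff ℝ ∞ fun x => fderiv ℝ (fun y => L (zmap δ Ω u y)) x b :=
      (hLz.fderiv_right (by simp)).clm_apply contDiff_const
    have hdp : IsPer fun x => fderiv ℝ (fun y => L (zmap δ Ω u y)) x b :=
      hLp.fderiv.comp (fun T => T b)
    rw [torusMean_sub (hdp.shift (δ • Ω)) (hd.continuous.comp (by fun_prop))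
      ((isPer_momentum hLper hp b).dd δ Ω) (contDiff_dd (contDiff_momentum hL hu b) δ Ω).continuous,
      torusMean_dd (isPer_momentum hLper hp b) (contDiff_momentum hL hu b).continuous,
      torusMean_shift hdp (δ • Ω), torusMean_fderiv hLp hLz b]
    simp
  · exact (isPer_elErr hLper hp).comp₂ (hp.jac.shift (δ • Ω)) (·.comp ·)
  · exact ((contDiff_elErr hL hu).clm_comp hj).continuous

lemma contDiff_lagForm (hL : ContDiff ℝ ∞ L) (hu : ContDiff ℝ ∞ u) :
    ContDiff ℝ ∞ (lagForm L δ Ω u) := by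
  have hj : ContDiff ℝ ∞ fun y => jac u (y + δ • Ω) :=
    (contDiff_jac hu).comp (g := jac u) (by fun_prop)
  have h1 : ContDiff ℝ ∞ fun x => bform ((hess L δ Ω u x).comp (zjac δ Ω u x))
      ((ContinuousLinearMap.inr ℝ (E n) (E n)).comp (jac u (x + δ • Ω))) := by
    unfold bform
    refine ContDiff.clm_comp ?_ ((contDiff_hess hL hu).clm_comp (contDiff_zjac hu))
    exact (ContinuousLinearMap.contDiff _).comp (contDiff_const.clm_comp hj)
  have h2 : ContDiff ℝ ∞ fun x => (bform ((hess L δ Ω u x).comp (zjac δ Ω u x))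
      ((ContinuousLinearMap.inr ℝ (E n) (E n)).comp (jac u (x + δ • Ω)))).flip := by
    refine contDiff_clm_apply_iff.2 fun a => contDiff_clm_apply_iff.2 fun b => ?_
    exact (h1.clm_apply contDiff_const).clm_apply contDiff_const
  exact h1.sub h2

lemma torusMean_lagForm
    (hLper : ∀ (x y : E n) (l : Fin n → ℤ), L (x + intVec l, y) = L (x, y))
    (hL : ContDiff ℝ ∞ L) (hu : ContDiff ℝ ∞ u) (hp : IsPer u) :
    torusMean (lagForm L δ Ω u) = 0 := by
  ext a b
  let T : (E n →L[ℝ] E n →L[ℝ] ℝ) →L[ℝ] ℝ :=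
    (ContinuousLinearMap.apply ℝ ℝ b).comp (ContinuousLinearMap.apply ℝ (E n →L[ℝ] ℝ) a)
  change T (torusMean _) = 0
  rw [← torusMean_clm T (isPer_lagForm hLper hp) (contDiff_lagForm hL hu).continuous]
  have h1 : ∀ x, T (lagForm L δ Ω u x) = lagForm L δ Ω u x a b := fun _ => rfl
  simp only [h1, lagForm_apply_eq hL hu]
  have hd : ∀ c e, Continuous fun x => fderiv ℝ
      (fun y => fderiv ℝ L (zmap δ Ω u y) (0, jac u (y + δ • Ω) c)) x e := fun c e =>
    (((contDiff_momentum hL hu c).fderiv_right (m := ∞) (by simp)).clm_apply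
      contDiff_const).continuous
  have hdp : ∀ c e, IsPer fun x => fderiv ℝ
      (fun y => fderiv ℝ L (zmap δ Ω u y) (0, jac u (y + δ • Ω) c)) x e := fun c e =>
    (isPer_momentum hLper hp c).fderiv.comp (fun T => T e)
  rw [torusMean_sub (hdp b a) (hd b a) (hdp a b) (hd a b),
    torusMean_fderiv (isPer_momentum hLper hp b) (contDiff_momentum hL hu b),
    torusMean_fderiv (isPer_momentum hLper hp a) (contDiff_momentum hL hu a), sub_zero]

end Periodic

end NewtonIdentities

section LagrangianFamily

open scoped ContDiff

variable {n : ℕ}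

/-- The quadratic part of the Lagrangian as a bilinear form on `(position, velocity)`. -/
def kin (Bf : E n ≃L[ℝ] (E n →L[ℝ] ℝ)) : E n × E n →L[ℝ] E n × E n →L[ℝ] ℝ :=
  (((ContinuousLinearMap.compL ℝ (E n × E n) (E n) ℝ).flip (ContinuousLinearMap.snd ℝ (E n) (E n))).comp
    (Bf : E n →L[ℝ] (E n →L[ℝ] ℝ))).comp (ContinuousLinearMap.snd ℝ (E n) (E n))

lemma kin_apply (Bf : E n ≃L[ℝ] (E n →L[ℝ] ℝ)) (z w : E n × E n) : kin Bf z w = Bf z.2 w.2 := rfl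

def lagr (Bf : E n ≃L[ℝ] (E n →L[ℝ] ℝ)) (r : ℝ → E n × E n → ℝ) (δ : ℝ) (z : E n × E n) : ℝ :=
  1 / 2 * kin Bf z z + δ * r δ z

/-- A family of perturbations that is bounded in `C^∞` together with a symmetric quadratic form. -/
structure LagFamily (Bf : E n ≃L[ℝ] (E n →L[ℝ] ℝ)) (r : ℝ → E n × E n → ℝ) (δ₀ : ℝ) : Prop where
  symm : ∀ a b, Bf a b = Bf b a
  smooth : ∀ δ, ContDiff ℝ ∞ (r δ)
  bound : ∀ k : ℕ, ∃ C, ∀ δ ∈ Set.Ioc 0 δ₀, ∀ z, ‖iteratedFDeriv ℝ k (r δ) z‖ ≤ C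
  per : ∀ δ ∈ Set.Ioc 0 δ₀, ∀ (x y : E n) (l : Fin n → ℤ), r δ (x + intVec l, y) = r δ (x, y)

variable {Bf : E n ≃L[ℝ] (E n →L[ℝ] ℝ)} {r : ℝ → E n × E n → ℝ} {δ₀ : ℝ}

namespace LagFamily

lemma contDiff_lagr (h : LagFamily Bf r δ₀) (δ : ℝ) : ContDiff ℝ ∞ (lagr Bf r δ) := by
  have h1 : ContDiff ℝ ∞ fun z : E n × E n => kin Bf z z :=
    (contDiff_const.clm_apply contDiff_id).clm_apply contDiff_id
  exact (contDiff_const.mul h1).add (contDiff_const.mul (h.smooth δ))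

lemma lagr_per (h : LagFamily Bf r δ₀) {δ : ℝ} (hδ : δ ∈ Set.Ioc 0 δ₀) (x y : E n)
    (l : Fin n → ℤ) : lagr Bf r δ (x + intVec l, y) = lagr Bf r δ (x, y) := by
  simp only [lagr, kin_apply, h.per δ hδ]

lemma fderiv_lagr (h : LagFamily Bf r δ₀) (δ : ℝ) (z : E n × E n) :
    fderiv ℝ (lagr Bf r δ) z = kin Bf z + δ • fderiv ℝ (r δ) z := by
  have h1 : HasFDerivAt (r δ) (fderiv ℝ (r δ) z) z :=
    ((h.smooth δ).differentiable (by simp) z).hasFDerivAt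
  have h2 := ((kin Bf).hasFDerivAt (x := z)).clm_apply (hasFDerivAt_id z)
  have h3 : HasFDerivAt (lagr Bf r δ) _ z := (h2.const_mul (1 / 2)).add (h1.const_mul δ)
  rw [h3.fderiv]
  ext1 <;> ext v <;> simp [kin_apply, h.symm _ z.2]
  ring

lemma hess_lagr (h : LagFamily Bf r δ₀) (δ : ℝ) (Ω : E n) (u : E n → E n) (x : E n) :
    hess (lagr Bf r δ) δ Ω u x = kin Bf + δ • fderiv ℝ (fderiv ℝ (r δ)) (zmap δ Ω u x) := by
  have h0 : fderiv ℝ (lagr Bf r δ) = fun z => kin Bf z + δ • fderiv ℝ (r δ) z :=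
    funext fun z => h.fderiv_lagr δ z
  have h1 : HasFDerivAt (fderiv ℝ (r δ)) (fderiv ℝ (fderiv ℝ (r δ)) (zmap δ Ω u x))
      (zmap δ Ω u x) := by
    have h2 : ContDiff ℝ ∞ (fderiv ℝ (r δ)) := (h.smooth δ).fderiv_right (by simp)
    exact (h2.differentiable (by simp) _).hasFDerivAt
  have h3 : HasFDerivAt (fun z => kin Bf z + δ • fderiv ℝ (r δ) z) _ (zmap δ Ω u x) :=
    (kin Bf).hasFDerivAt.add (h1.const_smul δ)
  rw [hess, h0, h3.fderiv]

lemma exists_twist_bound (h : LagFamily Bf r δ₀) (hδ₀ : δ₀ ≤ 1) : ∃ η : ℝ, 0 < η ∧ η ≤ 1 / 4 ∧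
    ∀ δ ∈ Set.Ioc 0 δ₀, δ ≤ η → ∀ (Ω : E n) (u : E n → E n), (∀ x, ‖fderiv ℝ u x‖ ≤ η) →
      ∀ x, ‖(Bf.symm : (E n →L[ℝ] ℝ) →L[ℝ] E n).comp (twist (lagr Bf r δ) δ Ω u x) - 1‖ ≤ 1 / 4 := by
  obtain ⟨K, hK⟩ := h.bound 2
  set b : ℝ := ‖(Bf : E n →L[ℝ] (E n →L[ℝ] ℝ))‖
  set bi : ℝ := ‖(Bf.symm : (E n →L[ℝ] ℝ) →L[ℝ] E n)‖
  have hb : 0 ≤ b := by positivity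
  have hbi : 0 ≤ bi := by positivity
  set c : ℝ := 3 * b + 4 * |K| + 1
  have hc : 0 < c := by positivity
  refine ⟨min (1 / 4) (1 / (4 * ((bi + 1) * c))), by positivity, min_le_left _ _, ?_⟩
  set η : ℝ := min (1 / 4) (1 / (4 * ((bi + 1) * c)))
  have hη : 0 < η := by positivity
  have hη1 : η ≤ 1 / 4 := min_le_left _ _
  have hη2 : (bi + 1) * (η * c) ≤ 1 / 4 := by
    have : η ≤ 1 / (4 * ((bi + 1) * c)) := min_le_right _ _
    rw [le_div_iff₀ (by positivity)] at this
    linarith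
  intro δ hδ hδη Ω u hu x
  have hJ1 : ∀ y a, ‖jac u y a - a‖ ≤ η * ‖a‖ := by
    intro y a
    have : jac u y a - a = fderiv ℝ u y a := by simp [jac]
    rw [this]
    exact ContinuousLinearMap.le_of_opNorm_le _ (hu y) a
  have hJ2 : ∀ y a, ‖jac u y a‖ ≤ 2 * ‖a‖ := by
    intro y a
    have h1 := norm_sub_norm_le (jac u y a) a
    have h2 := hJ1 y a
    nlinarith [norm_nonneg a]
  have hdiff : ‖twist (lagr Bf r δ) δ Ω u x - (Bf : E n →L[ℝ] (E n →L[ℝ] ℝ))‖ ≤ η * c := by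
    refine ContinuousLinearMap.opNorm_le_bound₂ _ (by positivity) fun a e => ?_
    have e1 : (twist (lagr Bf r δ) δ Ω u x - (Bf : E n →L[ℝ] (E n →L[ℝ] ℝ))) a e =
        Bf (jac u (x + δ • Ω) a - a) (jac u x e) + Bf a (jac u x e - e) +
        δ * fderiv ℝ (fderiv ℝ (r δ)) (zmap δ Ω u x) (0, jac u (x + δ • Ω) a)
          (-(δ • jac u x e), jac u x e) := by
      rw [sub_apply, sub_apply, twist_apply, h.hess_lagr]
      simp [kin_apply]
      ring
    have e2 : ‖Bf (jac u (x + δ • Ω) a - a) (jac u x e)‖ ≤ b * (η * ‖a‖) * (2 * ‖e‖) := by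
      refine ((Bf : E n →L[ℝ] (E n →L[ℝ] ℝ)).le_opNorm₂ _ _).trans ?_
      gcongr
      exacts [hJ1 _ _, hJ2 _ _]
    have e3 : ‖Bf a (jac u x e - e)‖ ≤ b * ‖a‖ * (η * ‖e‖) := by
      refine ((Bf : E n →L[ℝ] (E n →L[ℝ] ℝ)).le_opNorm₂ _ _).trans ?_
      gcongr
      exact hJ1 _ _
    have e4 : ‖δ * fderiv ℝ (fderiv ℝ (r δ)) (zmap δ Ω u x) (0, jac u (x + δ • Ω) a)
          (-(δ • jac u x e), jac u x e)‖ ≤ η * (|K| * (2 * ‖a‖) * (2 * ‖e‖)) := by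
      rw [norm_mul, Real.norm_of_nonneg hδ.1.le]
      refine mul_le_mul hδη ?_ (norm_nonneg _) hη.le
      refine (ContinuousLinearMap.le_opNorm₂ _ _ _).trans ?_
      have k1 : ‖fderiv ℝ (fderiv ℝ (r δ)) (zmap δ Ω u x)‖ ≤ |K| := by
        have := hK δ hδ (zmap δ Ω u x)
        rw [← norm_iteratedFDeriv_fderiv, ← norm_iteratedFDeriv_fderiv,
          norm_iteratedFDeriv_zero] at this
        exact this.trans (le_abs_self K)
      have k2 : ‖((0 : E n), jac u (x + δ • Ω) a)‖ ≤ 2 * ‖a‖ := by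
        rw [Prod.norm_def]
        simpa using hJ2 _ _
      have k3 : ‖(-(δ • jac u x e), jac u x e)‖ ≤ 2 * ‖e‖ := by
        rw [Prod.norm_def]
        refine max_le ?_ (hJ2 _ _)
        rw [norm_neg, norm_smul, Real.norm_of_nonneg hδ.1.le]
        have := hJ2 x e
        have h4 : δ ≤ 1 := hδ.2.trans hδ₀
        nlinarith [norm_nonneg (jac u x e)]
      gcongr
    rw [e1]
    refine (norm_add₃_le).trans ((add_le_add_three e2 e3 e4).trans (le_of_sub_nonneg ?_))
    have : η * c * ‖a‖ * ‖e‖ - (b * (η * ‖a‖) * (2 * ‖e‖) + b * ‖a‖ * (η * ‖e‖) +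
        η * (|K| * (2 * ‖a‖) * (2 * ‖e‖))) = η * ‖a‖ * ‖e‖ := by
      simp only [c]; ring
    rw [this]
    positivity
  have e5 : (Bf.symm : (E n →L[ℝ] ℝ) →L[ℝ] E n).comp (twist (lagr Bf r δ) δ Ω u x) - 1 =
      (Bf.symm : (E n →L[ℝ] ℝ) →L[ℝ] E n).comp
        (twist (lagr Bf r δ) δ Ω u x - (Bf : E n →L[ℝ] (E n →L[ℝ] ℝ))) := by
    ext1 a
    simp
  rw [e5]
  refine (ContinuousLinearMap.opNorm_comp_le _ _).trans ?_
  calc bi * _ ≤ (bi + 1) * (η * c) := by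
        refine mul_le_mul (by linarith) hdiff (norm_nonneg _) (by positivity)
    _ ≤ 1 / 4 := hη2

end LagFamily

end LagrangianFamily

section NewtonCoefficients

open scoped ContDiff

variable {n : ℕ}

/-- Inverse of the twist, normalized by the quadratic part of the Lagrangian. -/
def twistInv (Bf : E n ≃L[ℝ] (E n →L[ℝ] ℝ)) (L : E n × E n → ℝ) (δ : ℝ) (Ω : E n) (u : E n → E n)
    (x : E n) : E n →L[ℝ] E n :=
  Ring.inverse ((Bf.symm : (E n →L[ℝ] ℝ) →L[ℝ] E n).comp (twist L δ Ω u x))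

/-- A family of approximately invariant tori with uniform control of all derivatives. -/
structure TorusFamily {ι : Type*} (Bf : E n ≃L[ℝ] (E n →L[ℝ] ℝ)) (r : ℝ → E n × E n → ℝ)
    (δ₀ : ℝ) (Ω : E n) (Λ : ℝ) (p : ℕ) (δ κ N : ι → ℝ) (u : ι → E n → E n) : Prop where
  lag : LagFamily Bf r δ₀
  delta_mem : ∀ i, δ i ∈ Set.Ioc 0 δ₀
  delta_le : ∀ i, δ i ≤ κ i
  kappa_le : ∀ i, κ i ≤ 1
  one_le : ∀ i, 1 ≤ N i
  small_divisor : ∀ i, SmallDivisor (δ i) Ω Λ p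
  nonneg : 0 ≤ Λ
  smooth : ∀ i, ContDiff ℝ ∞ (u i)
  per : ∀ i, IsPer (u i)
  bound : ∀ k : ℕ, ∃ C, 0 ≤ C ∧ ∀ i x, ‖iteratedFDeriv ℝ k (u i) x‖ ≤ C * (κ i * N i ^ (k - 1))
  fderiv_le : ∀ i x, ‖fderiv ℝ (u i) x‖ ≤ 1 / 4
  twist_le : ∀ i x, ‖(Bf.symm : (E n →L[ℝ] ℝ) →L[ℝ] E n).comp
    (twist (lagr Bf r (δ i)) (δ i) Ω (u i) x) - 1‖ ≤ 1 / 4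

namespace TorusFamily

variable {ι : Type*} {Bf : E n ≃L[ℝ] (E n →L[ℝ] ℝ)} {r : ℝ → E n × E n → ℝ} {δ₀ : ℝ} {Ω : E n}
  {Λ : ℝ} {p : ℕ} {δ κ N : ι → ℝ} {u : ι → E n → E n}

lemma kappa_nonneg (h : TorusFamily Bf r δ₀ Ω Λ p δ κ N u) (i : ι) : 0 ≤ κ i :=
  (h.delta_mem i).1.le.trans (h.delta_le i)

lemma tame_fderiv (h : TorusFamily Bf r δ₀ Ω Λ p δ κ N u) :
    Tame 0 (fun _ => κ) N fun i => fderiv ℝ (u i) where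
  smooth i := (h.smooth i).fderiv_right (by simp)
  size_nonneg _ i := h.kappa_nonneg i
  one_le := h.one_le
  bound _ k := by
    obtain ⟨C, hC, hb⟩ := h.bound (k + 1)
    refine ⟨C, hC, fun i x => ?_⟩
    rw [norm_iteratedFDeriv_fderiv]
    simpa using hb i x

lemma tame_one (h : TorusFamily Bf r δ₀ Ω Λ p δ κ N u) {c : ℕ} {X F : Type*}
    [NormedAddCommGroup X] [NormedSpace ℝ X] [NormedAddCommGroup F] [NormedSpace ℝ F]
    {f : ι → X → F} {N' : ι → ℝ} (hf : Tame c (fun _ => κ) N' f) :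
    Tame c (fun _ _ => 1) N' f :=
  hf.mono (a := fun _ => 1) (fun _ i => by simpa using h.kappa_le i) (fun _ _ => zero_le_one)
    (fun _ => le_rfl) le_rfl

lemma tame_jac (h : TorusFamily Bf r δ₀ Ω Λ p δ κ N u) :
    Tame 0 (fun _ _ => 1) N fun i => jac (u i) :=
  (tame_const h.one_le (fun _ => (1 : E n →L[ℝ] E n)) (fun _ _ => zero_le_one)
    (a := ‖(1 : E n →L[ℝ] E n)‖) (fun _ _ => by simp)).add_self (h.tame_one h.tame_fderiv)

lemma tame_jac_shift (h : TorusFamily Bf r δ₀ Ω Λ p δ κ N u) :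
    Tame 0 (fun _ _ => 1) N fun i x => jac (u i) (x + δ i • Ω) :=
  h.tame_jac.shift fun i => δ i • Ω

lemma delta_pos (h : TorusFamily Bf r δ₀ Ω Λ p δ κ N u) (i : ι) : 0 < δ i := (h.delta_mem i).1

lemma tame_dd (h : TorusFamily Bf r δ₀ Ω Λ p δ κ N u) :
    Tame 0 (fun _ => κ) N fun i => dd (δ i) Ω (u i) where
  smooth i := contDiff_dd (h.smooth i) _ _
  size_nonneg _ i := h.kappa_nonneg i
  one_le := h.one_le
  bound _ k := by
    obtain ⟨C, hC, hb⟩ := h.bound (k + 1)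
    refine ⟨C * ‖Ω‖, by positivity, fun i x => ?_⟩
    have := norm_iteratedFDeriv_dd_le (h.delta_pos i) Ω (h.smooth i) (hb i) x
    simp only [add_tsub_cancel_right] at this
    rw [zero_add]
    linarith

lemma tame_zjac (h : TorusFamily Bf r δ₀ Ω Λ p δ κ N u) :
    Tame 1 (fun _ _ => 1) N fun i => zjac (δ i) Ω (u i) := by
  have h1 := h.tame_jac.clm
    (ContinuousLinearMap.compL ℝ (E n) (E n) (E n × E n) (ContinuousLinearMap.inl ℝ (E n) (E n)))
  have h2 := (h.tame_one (h.tame_fderiv.dd h.delta_pos Ω)).clm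
    (ContinuousLinearMap.compL ℝ (E n) (E n) (E n × E n) (ContinuousLinearMap.inr ℝ (E n) (E n)))
  refine (h1.add_self h2).congr fun i x => ?_
  ext a <;> simp [zjac]

lemma fderiv_zmap (hu : ContDiff ℝ ∞ (u i)) : fderiv ℝ (zmap (δ i) Ω (u i)) = zjac (δ i) Ω (u i) :=
  funext fun x => (hasFDerivAt_zmap hu x).fderiv

lemma tame_comp_zmap (h : TorusFamily Bf r δ₀ Ω Λ p δ κ N u) {F : Type*}
    [NormedAddCommGroup F] [NormedSpace ℝ F] {g : ι → E n × E n → F}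
    (hg : Tame 0 (fun _ _ => 1) (fun _ => 1) g) :
    Tame 0 (fun _ _ => 1) N fun i x => g i (zmap (δ i) Ω (u i) x) :=
  hg.comp (h.tame_zjac.congr fun i x => by rw [fderiv_zmap (h.smooth i)])
    fun i => contDiff_zmap (h.smooth i)

lemma tame_fderiv_pert (h : TorusFamily Bf r δ₀ Ω Λ p δ κ N u) :
    Tame 0 (fun _ _ => 1) N fun i x => fderiv ℝ (r (δ i)) (zmap (δ i) Ω (u i) x) := by
  refine h.tame_comp_zmap (tame_of_bound (fun i => (h.lag.smooth _).fderiv_right (by simp))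
    fun k => ?_)
  obtain ⟨C, hC⟩ := h.lag.bound (k + 1)
  refine ⟨C, fun i x => ?_⟩
  rw [norm_iteratedFDeriv_fderiv]
  exact hC _ (h.delta_mem i) x

lemma tame_hess (h : TorusFamily Bf r δ₀ Ω Λ p δ κ N u) :
    Tame 0 (fun _ _ => 1) N fun i => hess (lagr Bf r (δ i)) (δ i) Ω (u i) := by
  have h1 : Tame 0 (fun _ _ => 1) N
      fun i x => fderiv ℝ (fderiv ℝ (r (δ i))) (zmap (δ i) Ω (u i) x) := by
    refine h.tame_comp_zmap (tame_of_bound (fun i => ?_) fun k => ?_)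
    · have h2 : ContDiff ℝ ∞ (fderiv ℝ (r (δ i))) := (h.lag.smooth _).fderiv_right (by simp)
      exact h2.fderiv_right (by simp)
    · obtain ⟨C, hC⟩ := h.lag.bound (k + 1 + 1)
      refine ⟨C, fun i x => ?_⟩
      rw [norm_iteratedFDeriv_fderiv, norm_iteratedFDeriv_fderiv]
      exact hC _ (h.delta_mem i) x
  have h2 : Tame 0 (fun _ _ => 1) N fun i x =>
      δ i • fderiv ℝ (fderiv ℝ (r (δ i))) (zmap (δ i) Ω (u i) x) :=
    (h1.smul_param δ).mono (a := fun _ => 1) (fun _ i => by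
      rw [abs_of_pos (h.delta_pos i)]
      simpa using (h.delta_le i).trans (h.kappa_le i)) (fun _ _ => zero_le_one)
      (fun _ => le_rfl) le_rfl
  refine ((tame_const h.one_le (fun _ => kin Bf) (fun _ _ => zero_le_one)
    (a := ‖kin Bf‖) (fun _ _ => by simp)).add_self h2).congr fun i x => h.lag.hess_lagr _ _ _ _

set_option maxSynthPendingDepth 5 in
lemma tame_twist (h : TorusFamily Bf r δ₀ Ω Λ p δ κ N u) :
    Tame 0 (fun _ _ => 1) N fun i => twist (lagr Bf r (δ i)) (δ i) Ω (u i) := by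
  have h1 := h.tame_hess.comp_coef (h.tame_jac_shift.clm (ContinuousLinearMap.compL ℝ (E n) (E n)
    (E n × E n) (ContinuousLinearMap.inr ℝ (E n) (E n))))
  have h2 := h.tame_jac.clm (ContinuousLinearMap.compL ℝ (E n) (E n) (E n × E n)
    (ContinuousLinearMap.inr ℝ (E n) (E n)))
  have h3 := h.tame_jac.clm (ContinuousLinearMap.compL ℝ (E n) (E n) (E n × E n)
    (ContinuousLinearMap.inl ℝ (E n) (E n)))
  have h4 := (h3.smul_param δ).mono (s' := fun _ _ => 1) (a := fun _ => 1) (fun _ i => by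
      rw [abs_of_pos (h.delta_pos i)]
      simpa using (h.delta_le i).trans (h.kappa_le i)) (fun _ _ => zero_le_one)
      (fun _ => le_rfl) le_rfl
  have h5 := (h2.sub_self h4).clm (ContinuousLinearMap.compL ℝ (E n) (E n × E n) ℝ).flip
  refine (h5.comp_coef h1).congr fun i x => ?_
  ext a b
  rw [twist_apply, pairing_twist]
  simp

lemma tame_twistInv (h : TorusFamily Bf r δ₀ Ω Λ p δ κ N u) :
    Tame 0 (fun _ _ => 1) N fun i => twistInv Bf (lagr Bf r (δ i)) (δ i) Ω (u i) :=
  (h.tame_twist.clm (ContinuousLinearMap.compL ℝ (E n) (E n →L[ℝ] ℝ) (E n)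
    (Bf.symm : (E n →L[ℝ] ℝ) →L[ℝ] E n))).ringInverse h.twist_le

lemma tame_elErr (h : TorusFamily Bf r δ₀ Ω Λ p δ κ N u) :
    Tame 1 (fun _ => κ) N fun i => elErr (lagr Bf r (δ i)) (δ i) Ω (u i) := by
  have h0 : Tame 0 (fun _ => κ) N fun i x => δ i • fderiv ℝ (r (δ i)) (zmap (δ i) Ω (u i) x) :=
    (h.tame_fderiv_pert.smul_param δ).mono (a := fun _ => 1) (fun _ i => by
      rw [abs_of_pos (h.delta_pos i)]
      simpa using h.delta_le i) (fun _ i => h.kappa_nonneg i)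
      (fun _ => le_rfl) le_rfl
  have h1 := (h0.shift fun i => δ i • Ω).clm
    ((ContinuousLinearMap.compL ℝ (E n) (E n × E n) ℝ).flip (ContinuousLinearMap.inl ℝ (E n) (E n)))
  have h2 := (h0.clm ((ContinuousLinearMap.compL ℝ (E n) (E n × E n) ℝ).flip
    (ContinuousLinearMap.inr ℝ (E n) (E n)))).dd h.delta_pos Ω
  have h3 := (h.tame_dd.clm (Bf : E n →L[ℝ] (E n →L[ℝ] ℝ))).dd h.delta_pos Ω
  refine ((h1.sub_self h2).sub_self h3).congr fun i x => ?_
  simp only [elErr, dd, h.lag.fderiv_lagr]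
  ext a
  simp [kin_apply, zmap, dd]
  ring

end TorusFamily

end NewtonCoefficients

lemma norm_ringInverse_le {n : ℕ} {A : E n →L[ℝ] E n} (hA : ‖A - 1‖ ≤ 1 / 3) :
    ‖Ring.inverse A‖ ≤ 3 := by
  have hu := isUnit_of_norm_sub_one_lt (hA.trans_lt (by norm_num))
  have h1 : Ring.inverse A = Ring.inverse A * (1 - A) + 1 := by
    rw [mul_sub, Ring.inverse_mul_cancel _ hu, mul_one, sub_add_cancel]
  have h2 : ‖Ring.inverse A‖ ≤ ‖Ring.inverse A‖ * ‖1 - A‖ + 1 := by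
    conv_lhs => rw [h1]
    refine (norm_add_le _ _).trans ?_
    gcongr
    · exact norm_mul_le _ _
    · exact ContinuousLinearMap.norm_id_le
  rw [norm_sub_rev] at hA
  nlinarith [norm_nonneg (Ring.inverse A), norm_nonneg (1 - A)]

section NewtonSolve

open scoped ContDiff

variable {n : ℕ}

def newtonRhs (L : E n × E n → ℝ) (δ : ℝ) (Ω : E n) (u : E n → E n) (x : E n) : E n →L[ℝ] ℝ :=
  (elErr L δ Ω u x).comp (jac u (x + δ • Ω))

def newtonMom (Bf : E n ≃L[ℝ] (E n →L[ℝ] ℝ)) (L : E n × E n → ℝ) (δ : ℝ) (Ω : E n)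
    (u : E n → E n) (x : E n) : E n := Bf.symm (ddInv δ Ω (newtonRhs L δ Ω u) x)

def newtonAvg (Bf : E n ≃L[ℝ] (E n →L[ℝ] ℝ)) (L : E n × E n → ℝ) (δ : ℝ) (Ω : E n)
    (u : E n → E n) : E n :=
  Ring.inverse (torusMean (twistInv Bf L δ Ω u))
    (torusMean fun x => twistInv Bf L δ Ω u x (newtonMom Bf L δ Ω u x))

def newtonVel (Bf : E n ≃L[ℝ] (E n →L[ℝ] ℝ)) (L : E n × E n → ℝ) (δ : ℝ) (Ω : E n)
    (u : E n → E n) (x : E n) : E n :=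
  twistInv Bf L δ Ω u x (newtonMom Bf L δ Ω u x - newtonAvg Bf L δ Ω u)

def newtonPos (Bf : E n ≃L[ℝ] (E n →L[ℝ] ℝ)) (L : E n × E n → ℝ) (δ : ℝ) (Ω : E n)
    (u : E n → E n) : E n → E n := ddInv δ Ω (newtonVel Bf L δ Ω u)

/-- The Newton correction before smoothing. -/
def newtonStep (Bf : E n ≃L[ℝ] (E n →L[ℝ] ℝ)) (L : E n × E n → ℝ) (δ : ℝ) (Ω : E n)
    (u : E n → E n) (x : E n) : E n := jac u x (newtonPos Bf L δ Ω u x)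

namespace TorusFamily

variable {ι : Type*} {Bf : E n ≃L[ℝ] (E n →L[ℝ] ℝ)} {r : ℝ → E n × E n → ℝ} {δ₀ : ℝ} {Ω : E n}
  {Λ : ℝ} {p : ℕ} {δ κ N : ι → ℝ} {u : ι → E n → E n}

lemma lag_per (h : TorusFamily Bf r δ₀ Ω Λ p δ κ N u) (i : ι) (x y : E n) (l : Fin n → ℤ) :
    lagr Bf r (δ i) (x + intVec l, y) = lagr Bf r (δ i) (x, y) :=
  h.lag.lagr_per (h.delta_mem i) x y l

lemma isPer_twistInv (h : TorusFamily Bf r δ₀ Ω Λ p δ κ N u) (i : ι) :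
    IsPer (twistInv Bf (lagr Bf r (δ i)) (δ i) Ω (u i)) :=
  (isPer_twist (h.lag_per i) (h.per i)).comp fun T =>
    Ring.inverse ((Bf.symm : (E n →L[ℝ] ℝ) →L[ℝ] E n).comp T)

lemma contDiff_twistInv (h : TorusFamily Bf r δ₀ Ω Λ p δ κ N u) (i : ι) :
    ContDiff ℝ ∞ (twistInv Bf (lagr Bf r (δ i)) (δ i) Ω (u i)) := h.tame_twistInv.smooth i

lemma contDiff_lag (h : TorusFamily Bf r δ₀ Ω Λ p δ κ N u) (i : ι) :
    ContDiff ℝ ∞ (lagr Bf r (δ i)) := h.lag.contDiff_lagr (δ i)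

lemma contDiff_jac_shift (h : TorusFamily Bf r δ₀ Ω Λ p δ κ N u) (i : ι) :
    ContDiff ℝ ∞ fun x => jac (u i) (x + δ i • Ω) := h.tame_jac_shift.smooth i

lemma isPer_newtonRhs (h : TorusFamily Bf r δ₀ Ω Λ p δ κ N u) (i : ι) :
    IsPer (newtonRhs (lagr Bf r (δ i)) (δ i) Ω (u i)) :=
  (isPer_elErr (h.lag_per i) (h.per i)).comp₂ ((h.per i).jac.shift (δ i • Ω)) (·.comp ·)

lemma contDiff_newtonRhs (h : TorusFamily Bf r δ₀ Ω Λ p δ κ N u) (i : ι) :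
    ContDiff ℝ ∞ (newtonRhs (lagr Bf r (δ i)) (δ i) Ω (u i)) :=
  (contDiff_elErr (h.contDiff_lag i) (h.smooth i)).clm_comp (h.contDiff_jac_shift i)

lemma isPer_newtonMom (i : ι) : IsPer (newtonMom Bf (lagr Bf r (δ i)) (δ i) Ω (u i)) :=
  (isPer_ddInv _).comp Bf.symm

lemma contDiff_newtonMom (h : TorusFamily Bf r δ₀ Ω Λ p δ κ N u) (i : ι) :
    ContDiff ℝ ∞ (newtonMom Bf (lagr Bf r (δ i)) (δ i) Ω (u i)) :=
  Bf.symm.contDiff.comp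
    (contDiff_ddInv (h.small_divisor i) (h.isPer_newtonRhs i) (h.contDiff_newtonRhs i))

lemma isPer_newtonVel (h : TorusFamily Bf r δ₀ Ω Λ p δ κ N u) (i : ι) :
    IsPer (newtonVel Bf (lagr Bf r (δ i)) (δ i) Ω (u i)) :=
  (h.isPer_twistInv i).comp₂ (isPer_newtonMom i) fun A g =>
    A (g - newtonAvg Bf (lagr Bf r (δ i)) (δ i) Ω (u i))

lemma contDiff_newtonVel (h : TorusFamily Bf r δ₀ Ω Λ p δ κ N u) (i : ι) :
    ContDiff ℝ ∞ (newtonVel Bf (lagr Bf r (δ i)) (δ i) Ω (u i)) :=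
  (h.contDiff_twistInv i).clm_apply ((h.contDiff_newtonMom i).sub contDiff_const)

lemma isPer_newtonPos (i : ι) : IsPer (newtonPos Bf (lagr Bf r (δ i)) (δ i) Ω (u i)) :=
  isPer_ddInv _

lemma isPer_newtonStep (h : TorusFamily Bf r δ₀ Ω Λ p δ κ N u) (i : ι) :
    IsPer (newtonStep Bf (lagr Bf r (δ i)) (δ i) Ω (u i)) :=
  (h.per i).jac.comp₂ (isPer_newtonPos i) fun A z => A z

lemma norm_twistInv_sub_one_le (h : TorusFamily Bf r δ₀ Ω Λ p δ κ N u) (i : ι) (x : E n) :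
    ‖twistInv Bf (lagr Bf r (δ i)) (δ i) Ω (u i) x - 1‖ ≤ 1 / 3 :=
  norm_ringInverse_sub_one_le (h.twist_le i x)

lemma norm_mean_twistInv (h : TorusFamily Bf r δ₀ Ω Λ p δ κ N u) (i : ι) :
    ‖torusMean (twistInv Bf (lagr Bf r (δ i)) (δ i) Ω (u i)) - 1‖ ≤ 1 / 3 := by
  have h1 := norm_torusMean_le (h.norm_twistInv_sub_one_le i)
  rwa [torusMean_sub (h.isPer_twistInv i) (h.contDiff_twistInv i).continuous
    (fun _ _ => rfl) continuous_const, torusMean_const] at h1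

lemma torusMean_newtonVel (h : TorusFamily Bf r δ₀ Ω Λ p δ κ N u) (i : ι) :
    torusMean (newtonVel Bf (lagr Bf r (δ i)) (δ i) Ω (u i)) = 0 := by
  set v := newtonAvg Bf (lagr Bf r (δ i)) (δ i) Ω (u i) with hv
  have h1 : torusMean (fun x => twistInv Bf (lagr Bf r (δ i)) (δ i) Ω (u i) x v) =
      torusMean (twistInv Bf (lagr Bf r (δ i)) (δ i) Ω (u i)) v :=
    torusMean_clm (ContinuousLinearMap.apply ℝ (E n) v) (h.isPer_twistInv i)
      (h.contDiff_twistInv i).continuous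
  have h2 : newtonVel Bf (lagr Bf r (δ i)) (δ i) Ω (u i) = fun x =>
      twistInv Bf (lagr Bf r (δ i)) (δ i) Ω (u i) x
        (newtonMom Bf (lagr Bf r (δ i)) (δ i) Ω (u i) x) -
      twistInv Bf (lagr Bf r (δ i)) (δ i) Ω (u i) x v := funext fun x => map_sub _ _ _
  rw [h2, torusMean_sub ((h.isPer_twistInv i).comp₂ (isPer_newtonMom i) fun A g => A g)
    ((h.contDiff_twistInv i).clm_apply (h.contDiff_newtonMom i)).continuous
    ((h.isPer_twistInv i).comp fun A => A v)
    ((h.contDiff_twistInv i).clm_apply contDiff_const).continuous, h1]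
  have hu : IsUnit (torusMean (twistInv Bf (lagr Bf r (δ i)) (δ i) Ω (u i))) :=
    isUnit_of_norm_sub_one_lt ((h.norm_mean_twistInv i).trans_lt (by norm_num))
  have h3 := congrArg (fun T : E n →L[ℝ] E n => T (torusMean fun x =>
    twistInv Bf (lagr Bf r (δ i)) (δ i) Ω (u i) x
      (newtonMom Bf (lagr Bf r (δ i)) (δ i) Ω (u i) x))) (Ring.mul_inverse_cancel _ hu)
  simp only [mul_apply_eq_comp, one_apply_eq_self] at h3
  rw [hv, newtonAvg, h3, sub_self]

lemma dd_newtonPos (h : TorusFamily Bf r δ₀ Ω Λ p δ κ N u) (i : ι) (x : E n) :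
    dd (δ i) Ω (newtonPos Bf (lagr Bf r (δ i)) (δ i) Ω (u i)) x =
      newtonVel Bf (lagr Bf r (δ i)) (δ i) Ω (u i) x := by
  rw [newtonPos, dd_ddInv (h.small_divisor i) (h.isPer_newtonVel i) (h.contDiff_newtonVel i),
    h.torusMean_newtonVel, sub_zero]

lemma twist_newtonVel (h : TorusFamily Bf r δ₀ Ω Λ p δ κ N u) (i : ι) (x : E n) :
    twist (lagr Bf r (δ i)) (δ i) Ω (u i) x (newtonVel Bf (lagr Bf r (δ i)) (δ i) Ω (u i) x) =
      ddInv (δ i) Ω (newtonRhs (lagr Bf r (δ i)) (δ i) Ω (u i)) x -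
        Bf (newtonAvg Bf (lagr Bf r (δ i)) (δ i) Ω (u i)) := by
  have hu : IsUnit ((Bf.symm : (E n →L[ℝ] ℝ) →L[ℝ] E n).comp
      (twist (lagr Bf r (δ i)) (δ i) Ω (u i) x)) :=
    isUnit_of_norm_sub_one_lt ((h.twist_le i x).trans_lt (by norm_num))
  have h3 := congrArg (fun T : E n →L[ℝ] E n => T
    (newtonMom Bf (lagr Bf r (δ i)) (δ i) Ω (u i) x - newtonAvg Bf (lagr Bf r (δ i)) (δ i) Ω (u i)))
    (Ring.mul_inverse_cancel _ hu)
  simp only [mul_apply_eq_comp, one_apply_eq_self] at h3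
  have h4 := congrArg Bf h3
  simpa [newtonVel, twistInv, newtonMom] using h4

lemma newton_identity (h : TorusFamily Bf r δ₀ Ω Λ p δ κ N u) (i : ι) (x b : E n) :
    (elErr (lagr Bf r (δ i)) (δ i) Ω (u i) x + linErr (lagr Bf r (δ i)) (δ i) Ω (u i)
        (newtonStep Bf (lagr Bf r (δ i)) (δ i) Ω (u i)) x) (jac (u i) (x + δ i • Ω) b) =
      fderiv ℝ (elErr (lagr Bf r (δ i)) (δ i) Ω (u i)) x
          (newtonPos Bf (lagr Bf r (δ i)) (δ i) Ω (u i) (x + δ i • Ω)) (jac (u i) (x + δ i • Ω) b) -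
        lagForm (lagr Bf r (δ i)) (δ i) Ω (u i) x
          (newtonVel Bf (lagr Bf r (δ i)) (δ i) Ω (u i) x) b := by
  have h1 := linErr_jac (h.delta_pos i).ne' (h.contDiff_lag i) (h.smooth i) (Ω := Ω)
    (newtonPos Bf (lagr Bf r (δ i)) (δ i) Ω (u i)) x b
  simp only [h.dd_newtonPos i, h.twist_newtonVel i] at h1
  have h2 : dd (δ i) Ω (fun y => (ddInv (δ i) Ω (newtonRhs (lagr Bf r (δ i)) (δ i) Ω (u i)) y -
      Bf (newtonAvg Bf (lagr Bf r (δ i)) (δ i) Ω (u i))) b) x =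
      newtonRhs (lagr Bf r (δ i)) (δ i) Ω (u i) x b := by
    have h3 := congrArg (fun T => T b)
      (dd_ddInv (h.small_divisor i) (h.isPer_newtonRhs i) (h.contDiff_newtonRhs i) x)
    have h4 : torusMean (newtonRhs (lagr Bf r (δ i)) (δ i) Ω (u i)) = 0 :=
      torusMean_elErr_jac (h.lag_per i) (h.contDiff_lag i) (h.smooth i) (h.per i)
    rw [h4, sub_zero] at h3
    rw [← h3]
    simp [dd]
  rw [h2] at h1
  rw [add_apply]
  change _ + linErr (lagr Bf r (δ i)) (δ i) Ω (u i) (fun y => jac (u i) y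
    (newtonPos Bf (lagr Bf r (δ i)) (δ i) Ω (u i) y)) x _ = _
  rw [h1, newtonRhs, ContinuousLinearMap.comp_apply]
  ring

section Bounds

variable {s : ℕ → ι → ℝ} {N' : ι → ℝ} {a : ℕ}

lemma tame_newton (h : TorusFamily Bf r δ₀ Ω Λ p δ κ N u) (hN : ∀ i, N i ≤ N' i)
    (hF : Tame a s N' fun i => elErr (lagr Bf r (δ i)) (δ i) Ω (u i)) :
    ∃ c, Tame c s N' (fun i => newtonVel Bf (lagr Bf r (δ i)) (δ i) Ω (u i)) ∧
      Tame c s N' (fun i => newtonPos Bf (lagr Bf r (δ i)) (δ i) Ω (u i)) ∧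
      Tame c s N' (fun i => newtonStep Bf (lagr Bf r (δ i)) (δ i) Ω (u i)) := by
  have h1 : Tame _ s N' fun i => newtonRhs (lagr Bf r (δ i)) (δ i) Ω (u i) :=
    hF.comp_coef (h.tame_jac_shift.mono_freq hN)
  have h2 : Tame _ s N' fun i => newtonMom Bf (lagr Bf r (δ i)) (δ i) Ω (u i) :=
    (h1.multiplier h.isPer_newtonRhs (fun i => (h.small_divisor i).slowGrowth) h.nonneg).clm
      (Bf.symm : (E n →L[ℝ] ℝ) →L[ℝ] E n)
  have hA := h.tame_twistInv.mono_freq hN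
  have h3 := (hA.coef_apply h2).torusMean (X := E n)
  have h4 : Tame 0 (fun _ _ => 1) N' fun i (_ : E n) =>
      Ring.inverse (torusMean (twistInv Bf (lagr Bf r (δ i)) (δ i) Ω (u i))) := by
    refine tame_const (fun i => (h.one_le i).trans (hN i)) _ (fun _ _ => zero_le_one)
      (a := 3) fun q i => ?_
    exact (norm_ringInverse_le (h.norm_mean_twistInv i)).trans_eq (mul_one _).symm
  have h5 : Tame _ s N' fun i (_ : E n) => newtonAvg Bf (lagr Bf r (δ i)) (δ i) Ω (u i) :=
    h4.coef_apply h3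
  have h6 : Tame _ s N' fun i => newtonVel Bf (lagr Bf r (δ i)) (δ i) Ω (u i) :=
    hA.coef_apply (h2.sub_self h5)
  have h7 : Tame _ s N' fun i => newtonPos Bf (lagr Bf r (δ i)) (δ i) Ω (u i) :=
    h6.multiplier h.isPer_newtonVel (fun i => (h.small_divisor i).slowGrowth) h.nonneg
  have h8 : Tame _ s N' fun i => newtonStep Bf (lagr Bf r (δ i)) (δ i) Ω (u i) :=
    (h.tame_jac.mono_freq hN).coef_apply h7
  exact ⟨_, h6.mono_loss ((le_max_left _ _).trans (le_max_left _ _)),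
    h7.mono_loss ((le_max_right _ _).trans (le_max_left _ _)), h8.mono_loss (le_max_right _ _)⟩

set_option maxSynthPendingDepth 5 in
lemma tame_lagForm (h : TorusFamily Bf r δ₀ Ω Λ p δ κ N u) (hN : ∀ i, N i ≤ N' i)
    (hF : Tame a s N' fun i => elErr (lagr Bf r (δ i)) (δ i) Ω (u i)) :
    ∃ c, Tame c s N' (fun i => lagForm (lagr Bf r (δ i)) (δ i) Ω (u i)) := by
  have h1 := ((h.tame_jac_shift.mono_freq hN).clm
    (ContinuousLinearMap.compL ℝ (E n) (E n) ℝ).flip).coef_comp hF.fderiv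
  have h2 := h1.clm ((ContinuousLinearMap.flipₗᵢ ℝ (E n) (E n) ℝ).toContinuousLinearEquiv :
      (E n →L[ℝ] E n →L[ℝ] ℝ) →L[ℝ] (E n →L[ℝ] E n →L[ℝ] ℝ))
  have h3 : Tame (max (0 + (a + 1)) (0 + (a + 1))) s N'
      fun i => dd (δ i) Ω (lagForm (lagr Bf r (δ i)) (δ i) Ω (u i)) := by
    refine (h2.sub_self h1).congr fun i x => ?_
    ext1 b
    ext1 c
    rw [dd_lagForm (h.delta_pos i).ne' (h.contDiff_lag i) (h.smooth i)]
    simp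
  have h4 := h3.multiplier
    (fun i => (isPer_lagForm (h.lag_per i) (h.per i)).dd (δ i) Ω)
    (fun i => (h.small_divisor i).slowGrowth) h.nonneg
  refine ⟨_, h4.congr fun i x => ?_⟩
  have h5 := ddInv_dd (h.small_divisor i)
    (isPer_lagForm (δ := δ i) (Ω := Ω) (h.lag_per i) (h.per i))
    (contDiff_lagForm (h.contDiff_lag i) (h.smooth i)) x
  rw [torusMean_lagForm (h.lag_per i) (h.contDiff_lag i) (h.smooth i) (h.per i), sub_zero] at h5
  exact h5.symm

end Bounds

end TorusFamily

end NewtonSolve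

section TaylorRemainder

open scoped ContDiff

variable {X P F : Type*} [NormedAddCommGroup X] [NormedSpace ℝ X] [NormedAddCommGroup P]
  [NormedSpace ℝ P] [NormedAddCommGroup F] [NormedSpace ℝ F] {g : P → F} {K : ℝ}

lemma norm_sub_le_of_norm_fderiv_le (hg : ContDiff ℝ ∞ g) (hK : ∀ z, ‖fderiv ℝ g z‖ ≤ K)
    (z w : P) : ‖g (z + w) - g z‖ ≤ K * ‖w‖ := by
  have := Convex.norm_image_sub_le_of_norm_fderiv_le (𝕜 := ℝ) (s := Set.univ) (x := z) (y := z + w)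
    (fun x _ => hg.differentiable (by simp) x) (fun x _ => hK x) convex_univ trivial trivial
  simpa using this

set_option maxSynthPendingDepth 5 in
lemma norm_taylor_le (hg : ContDiff ℝ ∞ g) (hK : ∀ z, ‖fderiv ℝ (fderiv ℝ g) z‖ ≤ K) (z w : P) :
    ‖g (z + w) - g z - fderiv ℝ g z w‖ ≤ K * ‖w‖ ^ 2 := by
  have hK0 : 0 ≤ K := le_trans (by positivity) (hK 0)
  have hb : ∀ y ∈ Metric.closedBall z ‖w‖, ‖fderiv ℝ g y - fderiv ℝ g z‖ ≤ K * ‖w‖ := fun y hy => by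
    have h1 := norm_sub_le_of_norm_fderiv_le (hg.fderiv_right (m := ∞) (by simp)) hK z (y - z)
    rw [add_sub_cancel] at h1
    refine h1.trans ?_
    gcongr
    simpa [dist_eq_norm] using hy
  have := (convex_closedBall z ‖w‖).norm_image_sub_le_of_norm_fderiv_le' (𝕜 := ℝ) (f := g)
    (φ := fderiv ℝ g z) (x := z) (y := z + w) (fun x _ => hg.differentiable (by simp) x) hb
    (by simp) (by simp)
  rw [add_sub_cancel_left] at this
  linarith

set_option maxSynthPendingDepth 5 in
lemma norm_fderiv_taylor_le (hg : ContDiff ℝ ∞ g) (hK : ∀ z, ‖fderiv ℝ (fderiv ℝ g) z‖ ≤ K)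
    (hK' : ∀ z, ‖fderiv ℝ (fderiv ℝ (fderiv ℝ g)) z‖ ≤ K) {Z W : X → P} (hZ : ContDiff ℝ ∞ Z)
    (hW : ContDiff ℝ ∞ W) (x : X) :
    ‖fderiv ℝ (fun y => g (Z y + W y) - g (Z y) - fderiv ℝ g (Z y) (W y)) x‖ ≤
      K * ‖W x‖ ^ 2 * ‖fderiv ℝ Z x‖ + K * ‖W x‖ * ‖fderiv ℝ W x‖ := by
  have hK0 : 0 ≤ K := le_trans (by positivity) (hK 0)
  have hg' : ContDiff ℝ ∞ (fderiv ℝ g) := hg.fderiv_right (by simp)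
  have hdg : ∀ z, HasFDerivAt g (fderiv ℝ g z) z := fun z =>
    (hg.differentiable (by simp) z).hasFDerivAt
  have hdg' : ∀ z, HasFDerivAt (fderiv ℝ g) (fderiv ℝ (fderiv ℝ g) z) z := fun z =>
    (hg'.differentiable (by simp) z).hasFDerivAt
  have hdZ : HasFDerivAt Z (fderiv ℝ Z x) x := (hZ.differentiable (by simp) x).hasFDerivAt
  have hdW : HasFDerivAt W (fderiv ℝ W x) x := (hW.differentiable (by simp) x).hasFDerivAt
  have h1 := (((HasFDerivAt.comp (g := g) x (hdg _) (hdZ.add hdW)).sub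
    (HasFDerivAt.comp (g := g) x (hdg _) hdZ)).sub
    ((HasFDerivAt.comp (g := fderiv ℝ g) x (hdg' _) hdZ).clm_apply hdW)).fderiv
  simp only [Function.comp_def] at h1
  rw [show (fun y => g (Z y + W y) - g (Z y) - fderiv ℝ g (Z y) (W y)) =
    ((fun y => g ((Z + W) y)) - fun y => g (Z y)) - fun y => fderiv ℝ g (Z y) (W y) from rfl, h1]
  refine ContinuousLinearMap.opNorm_le_bound _ (by positivity) fun e => ?_
  have hsymm : fderiv ℝ (fderiv ℝ g) (Z x) (fderiv ℝ Z x e) (W x) =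
      fderiv ℝ (fderiv ℝ g) (Z x) (W x) (fderiv ℝ Z x e) :=
    (hg.contDiffAt.isSymmSndFDerivAt
      (by simpa using (WithTop.coe_le_coe.2 (le_top : (2 : ℕ∞) ≤ ⊤)))).eq _ _
  have h2 := norm_taylor_le hg' hK' (Z x) (W x)
  have h3 := norm_sub_le_of_norm_fderiv_le hg' hK (Z x) (W x)
  have h4 : (fderiv ℝ g (Z x + W x) - fderiv ℝ g (Z x) -
        fderiv ℝ (fderiv ℝ g) (Z x) (W x)) (fderiv ℝ Z x e) +
      (fderiv ℝ g (Z x + W x) - fderiv ℝ g (Z x)) (fderiv ℝ W x e) =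
      (fderiv ℝ g ((Z + W) x) ∘SL (fderiv ℝ Z x + fderiv ℝ W x) - fderiv ℝ g (Z x) ∘SL fderiv ℝ Z x -
        (fderiv ℝ g (Z x) ∘SL fderiv ℝ W x +
          ((fderiv ℝ (fderiv ℝ g) (Z x) ∘SL fderiv ℝ Z x).flip (W x)))) e := by
    simp only [sub_apply, add_apply, ContinuousLinearMap.comp_apply, ContinuousLinearMap.flip_apply,
      hsymm, map_add, Pi.add_apply]
    abel
  rw [← h4]
  calc _ ≤ K * ‖W x‖ ^ 2 * (‖fderiv ℝ Z x‖ * ‖e‖) + K * ‖W x‖ * (‖fderiv ℝ W x‖ * ‖e‖) := by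
        refine norm_add_le_of_le ?_ ?_
        · exact (ContinuousLinearMap.le_opNorm _ _).trans
            (mul_le_mul h2 (ContinuousLinearMap.le_opNorm _ _) (norm_nonneg _) (by positivity))
        · exact (ContinuousLinearMap.le_opNorm _ _).trans
            (mul_le_mul h3 (ContinuousLinearMap.le_opNorm _ _) (norm_nonneg _) (by positivity))
    _ = _ := by ring

end TaylorRemainder

section RemainderBound

open scoped ContDiff

variable {n : ℕ}

/-- The quadratic remainder of the momentum along a displacement of the torus. -/
def momRem (L : E n × E n → ℝ) (δ : ℝ) (Ω : E n) (u w : E n → E n) (x : E n) : E n × E n →L[ℝ] ℝ :=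
  fderiv ℝ L (zmap δ Ω u x + (w x, dd δ Ω w x)) - fderiv ℝ L (zmap δ Ω u x) -
    fderiv ℝ (fderiv ℝ L) (zmap δ Ω u x) (w x, dd δ Ω w x)

variable {L : E n × E n → ℝ} {δ : ℝ} {Ω : E n} {u w : E n → E n}

lemma zmap_add (x : E n) : zmap δ Ω (fun y => u y + w y) x = zmap δ Ω u x + (w x, dd δ Ω w x) := by
  ext1
  · simp [zmap, add_assoc]
  · simp only [zmap, dd, Prod.snd_add, add_assoc]
    rw [← smul_add]
    congr 2
    abel

lemma elErr_add (x : E n) : elErr L δ Ω (fun y => u y + w y) x - elErr L δ Ω u x -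
    linErr L δ Ω u w x = (momRem L δ Ω u w (x + δ • Ω)).comp (ContinuousLinearMap.inl ℝ (E n) (E n)) -
      dd δ Ω (fun y => (momRem L δ Ω u w y).comp (ContinuousLinearMap.inr ℝ (E n) (E n))) x := by
  ext1 b
  simp only [elErr, linErr, hess, zmap_add, momRem, dd, sub_apply, smul_apply,
    ContinuousLinearMap.comp_apply, smul_eq_mul]
  ring

lemma norm_dd_le {F : Type*} [NormedAddCommGroup F] [NormedSpace ℝ F] (hδ : 0 < δ) {f : E n → F}
    (hf : ContDiff ℝ ∞ f) {C : ℝ} (hC : ∀ x, ‖fderiv ℝ f x‖ ≤ C) (x : E n) :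
    ‖dd δ Ω f x‖ ≤ C * ‖Ω‖ := by
  have := norm_iteratedFDeriv_dd_le hδ Ω hf (k := 0) (C := C) (fun x => by
    rw [← norm_iteratedFDeriv_fderiv, norm_iteratedFDeriv_zero]
    exact hC x) x
  rwa [norm_iteratedFDeriv_zero] at this

lemma contDiff_momRem (hL : ContDiff ℝ ∞ L) (hu : ContDiff ℝ ∞ u) (hw : ContDiff ℝ ∞ w) :
    ContDiff ℝ ∞ (momRem L δ Ω u w) := by
  have hW : ContDiff ℝ ∞ fun x => (w x, dd δ Ω w x) := hw.prodMk (contDiff_dd hw _ _)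
  have hZ := contDiff_zmap (δ := δ) (Ω := Ω) hu
  have hL' : ContDiff ℝ ∞ (fderiv ℝ L) := hL.fderiv_right (by simp)
  exact ((hL'.comp (hZ.add hW)).sub (hL'.comp hZ)).sub
    (((hL'.fderiv_right (m := ∞) (by simp)).comp hZ).clm_apply hW)

set_option maxSynthPendingDepth 5 in
lemma norm_elErr_add_le (hδ : 0 < δ) (hL : ContDiff ℝ ∞ L) (hu : ContDiff ℝ ∞ u)
    (hw : ContDiff ℝ ∞ w) {C C' : ℝ} (hC : ∀ x, ‖momRem L δ Ω u w x‖ ≤ C)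
    (hC' : ∀ x, ‖fderiv ℝ (momRem L δ Ω u w) x‖ ≤ C') (x : E n) :
    ‖elErr L δ Ω (fun y => u y + w y) x - elErr L δ Ω u x - linErr L δ Ω u w x‖ ≤
      C + C' * ‖Ω‖ := by
  have hC0 : 0 ≤ C := (norm_nonneg _).trans (hC 0)
  have hC0' : 0 ≤ C' := le_trans (by positivity) (hC' 0)
  rw [elErr_add]
  refine norm_sub_le_of_le ?_ ?_
  · refine (ContinuousLinearMap.opNorm_comp_le _ _).trans ?_
    calc _ ≤ C * 1 := mul_le_mul (hC _) (ContinuousLinearMap.norm_inl_le_one ℝ (E n) (E n))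
          (norm_nonneg _) hC0
      _ = C := mul_one C
  · have hsm := contDiff_momRem (δ := δ) (Ω := Ω) hL hu hw
    let R := (ContinuousLinearMap.compL ℝ (E n) (E n × E n) ℝ).flip
      (ContinuousLinearMap.inr ℝ (E n) (E n))
    have hR : ‖R‖ ≤ 1 := ContinuousLinearMap.opNorm_le_bound _ zero_le_one fun T => by
      rw [one_mul]
      refine (ContinuousLinearMap.opNorm_comp_le _ _).trans ?_
      exact mul_le_of_le_one_right (norm_nonneg _) (ContinuousLinearMap.norm_inr_le_one ℝ (E n) (E n))
    refine norm_dd_le hδ (R.contDiff.comp hsm) (fun y => ?_) x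
    have h1 : fderiv ℝ (R ∘ momRem L δ Ω u w) y = R.comp (fderiv ℝ (momRem L δ Ω u w) y) :=
      (R.hasFDerivAt.comp y (hsm.differentiable (by simp) y).hasFDerivAt).fderiv
    rw [h1]
    refine (ContinuousLinearMap.opNorm_comp_le _ _).trans ?_
    calc _ ≤ 1 * C' := mul_le_mul hR (hC' y) (norm_nonneg _) zero_le_one
      _ = C' := one_mul _

end RemainderBound

section StepBounds

open scoped ContDiff

variable {n : ℕ}

lemma linErr_sub {L : E n × E n → ℝ} {δ : ℝ} {Ω : E n} {u w v : E n → E n} (x : E n) :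
    linErr L δ Ω u (fun y => w y - v y) x = linErr L δ Ω u w x - linErr L δ Ω u v x := by
  have h1 : ∀ y, ((w y - v y, dd δ Ω (fun y => w y - v y) y) : E n × E n) =
      (w y, dd δ Ω w y) - (v y, dd δ Ω v y) := fun y => by
    ext1
    · rfl
    · simp only [dd, Prod.snd_sub, ← smul_sub]
      congr 1
      abel
  ext1 b
  simp only [linErr, h1, map_sub]
  simp only [dd, sub_apply, smul_apply, ContinuousLinearMap.comp_apply,
    smul_eq_mul]
  ring

lemma LagFamily.fderiv_fderiv_lagr {Bf : E n ≃L[ℝ] (E n →L[ℝ] ℝ)} {r : ℝ → E n × E n → ℝ} {δ₀ : ℝ}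
    (h : LagFamily Bf r δ₀) (δ : ℝ) :
    fderiv ℝ (fderiv ℝ (lagr Bf r δ)) = fun z => kin Bf + δ • fderiv ℝ (fderiv ℝ (r δ)) z := by
  funext z
  have h1 : ∀ x, HasFDerivAt (fderiv ℝ (r δ)) (fderiv ℝ (fderiv ℝ (r δ)) x) x := fun x =>
    (((h.smooth δ).fderiv_right (m := ∞) (by simp)).differentiable (by simp) x).hasFDerivAt
  rw [show fderiv ℝ (lagr Bf r δ) = fun z => kin Bf z + δ • fderiv ℝ (r δ) z from
    funext (h.fderiv_lagr δ)]
  exact ((kin Bf).hasFDerivAt.add ((h1 z).const_smul δ)).fderiv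

set_option maxSynthPendingDepth 5 in
lemma LagFamily.exists_fderiv_bound {Bf : E n ≃L[ℝ] (E n →L[ℝ] ℝ)} {r : ℝ → E n × E n → ℝ}
    {δ₀ : ℝ} (h : LagFamily Bf r δ₀) : ∃ K, 0 ≤ K ∧ ∀ δ ∈ Set.Ioc 0 δ₀, δ ≤ 1 → ∀ z,
      ‖fderiv ℝ (fderiv ℝ (fderiv ℝ (lagr Bf r δ))) z‖ ≤ K ∧
      ‖fderiv ℝ (fderiv ℝ (fderiv ℝ (fderiv ℝ (lagr Bf r δ)))) z‖ ≤ K := by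
  obtain ⟨C, hC⟩ := h.bound 3
  obtain ⟨C', hC'⟩ := h.bound 4
  refine ⟨max 0 (max C C'), le_max_left _ _, fun δ hδ hδ1 z => ?_⟩
  have h0 : ContDiff ℝ ∞ (fderiv ℝ (fderiv ℝ (r δ))) :=
    ((h.smooth δ).fderiv_right (m := ∞) (by simp)).fderiv_right (by simp)
  have h1 : ∀ x, HasFDerivAt (fderiv ℝ (fderiv ℝ (r δ)))
      (fderiv ℝ (fderiv ℝ (fderiv ℝ (r δ))) x) x := fun x =>
    (h0.differentiable (by simp) x).hasFDerivAt
  have h2 : ∀ x, HasFDerivAt (fderiv ℝ (fderiv ℝ (fderiv ℝ (r δ))))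
      (fderiv ℝ (fderiv ℝ (fderiv ℝ (fderiv ℝ (r δ)))) x) x := fun x =>
    ((h0.fderiv_right (m := ∞) (by simp)).differentiable (by simp) x).hasFDerivAt
  have h3 : fderiv ℝ (fderiv ℝ (fderiv ℝ (lagr Bf r δ))) =
      fun z => δ • fderiv ℝ (fderiv ℝ (fderiv ℝ (r δ))) z := by
    funext x
    rw [h.fderiv_fderiv_lagr]
    exact (((h1 x).const_smul δ).const_add _).fderiv
  have hd : ‖δ‖ ≤ 1 := by rwa [Real.norm_of_nonneg hδ.1.le]
  have h5 : ‖fderiv ℝ (fderiv ℝ (fderiv ℝ (r δ))) z‖ ≤ C := by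
    have := hC δ hδ z
    rwa [← norm_iteratedFDeriv_fderiv, ← norm_iteratedFDeriv_fderiv, ← norm_iteratedFDeriv_fderiv,
      norm_iteratedFDeriv_zero] at this
  have h6 : ‖fderiv ℝ (fderiv ℝ (fderiv ℝ (fderiv ℝ (r δ)))) z‖ ≤ C' := by
    have := hC' δ hδ z
    rwa [← norm_iteratedFDeriv_fderiv, ← norm_iteratedFDeriv_fderiv, ← norm_iteratedFDeriv_fderiv,
      ← norm_iteratedFDeriv_fderiv, norm_iteratedFDeriv_zero] at this
  rw [h3]
  constructor
  · refine (norm_smul_le _ _).trans ((mul_le_of_le_one_left (norm_nonneg _) hd).trans ?_)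
    exact h5.trans ((le_max_left _ _).trans (le_max_right _ _))
  · rw [((h2 z).fun_const_smul δ).fderiv]
    refine (norm_smul_le _ _).trans ((mul_le_of_le_one_left (norm_nonneg _) hd).trans ?_)
    exact h6.trans ((le_max_right _ _).trans (le_max_right _ _))

namespace TorusFamily

variable {ι : Type*} {Bf : E n ≃L[ℝ] (E n →L[ℝ] ℝ)} {r : ℝ → E n × E n → ℝ} {δ₀ : ℝ} {Ω : E n}
  {Λ : ℝ} {p : ℕ} {δ κ N : ι → ℝ} {u : ι → E n → E n} {s : ℕ → ι → ℝ} {N' : ι → ℝ} {c : ℕ}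
  {w : ι → E n → E n}

lemma tame_displacement (h : TorusFamily Bf r δ₀ Ω Λ p δ κ N u) (hw : Tame c s N' w) :
    Tame (c + 1) s N' fun i x => (w i x, dd (δ i) Ω (w i) x) := by
  have h1 := hw.clm (ContinuousLinearMap.inl ℝ (E n) (E n))
  have h2 := (hw.dd h.delta_pos Ω).clm (ContinuousLinearMap.inr ℝ (E n) (E n))
  refine ((h1.add_self h2).mono_loss (c' := c + 1) (by simp)).congr fun i x => ?_
  simp

set_option maxSynthPendingDepth 5 in
lemma tame_linErr (h : TorusFamily Bf r δ₀ Ω Λ p δ κ N u) (hN : ∀ i, N i ≤ N' i)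
    (hw : Tame c s N' w) :
    Tame (c + 2) s N' fun i => linErr (lagr Bf r (δ i)) (δ i) Ω (u i) (w i) := by
  have h1 := (h.tame_hess.mono_freq hN).coef_apply (h.tame_displacement hw)
  have h2 := (h1.shift fun i => δ i • Ω).clm ((ContinuousLinearMap.compL ℝ (E n) (E n × E n) ℝ).flip
    (ContinuousLinearMap.inl ℝ (E n) (E n)))
  have h3 := (h1.clm ((ContinuousLinearMap.compL ℝ (E n) (E n × E n) ℝ).flip
    (ContinuousLinearMap.inr ℝ (E n) (E n)))).dd h.delta_pos Ω
  exact (h2.sub_self h3).mono_loss (c' := c + 2) (max_le (by omega) (by omega))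

set_option maxSynthPendingDepth 5 in
lemma exists_remainder_bound (h : TorusFamily Bf r δ₀ Ω Λ p δ κ N u) (hN : ∀ i, N i ≤ N' i)
    (hw : Tame c s N' w) (q : ℕ) : ∃ C, 0 ≤ C ∧ ∀ i x,
      ‖elErr (lagr Bf r (δ i)) (δ i) Ω (fun y => u i y + w i y) x -
        elErr (lagr Bf r (δ i)) (δ i) Ω (u i) x -
        linErr (lagr Bf r (δ i)) (δ i) Ω (u i) (w i) x‖ ≤
      C * (s q i ^ 2 * N' i ^ (2 * c + 3)) := by
  obtain ⟨K, hK, hb⟩ := h.lag.exists_fderiv_bound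
  have hW := h.tame_displacement hw
  obtain ⟨C₁, hC₁, hb₁⟩ := hW.norm_le q
  obtain ⟨C₂, hC₂, hb₂⟩ := hW.fderiv.norm_le q
  obtain ⟨C₃, hC₃, hb₃⟩ := (h.tame_zjac.mono_freq hN).norm_le q
  refine ⟨K * C₁ ^ 2 + (K * C₁ ^ 2 * C₃ + K * C₁ * C₂) * ‖Ω‖, by positivity, fun i x => ?_⟩
  have hN1 : 1 ≤ N' i := hw.one_le i
  have hs := hw.size_nonneg q i
  have hδ1 : δ i ≤ 1 := (h.delta_le i).trans (h.kappa_le i)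
  have hbi := hb (δ i) (h.delta_mem i) hδ1
  have hL : ContDiff ℝ ∞ (fderiv ℝ (lagr Bf r (δ i))) :=
    (h.contDiff_lag i).fderiv_right (by simp)
  have hWsq : ∀ y, K * ‖(w i y, dd (δ i) Ω (w i) y)‖ ^ 2 ≤
      K * C₁ ^ 2 * (s q i ^ 2 * N' i ^ (2 * c + 2)) := fun y => by
    calc _ ≤ K * (C₁ * (s q i * N' i ^ (c + 1))) ^ 2 := by gcongr; exact hb₁ i y
      _ = _ := by ring
  have hpow : N' i ^ (2 * c + 2) ≤ N' i ^ (2 * c + 3) := pow_le_pow_right₀ hN1 (by omega)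
  refine (norm_elErr_add_le (h.delta_pos i) (h.contDiff_lag i) (h.smooth i) (hw.smooth i)
    (C := K * C₁ ^ 2 * (s q i ^ 2 * N' i ^ (2 * c + 3)))
    (C' := (K * C₁ ^ 2 * C₃ + K * C₁ * C₂) * (s q i ^ 2 * N' i ^ (2 * c + 3)))
    (fun y => ?_) (fun y => ?_) x).trans_eq (by ring)
  · refine (norm_taylor_le hL (fun z => (hbi z).1) _ _).trans ((hWsq y).trans ?_)
    gcongr
  · refine (norm_fderiv_taylor_le hL (fun z => (hbi z).1) (fun z => (hbi z).2)
      (contDiff_zmap (h.smooth i)) (hW.smooth i) y).trans ?_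
    have h3 : ‖fderiv ℝ (zmap (δ i) Ω (u i)) y‖ ≤ C₃ * N' i := by
      rw [fderiv_zmap (h.smooth i)]
      simpa using hb₃ i y
    calc _ ≤ K * C₁ ^ 2 * (s q i ^ 2 * N' i ^ (2 * c + 2)) * (C₃ * N' i) +
          K * (C₁ * (s q i * N' i ^ (c + 1))) * (C₂ * (s q i * N' i ^ (c + 1 + 1))) := by
          refine add_le_add ?_ ?_
          · exact mul_le_mul (hWsq y) h3 (by positivity) (by positivity)
          · refine mul_le_mul ?_ (hb₂ i y) (by positivity) (by positivity)
            gcongr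
            exact hb₁ i y
      _ = _ := by ring

lemma norm_le_of_jac (h : TorusFamily Bf r δ₀ Ω Λ p δ κ N u) (i : ι) (x : E n)
    {T : E n →L[ℝ] ℝ} {A A' : ℝ} (hA' : 0 ≤ A')
    (hT : ∀ b, ‖T (jac (u i) x b)‖ ≤ A * ‖jac (u i) x b‖ + A' * ‖b‖) (hA : 0 ≤ A) :
    ‖T‖ ≤ A + 3 * A' := by
  have hJ : ‖jac (u i) x - 1‖ ≤ 1 / 4 := by simpa [jac] using h.fderiv_le i x
  have hu : IsUnit (jac (u i) x) := isUnit_of_norm_sub_one_lt (hJ.trans_lt (by norm_num))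
  refine ContinuousLinearMap.opNorm_le_bound _ (by positivity) fun a => ?_
  have h1 : jac (u i) x (Ring.inverse (jac (u i) x) a) = a :=
    congrArg (fun S : E n →L[ℝ] E n => S a) (Ring.mul_inverse_cancel _ hu)
  have h2 := hT (Ring.inverse (jac (u i) x) a)
  rw [h1] at h2
  have h3 : ‖Ring.inverse (jac (u i) x) a‖ ≤ 3 * ‖a‖ :=
    ContinuousLinearMap.le_of_opNorm_le _ (norm_ringInverse_le (hJ.trans (by norm_num))) a
  calc _ ≤ A * ‖a‖ + A' * (3 * ‖a‖) := h2.trans (by gcongr)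
    _ = _ := by ring

set_option maxSynthPendingDepth 5 in
lemma exists_residual_bound (h : TorusFamily Bf r δ₀ Ω Λ p δ κ N u) (hN : ∀ i, N i ≤ N' i)
    {a : ℕ} (hF : Tame a s N' fun i => elErr (lagr Bf r (δ i)) (δ i) Ω (u i)) :
    ∃ b, ∀ q, ∃ C, 0 ≤ C ∧ ∀ i x, ‖elErr (lagr Bf r (δ i)) (δ i) Ω (u i) x +
      linErr (lagr Bf r (δ i)) (δ i) Ω (u i) (newtonStep Bf (lagr Bf r (δ i)) (δ i) Ω (u i)) x‖ ≤
      C * (s q i ^ 2 * N' i ^ b) := by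
  obtain ⟨c, hv, hz, -⟩ := h.tame_newton hN hF
  obtain ⟨c', hl⟩ := h.tame_lagForm hN hF
  refine ⟨(a + 1) + c + (c' + c), fun q => ?_⟩
  obtain ⟨C₁, hC₁, hb₁⟩ := hF.fderiv.norm_le q
  obtain ⟨C₂, hC₂, hb₂⟩ := hz.norm_le q
  obtain ⟨C₃, hC₃, hb₃⟩ := hl.norm_le q
  obtain ⟨C₄, hC₄, hb₄⟩ := hv.norm_le q
  refine ⟨C₁ * C₂ + 3 * (C₃ * C₄), by positivity, fun i x => ?_⟩
  have hN1 : 1 ≤ N' i := hF.one_le i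
  have hs := hF.size_nonneg q i
  refine (h.norm_le_of_jac i (x + δ i • Ω) (A := (C₁ * (s q i * N' i ^ (a + 1))) *
    (C₂ * (s q i * N' i ^ c))) (A' := (C₃ * (s q i * N' i ^ c')) * (C₄ * (s q i * N' i ^ c)))
    (by positivity) (fun b => ?_) (by positivity)).trans ?_
  · rw [h.newton_identity i x b]
    refine norm_sub_le_of_le ?_ ?_
    · refine (ContinuousLinearMap.le_opNorm _ _).trans ?_
      gcongr
      exact (ContinuousLinearMap.le_opNorm _ _).trans
        (mul_le_mul (hb₁ i x) (hb₂ i _) (norm_nonneg _) (by positivity))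
    · refine (ContinuousLinearMap.le_opNorm _ _).trans ?_
      gcongr
      exact (ContinuousLinearMap.le_opNorm _ _).trans
        (mul_le_mul (hb₃ i x) (hb₄ i _) (norm_nonneg _) (by positivity))
  · calc _ = C₁ * C₂ * (s q i ^ 2 * N' i ^ (a + 1 + c)) +
          3 * (C₃ * C₄) * (s q i ^ 2 * N' i ^ (c' + c)) := by ring
      _ ≤ C₁ * C₂ * (s q i ^ 2 * N' i ^ (a + 1 + c + (c' + c))) +
          3 * (C₃ * C₄) * (s q i ^ 2 * N' i ^ (a + 1 + c + (c' + c))) := by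
          have e1 := pow_le_pow_right₀ hN1 (show a + 1 + c ≤ a + 1 + c + (c' + c) by omega)
          have e2 := pow_le_pow_right₀ hN1 (show c' + c ≤ a + 1 + c + (c' + c) by omega)
          gcongr
      _ = _ := by ring

end TorusFamily

end StepBounds

section NewtonIteration

open scoped ContDiff

variable {n : ℕ}

/-- The Newton step, smoothed at frequency `M`. -/
def newtonLow (Bf : E n ≃L[ℝ] (E n →L[ℝ] ℝ)) (L : E n × E n → ℝ) (δ : ℝ) (Ω : E n) (M : ℝ)
    (u : E n → E n) : E n → E n :=
  fop (lowSym n M) (newtonStep Bf L δ Ω u)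

namespace TorusFamily

variable {ι : Type*} {Bf : E n ≃L[ℝ] (E n →L[ℝ] ℝ)} {r : ℝ → E n × E n → ℝ} {δ₀ : ℝ} {Ω : E n}
  {Λ : ℝ} {p : ℕ} {δ κ N : ι → ℝ} {u : ι → E n → E n}

set_option maxSynthPendingDepth 5 in
lemma exists_newton_estimate (h : TorusFamily Bf r δ₀ Ω Λ p δ κ N u) {M ε : ι → ℝ}
    (hM : ∀ i, N i ≤ M i) (hε : ∀ i x, ‖elErr (lagr Bf r (δ i)) (δ i) Ω (u i) x‖ ≤ ε i) :
    ∃ c, ∀ q, ∃ C, 0 ≤ C ∧ ∀ i,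
      (∀ x, ‖newtonStep Bf (lagr Bf r (δ i)) (δ i) Ω (u i) x‖ ≤
        C * ((ε i + κ i * (N i / M i) ^ q) * M i ^ c)) ∧
      ∀ x, ‖elErr (lagr Bf r (δ i)) (δ i) Ω
          (fun y => u i y + newtonLow Bf (lagr Bf r (δ i)) (δ i) Ω (M i) (u i) y) x‖ ≤
        C * (((ε i + κ i * (N i / M i) ^ q) ^ 2 + κ i * (N i / M i) ^ q) * M i ^ c) := by
  have hM1 : ∀ i, 1 ≤ M i := fun i => (h.one_le i).trans (hM i)
  have hε0 : ∀ i, 0 ≤ ε i := fun i => (norm_nonneg _).trans (hε i 0)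
  have hκ0 : ∀ (q : ℕ) i, 0 ≤ κ i * (N i / M i) ^ q := fun q i =>
    mul_nonneg (h.kappa_nonneg i) (pow_nonneg (div_nonneg (zero_le_one.trans (h.one_le i))
      (zero_le_one.trans (hM1 i))) q)
  have hF0 := h.tame_elErr
  have hper : ∀ i, IsPer (elErr (lagr Bf r (δ i)) (δ i) Ω (u i)) := fun i =>
    isPer_elErr (h.lag_per i) (h.per i)
  obtain ⟨c₀, -, -, hw₀⟩ := h.tame_newton (fun _ => le_rfl) hF0
  have hhigh := (hw₀.high h.isPer_newtonStep hM1).mono_freq hM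
  have hlinhigh := h.tame_linErr hM hhigh
  let s : ℕ → ι → ℝ := fun q i => ε i + κ i * (N i / M i) ^ q
  have hF : Tame (max (n + 1) (1 + (n + 1))) s M
      fun i => elErr (lagr Bf r (δ i)) (δ i) Ω (u i) := by
    have h1 := tame_low hM1 (s := s) (a := fun _ => 1) (fun q i => add_nonneg (hε0 i) (hκ0 q i))
      (fun q i x => (hε i x).trans (by
        rw [one_mul]
        exact le_add_of_nonneg_right (hκ0 q i))) hper hF0.smooth
    have h2 := ((hF0.high hper hM1).mono_freq hM).mono_size (s' := s)
      fun q i => le_add_of_nonneg_left (hε0 i)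
    exact (h1.add_self h2).congr fun i x => by abel
  obtain ⟨c₁, -, -, hw₁⟩ := h.tame_newton hM hF
  obtain ⟨b, hres⟩ := h.exists_residual_bound hM hF
  have hlow : Tame (c₁ + 0 + (n + 1)) s M fun i =>
      newtonLow Bf (lagr Bf r (δ i)) (δ i) Ω (M i) (u i) :=
    hw₁.multiplier h.isPer_newtonStep (fun i => lowSym_slowGrowth (M i)) zero_le_one
  refine ⟨c₁ + b + (2 * (c₁ + 0 + (n + 1)) + 3) + (c₀ + (n + 1) + 2), fun q => ?_⟩
  obtain ⟨C₁, hC₁, hb₁⟩ := hw₁.norm_le q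
  obtain ⟨C₂, hC₂, hb₂⟩ := hres q
  obtain ⟨C₃, hC₃, hb₃⟩ := h.exists_remainder_bound hM hlow q
  obtain ⟨C₄, hC₄, hb₄⟩ := hlinhigh.norm_le q
  refine ⟨C₁ + C₂ + C₃ + C₄, by positivity, fun i => ?_⟩
  set e := c₁ + b + (2 * (c₁ + 0 + (n + 1)) + 3) + (c₀ + (n + 1) + 2) with he
  have hs0 : 0 ≤ ε i + κ i * (N i / M i) ^ q := add_nonneg (hε0 i) (hκ0 q i)
  have hk0 := hκ0 q i
  have hMp : 0 < M i := zero_lt_one.trans_le (hM1 i)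
  have hp : ∀ j, j ≤ e → M i ^ j ≤ M i ^ e := fun j hj => pow_le_pow_right₀ (hM1 i) hj
  have hMe : 0 ≤ M i ^ e := by positivity
  constructor
  · intro x
    refine (hb₁ i x).trans ?_
    have := hp c₁ (by omega)
    gcongr
    linarith
  · intro x
    have e1 : elErr (lagr Bf r (δ i)) (δ i) Ω
          (fun y => u i y + newtonLow Bf (lagr Bf r (δ i)) (δ i) Ω (M i) (u i) y) x =
        (elErr (lagr Bf r (δ i)) (δ i) Ω
            (fun y => u i y + newtonLow Bf (lagr Bf r (δ i)) (δ i) Ω (M i) (u i) y) x -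
          elErr (lagr Bf r (δ i)) (δ i) Ω (u i) x - linErr (lagr Bf r (δ i)) (δ i) Ω (u i)
            (newtonLow Bf (lagr Bf r (δ i)) (δ i) Ω (M i) (u i)) x) +
        (elErr (lagr Bf r (δ i)) (δ i) Ω (u i) x + linErr (lagr Bf r (δ i)) (δ i) Ω (u i)
            (newtonStep Bf (lagr Bf r (δ i)) (δ i) Ω (u i)) x) -
        linErr (lagr Bf r (δ i)) (δ i) Ω (u i) (fun y =>
          newtonStep Bf (lagr Bf r (δ i)) (δ i) Ω (u i) y -
            newtonLow Bf (lagr Bf r (δ i)) (δ i) Ω (M i) (u i) y) x := by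
      rw [linErr_sub]
      abel
    rw [e1]
    refine (norm_sub_le_of_le (norm_add_le_of_le (hb₃ i x) (hb₂ i x)) (hb₄ i x)).trans ?_
    have p1 := hp (2 * (c₁ + 0 + (n + 1)) + 3) (by omega)
    have p2 := hp b (by omega)
    have p3 := hp (c₀ + (n + 1) + 2) (by omega)
    set t := ε i + κ i * (N i / M i) ^ q
    set v := κ i * (N i / M i) ^ q
    calc _ ≤ C₃ * (t ^ 2 * M i ^ e) + C₂ * (t ^ 2 * M i ^ e) + C₄ * (v * M i ^ e) := by
          change C₃ * (t ^ 2 * _) + C₂ * (t ^ 2 * _) + C₄ * (v * _) ≤ _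
          gcongr
      _ ≤ (C₁ + C₂ + C₃ + C₄) * (t ^ 2 * M i ^ e) + (C₁ + C₂ + C₃ + C₄) * (v * M i ^ e) := by
          have hx : 0 ≤ t ^ 2 * M i ^ e := by positivity
          have hy : 0 ≤ v * M i ^ e := by positivity
          linarith [mul_nonneg hC₁ hx, mul_nonneg hC₄ hx, mul_nonneg hC₁ hy, mul_nonneg hC₂ hy,
            mul_nonneg hC₃ hy]
      _ = _ := by ring

end TorusFamily

end NewtonIteration

section ApproximateTori

open scoped ContDiff

variable {n : ℕ}

/-- Bernstein constants of the smoothing operators. -/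
def bernC (n k : ℕ) : ℝ := (2 * Real.pi * n) ^ k * latSum n * 2 ^ (k + (n + 1) + 1)

lemma bernC_nonneg (n k : ℕ) : 0 ≤ bernC n k := by
  have : 0 ≤ latSum n := latSum_nonneg
  have := Real.pi_pos
  unfold bernC
  positivity

/-- A periodic solution of the discrete Euler-Lagrange equation up to an error `ε`, whose
frequencies are essentially bounded by `T ^ 2`. -/
structure ApproxTorus (Bf : E n ≃L[ℝ] (E n →L[ℝ] ℝ)) (r : ℝ → E n × E n → ℝ) (δ₀ : ℝ) (Ω : E n)
    (Λ : ℝ) (p : ℕ) (c₀ δ κ T ε : ℝ) (u : E n → E n) : Prop where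
  delta_mem : δ ∈ Set.Ioc 0 δ₀
  delta_le : δ ≤ κ
  kappa_le : κ ≤ 1
  one_le : 1 ≤ T
  small_divisor : SmallDivisor δ Ω Λ p
  smooth : ContDiff ℝ ∞ u
  per : IsPer u
  bound : ∀ (k : ℕ) x, ‖iteratedFDeriv ℝ k u x‖ ≤
    κ * c₀ * (1 + bernC n k) * (1 - 1 / T ^ 2) * (T ^ 2) ^ (k - 1)
  err_le : ∀ x, ‖elErr (lagr Bf r δ) δ Ω u x‖ ≤ ε

variable {Bf : E n ≃L[ℝ] (E n →L[ℝ] ℝ)} {r : ℝ → E n × E n → ℝ} {δ₀ : ℝ} {Ω : E n} {Λ : ℝ} {p : ℕ}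

lemma LagFamily.exists_torusFamily (h : LagFamily Bf r δ₀) (hδ₀ : 0 < δ₀) (hδ₀1 : δ₀ ≤ 1)
    (hΛ : 0 ≤ Λ) : ∃ δ₁ c₀ : ℝ, 0 < δ₁ ∧ δ₁ ≤ δ₀ ∧ 0 < c₀ ∧ ∀ {ι : Type} (δ κ T ε : ι → ℝ)
      (u : ι → E n → E n),
      (∀ i, ApproxTorus Bf r δ₁ Ω Λ p c₀ (δ i) (κ i) (T i) (ε i) (u i)) →
      TorusFamily Bf r δ₀ Ω Λ p δ κ (fun i => T i ^ 2) u := by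
  obtain ⟨η, hη, hη4, hb⟩ := h.exists_twist_bound hδ₀1
  have hB := bernC_nonneg n
  refine ⟨min δ₀ η, η / (1 + bernC n 1), lt_min hδ₀ hη, min_le_left _ _,
    div_pos hη (by linarith [hB 1]), fun {ι} δ κ T ε u ht => ?_⟩
  have hT : ∀ i, 1 ≤ T i ^ 2 := fun i => one_le_pow₀ (ht i).one_le
  have hT1 : ∀ i, 0 ≤ 1 - 1 / T i ^ 2 := fun i => by
    rw [sub_nonneg, div_le_one (by linarith [hT i])]
    exact hT i
  have hT2 : ∀ i, 1 - 1 / T i ^ 2 ≤ 1 := fun i => by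
    have := hT i
    have : 0 ≤ 1 / T i ^ 2 := by positivity
    linarith
  have hκ : ∀ i, 0 ≤ κ i := fun i => (ht i).delta_mem.1.le.trans (ht i).delta_le
  have hd : ∀ i x, ‖fderiv ℝ (u i) x‖ ≤ η := fun i x => by
    have h1 := (ht i).bound 1 x
    rw [← norm_iteratedFDeriv_fderiv, norm_iteratedFDeriv_zero] at h1
    refine h1.trans ?_
    have h3 := hκ i
    have h4 := (ht i).kappa_le
    have h5 := hT1 i
    have h6 := hT2 i
    have h7 := hB 1
    rw [mul_assoc (κ i), div_mul_cancel₀ _ (by linarith)]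
    simp only [Nat.sub_self, pow_zero, mul_one]
    calc κ i * η * (1 - 1 / T i ^ 2) ≤ 1 * η * 1 := by gcongr
      _ = η := by ring
  have hmem : ∀ i, δ i ∈ Set.Ioc 0 δ₀ := fun i =>
    ⟨(ht i).delta_mem.1, (ht i).delta_mem.2.trans (min_le_left _ _)⟩
  exact {
    lag := h
    delta_mem := hmem
    delta_le := fun i => (ht i).delta_le
    kappa_le := fun i => (ht i).kappa_le
    one_le := hT
    small_divisor := fun i => (ht i).small_divisor
    nonneg := hΛ
    smooth := fun i => (ht i).smooth
    per := fun i => (ht i).per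
    bound := fun k => by
      have h7 := hB k
      have h8 := hB 1
      refine ⟨η / (1 + bernC n 1) * (1 + bernC n k), by positivity, fun i x =>
        ((ht i).bound k x).trans ?_⟩
      have h3 := hκ i
      have h5 := hT1 i
      have h6 := hT2 i
      have h9 := hT i
      calc _ ≤ κ i * (η / (1 + bernC n 1)) * (1 + bernC n k) * 1 * (T i ^ 2) ^ (k - 1) := by
            gcongr
        _ = _ := by ring
    fderiv_le := fun i x => (hd i x).trans hη4
    twist_le := fun i x => hb (δ i) (hmem i) ((ht i).delta_mem.2.trans (min_le_right _ _)) Ω (u i)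
      (hd i) x }

lemma approxTorus_zero {c₀ δ κ T ε : ℝ} (hδ : δ ∈ Set.Ioc 0 δ₀) (hκ : δ ≤ κ) (hκ1 : κ ≤ 1)
    (hT : 1 ≤ T) (hc₀ : 0 ≤ c₀) (hs : SmallDivisor δ Ω Λ p)
    (hε : ∀ x, ‖elErr (lagr Bf r δ) δ Ω (fun _ => 0) x‖ ≤ ε) :
    ApproxTorus Bf r δ₀ Ω Λ p c₀ δ κ T ε fun _ => 0 where
  delta_mem := hδ
  delta_le := hκ
  kappa_le := hκ1
  one_le := hT
  small_divisor := hs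
  smooth := contDiff_const
  per _ _ := rfl
  bound k x := by
    have h1 := bernC_nonneg n k
    have h2 : 0 ≤ κ := hδ.1.le.trans hκ
    have h3 : 0 ≤ 1 - 1 / T ^ 2 := by
      rw [sub_nonneg, div_le_one (by positivity)]
      exact one_le_pow₀ hT
    have h4 : iteratedFDeriv ℝ k (fun _ : E n => (0 : E n)) x = 0 := by
      rw [iteratedFDeriv_fun_zero]
      rfl
    rw [h4, norm_zero]
    positivity
  err_le := hε

/-- The smoothed Newton step of an approximate torus. -/
def newtonIncr (Bf : E n ≃L[ℝ] (E n →L[ℝ] ℝ)) (L : E n × E n → ℝ) (δ : ℝ) (Ω : E n) (T : ℝ)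
    (u : E n → E n) : E n → E n :=
  newtonLow Bf L δ Ω (T ^ 3) u

lemma LagFamily.exists_step (h : LagFamily Bf r δ₀) (hδ₀ : 0 < δ₀) (hδ₀1 : δ₀ ≤ 1)
    (hΛ : 0 ≤ Λ) : ∃ δ₁ c₀ C₀ : ℝ, ∃ c : ℕ, 0 < δ₁ ∧ δ₁ ≤ δ₀ ∧ 0 < c₀ ∧ 0 ≤ C₀ ∧
      (∀ δ ∈ Set.Ioc 0 δ₁, SmallDivisor δ Ω Λ p → ∀ x,
        ‖elErr (lagr Bf r δ) δ Ω (fun _ => 0) x‖ ≤ C₀ * δ) ∧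
      ∀ q, ∃ C, 0 ≤ C ∧ ∀ δ κ T ε u, ApproxTorus Bf r δ₁ Ω Λ p c₀ δ κ T ε u →
        ContDiff ℝ ∞ (newtonIncr Bf (lagr Bf r δ) δ Ω T u) ∧
        IsPer (newtonIncr Bf (lagr Bf r δ) δ Ω T u) ∧
        (∀ k x, ‖iteratedFDeriv ℝ k (newtonIncr Bf (lagr Bf r δ) δ Ω T u) x‖ ≤
          bernC n k * (T ^ 3) ^ k * (C * ((ε + κ / T ^ q) * T ^ c))) ∧
        ∀ x, ‖elErr (lagr Bf r δ) δ Ω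
          (fun y => u y + newtonIncr Bf (lagr Bf r δ) δ Ω T u y) x‖ ≤
            C * (((ε + κ / T ^ q) ^ 2 + κ / T ^ q) * T ^ c) := by
  obtain ⟨δ₁, c₀, hδ₁, hδ₁₀, hc₀, hfam⟩ := h.exists_torusFamily (Ω := Ω) (p := p) hδ₀ hδ₀1 hΛ
  let J : Type := {i : ℝ // i ∈ Set.Ioc 0 δ₁ ∧ SmallDivisor i Ω Λ p}
  have hbd : ∀ i : J, ∃ C, ∀ x, ‖elErr (lagr Bf r i.1) i.1 Ω (fun _ => 0) x‖ ≤ C := fun i =>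
    IsPer.bounded (isPer_elErr (fun x y l => h.lagr_per ⟨i.2.1.1, i.2.1.2.trans hδ₁₀⟩ x y l)
      fun _ _ => rfl) (contDiff_elErr (h.contDiff_lagr _) contDiff_const).continuous
  choose e he using hbd
  have hJ := hfam (ι := J) (fun i => i.1) (fun i => i.1) (fun _ => 1) e (fun _ _ => 0) fun i =>
    approxTorus_zero i.2.1 le_rfl (i.2.1.2.trans (hδ₁₀.trans hδ₀1)) le_rfl hc₀.le i.2.2 (he i)
  obtain ⟨C₀, hC₀, hb₀⟩ := hJ.tame_elErr.norm_le 0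
  let I : Type := {i : ℝ × ℝ × ℝ × ℝ × (E n → E n) //
    ApproxTorus Bf r δ₁ Ω Λ p c₀ i.1 i.2.1 i.2.2.1 i.2.2.2.1 i.2.2.2.2}
  have hI := hfam (ι := I) (fun i => i.1.1) (fun i => i.1.2.1) (fun i => i.1.2.2.1)
    (fun i => i.1.2.2.2.1) (fun i => i.1.2.2.2.2) fun i => i.2
  obtain ⟨c, hc⟩ := hI.exists_newton_estimate (M := fun i => i.1.2.2.1 ^ 3)
    (ε := fun i => i.1.2.2.2.1) (fun i => pow_le_pow_right₀ i.2.one_le (by norm_num))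
    (fun i => i.2.err_le)
  refine ⟨δ₁, c₀, C₀, 3 * (c + (n + 1)), hδ₁, hδ₁₀, hc₀, hC₀, fun δ hδ hs x => ?_, fun q => ?_⟩
  · simpa using hb₀ ⟨δ, hδ, hs⟩ x
  obtain ⟨C, hC, hb⟩ := hc q
  refine ⟨C, hC, fun δ κ T ε u ht => ?_⟩
  obtain ⟨h1, h2⟩ := hb ⟨(δ, κ, T, ε, u), ht⟩
  simp only at h1 h2
  have hw : ContDiff ℝ ∞ (newtonStep Bf (lagr Bf r δ) δ Ω u) := by
    obtain ⟨_, -, -, hw⟩ := hI.tame_newton (fun _ => le_rfl) hI.tame_elErr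
    exact hw.smooth ⟨(δ, κ, T, ε, u), ht⟩
  have hwp := hI.isPer_newtonStep ⟨(δ, κ, T, ε, u), ht⟩
  have hT := ht.one_le
  have hT0 : 0 < T := by linarith
  have e1 : T ^ 2 / T ^ 3 = T⁻¹ := by field_simp
  have hκ : 0 ≤ κ := ht.delta_mem.1.le.trans ht.delta_le
  have hε : 0 ≤ ε := (norm_nonneg _).trans (ht.err_le 0)
  rw [e1, inv_pow, ← div_eq_mul_inv] at h1 h2
  refine ⟨contDiff_fop (lowSym_slowGrowth _) hwp hw, isPer_fop _ _, fun k x => ?_, fun x => ?_⟩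
  · refine (fop_lowSym_bound (one_le_pow₀ hT) h1 k x).trans_eq ?_
    rw [bernC]
    ring
  · refine (h2 x).trans ?_
    rw [← pow_mul]
    have : T ^ (3 * c) ≤ T ^ (3 * (c + (n + 1))) := pow_le_pow_right₀ hT (by omega)
    gcongr

end ApproximateTori

section ApproximationSequence

open scoped ContDiff

variable {n : ℕ}

lemma step_size_le {C c₀ κ T : ℝ} {c : ℕ} (hC : 0 ≤ C) (hκ : 0 ≤ κ) (hT : 2 ≤ T)
    (hT' : 2 * C ≤ c₀ * T) (hc₀ : 0 ≤ c₀) :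
    T ^ 3 * (C * ((κ / T ^ (2 * (c + 4)) + κ / T ^ (4 * (c + 4))) * T ^ c)) ≤
      κ * c₀ * (1 / T ^ 2 - 1 / T ^ 3) := by
  have hT0 : 0 < T := by linarith
  have hT1 : 1 ≤ T := by linarith
  have h1 : κ / T ^ (4 * (c + 4)) ≤ κ / T ^ (2 * (c + 4)) :=
    div_le_div_of_nonneg_left hκ (by positivity) (pow_le_pow_right₀ hT1 (by omega))
  have h2 : κ * c₀ * (1 / T ^ 3) ≤ κ * c₀ * (1 / T ^ 2 - 1 / T ^ 3) := by
    refine mul_le_mul_of_nonneg_left ?_ (by positivity)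
    rw [le_sub_iff_add_le, ← add_div, div_le_div_iff₀ (by positivity) (by positivity)]
    nlinarith [pow_pos hT0 2]
  refine le_trans ?_ h2
  calc T ^ 3 * (C * ((κ / T ^ (2 * (c + 4)) + κ / T ^ (4 * (c + 4))) * T ^ c))
      ≤ T ^ 3 * (C * ((κ / T ^ (2 * (c + 4)) + κ / T ^ (2 * (c + 4))) * T ^ c)) := by gcongr
    _ = κ * (2 * C) / T ^ (c + 5) := by
        field_simp
        ring
    _ ≤ κ * (c₀ * T) / T ^ (c + 5) := by gcongr
    _ = κ * c₀ * (1 / T ^ (c + 4)) := by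
        field_simp
        ring
    _ ≤ κ * c₀ * (1 / T ^ 3) := by
        have : T ^ 3 ≤ T ^ (c + 4) := pow_le_pow_right₀ hT1 (by omega)
        gcongr

lemma step_error_le {C κ T A : ℝ} {c b : ℕ} (hC : 0 ≤ C) (hκ : 0 ≤ κ) (hκ1 : κ ≤ 1) (hT : 1 ≤ T)
    (hA : 0 ≤ A) :
    C * (((A * κ / T ^ (2 * b) + κ / T ^ (4 * b)) ^ 2 + κ / T ^ (4 * b)) * T ^ c) ≤
      C * ((A + 1) ^ 2 + 1) * κ * T ^ c / T ^ (4 * b) := by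
  have hT0 : 0 < T := by linarith
  have h1 : κ / T ^ (4 * b) ≤ κ / T ^ (2 * b) :=
    div_le_div_of_nonneg_left hκ (by positivity) (pow_le_pow_right₀ hT (by omega))
  have h2 : κ ^ 2 ≤ κ := by nlinarith
  calc _ ≤ C * (((A * κ / T ^ (2 * b) + κ / T ^ (2 * b)) ^ 2 + κ / T ^ (4 * b)) * T ^ c) := by
        gcongr
    _ = C * ((A + 1) ^ 2 * κ ^ 2 + κ) * T ^ c / T ^ (4 * b) := by
        field_simp
        ring
    _ ≤ C * ((A + 1) ^ 2 * κ + κ) * T ^ c / T ^ (4 * b) := by gcongr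
    _ = _ := by ring

variable {Bf : E n ≃L[ℝ] (E n →L[ℝ] ℝ)} {r : ℝ → E n × E n → ℝ} {δ₀ : ℝ} {Ω : E n} {Λ : ℝ} {p : ℕ}
  {c₀ δ κ T T' C ε : ℝ} {c : ℕ} {u w : E n → E n}

lemma ApproxTorus.kappa_nonneg (h : ApproxTorus Bf r δ₀ Ω Λ p c₀ δ κ T ε u) : 0 ≤ κ :=
  h.delta_mem.1.le.trans h.delta_le

lemma ApproxTorus.next (h : ApproxTorus Bf r δ₀ Ω Λ p c₀ δ κ T (κ / T ^ (2 * (c + 4))) u)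
    (hw : ContDiff ℝ ∞ w) (hwp : IsPer w) (hb : ∀ k x, ‖iteratedFDeriv ℝ k w x‖ ≤
      bernC n k * (T ^ 3) ^ k * (C * ((κ / T ^ (2 * (c + 4)) + κ / T ^ (4 * (c + 4))) * T ^ c)))
    (he : ∀ x, ‖elErr (lagr Bf r δ) δ Ω (fun y => u y + w y) x‖ ≤
      C * (((κ / T ^ (2 * (c + 4)) + κ / T ^ (4 * (c + 4))) ^ 2 + κ / T ^ (4 * (c + 4))) * T ^ c))
    (hC : 0 ≤ C) (hc₀ : 0 ≤ c₀) (hT : 2 ≤ T) (hT₁ : 5 * C ≤ T) (hT₂ : 2 * C ≤ c₀ * T)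
    (hT' : 1 ≤ T') (hTT' : T' ^ 2 = T ^ 3) :
    ApproxTorus Bf r δ₀ Ω Λ p c₀ δ κ T' (κ / T' ^ (2 * (c + 4))) fun y => u y + w y where
  delta_mem := h.delta_mem
  delta_le := h.delta_le
  kappa_le := h.kappa_le
  one_le := hT'
  small_divisor := h.small_divisor
  smooth := h.smooth.add hw
  per := h.per.comp₂ hwp (· + ·)
  bound k x := by
    have hT1 : 1 ≤ T := by linarith
    have hκ := h.kappa_nonneg
    have hB := bernC_nonneg n k
    have h1 := step_size_le (c := c) hC hκ hT hT₂ hc₀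
    have h2 : 0 ≤ 1 - 1 / T ^ 2 := by
      rw [sub_nonneg, div_le_one (by positivity)]
      exact one_le_pow₀ hT1
    set A := C * ((κ / T ^ (2 * (c + 4)) + κ / T ^ (4 * (c + 4))) * T ^ c) with hA
    have hA0 : 0 ≤ A := by positivity
    have h3 : (T ^ 2) ^ (k - 1) ≤ (T ^ 3) ^ (k - 1) :=
      pow_le_pow_left₀ (by positivity) (pow_le_pow_right₀ hT1 (by norm_num)) _
    have h4 : (T ^ 3) ^ k ≤ T ^ 3 * (T ^ 3) ^ (k - 1) := by
      rw [← pow_succ']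
      exact pow_le_pow_right₀ (one_le_pow₀ hT1) (by omega)
    change ‖iteratedFDeriv ℝ k (u + w) x‖ ≤ _
    rw [iteratedFDeriv_add_apply (h.smooth.contDiffAt.of_le (by exact_mod_cast le_top))
      (hw.contDiffAt.of_le (by exact_mod_cast le_top))]
    refine (norm_add_le_of_le (h.bound k x) (hb k x)).trans ?_
    rw [hTT']
    calc _ ≤ κ * c₀ * (1 + bernC n k) * (1 - 1 / T ^ 2) * (T ^ 3) ^ (k - 1) +
          (1 + bernC n k) * (T ^ 3 * (T ^ 3) ^ (k - 1)) * A := by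
          gcongr
          linarith
      _ = (1 + bernC n k) * (T ^ 3) ^ (k - 1) * (κ * c₀ * (1 - 1 / T ^ 2) + T ^ 3 * A) := by ring
      _ ≤ (1 + bernC n k) * (T ^ 3) ^ (k - 1) * (κ * c₀ * (1 - 1 / T ^ 3)) := by
          gcongr
          linarith
      _ = _ := by ring
  err_le x := by
    have hT0 : 0 < T := by linarith
    have hκ := h.kappa_nonneg
    refine (he x).trans ?_
    have h1 := step_error_le (C := C) (T := T) (A := 1) (c := c) (b := c + 4) hC hκ h.kappa_le
      (by linarith) zero_le_one
    rw [one_mul] at h1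
    refine h1.trans ?_
    have h2 : T ≤ T ^ 4 := le_self_pow₀ (by linarith) (by norm_num)
    rw [pow_mul T', hTT']
    calc C * ((1 + 1) ^ 2 + 1) * κ * T ^ c / T ^ (4 * (c + 4))
        = (5 * C) * (κ * T ^ c / T ^ (4 * (c + 4))) := by ring
      _ ≤ T ^ 4 * (κ * T ^ c / T ^ (4 * (c + 4))) := by
          gcongr
          linarith
      _ = κ / (T ^ 3) ^ (c + 4) := by
          field_simp
          ring

/-- The sequence of frequencies, growing superexponentially. -/
def freqSeq (T : ℝ) : ℕ → ℝ
  | 0 => T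
  | j + 1 => √(freqSeq T j ^ 3)

lemma freqSeq_bounds (hT : 4 ≤ T) (j : ℕ) : T ≤ freqSeq T j ∧ 2 ^ j ≤ freqSeq T j := by
  induction j with
  | zero => exact ⟨le_rfl, by simp only [pow_zero, freqSeq]; linarith⟩
  | succ j ih =>
    have h4 : 4 ≤ freqSeq T j := hT.trans ih.1
    have h1 : 2 * freqSeq T j ≤ freqSeq T (j + 1) := by
      refine Real.le_sqrt_of_sq_le ?_
      nlinarith [sq_nonneg (freqSeq T j)]
    exact ⟨by linarith, by rw [pow_succ']; linarith⟩

lemma freqSeq_succ_sq (hT : 4 ≤ T) (j : ℕ) : freqSeq T (j + 1) ^ 2 = freqSeq T j ^ 3 :=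
  Real.sq_sqrt (pow_nonneg (by linarith [(freqSeq_bounds hT j).1]) 3)

/-- The sequence of approximate tori. -/
def torusSeq (Bf : E n ≃L[ℝ] (E n →L[ℝ] ℝ)) (L : E n × E n → ℝ) (δ : ℝ) (Ω : E n) (T : ℝ) :
    ℕ → E n → E n
  | 0 => fun _ => 0
  | j + 1 => fun y => torusSeq Bf L δ Ω T j y +
      newtonIncr Bf L δ Ω (freqSeq T j) (torusSeq Bf L δ Ω T j) y

lemma torusSeq_eq_sum (L : E n × E n → ℝ) (j : ℕ) (x : E n) : torusSeq Bf L δ Ω T j x =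
    ∑ i ∈ Finset.range j, newtonIncr Bf L δ Ω (freqSeq T i) (torusSeq Bf L δ Ω T i) x := by
  induction j with
  | zero => rfl
  | succ j ih => rw [Finset.sum_range_succ, ← ih, torusSeq]

end ApproximationSequence

section NashMoserIteration

open scoped ContDiff

variable {n : ℕ} {Bf : E n ≃L[ℝ] (E n →L[ℝ] ℝ)} {r : ℝ → E n × E n → ℝ} {δ₀ : ℝ} {Ω : E n} {Λ : ℝ}
  {p : ℕ}

lemma ApproxTorus.of_err_le {c₀ δ κ T ε ε' : ℝ} {u : E n → E n}
    (h : ApproxTorus Bf r δ₀ Ω Λ p c₀ δ κ T ε u)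
    (he : ∀ x, ‖elErr (lagr Bf r δ) δ Ω u x‖ ≤ ε') :
    ApproxTorus Bf r δ₀ Ω Λ p c₀ δ κ T ε' u :=
  { h with err_le := he }

lemma LagFamily.exists_torusSeq (h : LagFamily Bf r δ₀) (hδ₀ : 0 < δ₀) (hδ₀1 : δ₀ ≤ 1)
    (hΛ : 0 ≤ Λ) : ∃ δ₁ K T : ℝ, ∃ c : ℕ, 0 < δ₁ ∧ δ₁ ≤ δ₀ ∧ 0 ≤ K ∧ K * δ₁ ≤ 1 ∧ 4 ≤ T ∧
      (∀ δ ∈ Set.Ioc 0 δ₁, SmallDivisor δ Ω Λ p → ∀ j,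
        ContDiff ℝ ∞ (newtonIncr Bf (lagr Bf r δ) δ Ω (freqSeq T j)
          (torusSeq Bf (lagr Bf r δ) δ Ω T j)) ∧
        IsPer (newtonIncr Bf (lagr Bf r δ) δ Ω (freqSeq T j)
          (torusSeq Bf (lagr Bf r δ) δ Ω T j)) ∧
        ∀ x, ‖elErr (lagr Bf r δ) δ Ω (torusSeq Bf (lagr Bf r δ) δ Ω T j) x‖ ≤
          K * δ / freqSeq T j ^ (2 * (c + 4))) ∧
      ∀ q, ∃ C, 0 ≤ C ∧ ∀ δ ∈ Set.Ioc 0 δ₁, SmallDivisor δ Ω Λ p → ∀ j ε,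
        (∀ x, ‖elErr (lagr Bf r δ) δ Ω (torusSeq Bf (lagr Bf r δ) δ Ω T j) x‖ ≤ ε) →
        (∀ k x, ‖iteratedFDeriv ℝ k (newtonIncr Bf (lagr Bf r δ) δ Ω (freqSeq T j)
            (torusSeq Bf (lagr Bf r δ) δ Ω T j)) x‖ ≤
          bernC n k * (freqSeq T j ^ 3) ^ k *
            (C * ((ε + K * δ / freqSeq T j ^ q) * freqSeq T j ^ c))) ∧
        ∀ x, ‖elErr (lagr Bf r δ) δ Ω (torusSeq Bf (lagr Bf r δ) δ Ω T (j + 1)) x‖ ≤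
          C * (((ε + K * δ / freqSeq T j ^ q) ^ 2 + K * δ / freqSeq T j ^ q) *
            freqSeq T j ^ c) := by
  obtain ⟨δ₁, c₀, C₀, c, hδ₁, hδ₁₀, hc₀, hC₀, hst, hstep⟩ :=
    h.exists_step (Ω := Ω) (p := p) hδ₀ hδ₀1 hΛ
  obtain ⟨C, hC, hCs⟩ := hstep (4 * (c + 4))
  set T : ℝ := 4 + 5 * C + 2 * C / c₀ with hT
  have hq : 0 ≤ 2 * C / c₀ := by positivity
  have hT4 : 4 ≤ T := by linarith
  have hT0 : 0 < T := by linarith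
  have hTC : 2 * C ≤ c₀ * T := by
    have : c₀ * (2 * C / c₀) = 2 * C := by field_simp
    nlinarith
  set K : ℝ := 1 + C₀ * T ^ (2 * (c + 4)) with hK
  have hK1 : 1 ≤ K := by
    have : 0 ≤ C₀ * T ^ (2 * (c + 4)) := by positivity
    linarith
  have hKi : K * K⁻¹ = 1 := mul_inv_cancel₀ (by linarith)
  have key : ∀ δ ∈ Set.Ioc 0 (min δ₁ K⁻¹), SmallDivisor δ Ω Λ p → ∀ j,
      ApproxTorus Bf r δ₁ Ω Λ p c₀ δ (K * δ) (freqSeq T j)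
        (K * δ / freqSeq T j ^ (2 * (c + 4))) (torusSeq Bf (lagr Bf r δ) δ Ω T j) := by
    intro δ hδ hs j
    have hδ' : δ ∈ Set.Ioc 0 δ₁ := ⟨hδ.1, hδ.2.trans (min_le_left _ _)⟩
    have hKδ : K * δ ≤ 1 := by
      rw [← hKi]
      exact mul_le_mul_of_nonneg_left (hδ.2.trans (min_le_right _ _)) (by linarith)
    induction j with
    | zero =>
      refine approxTorus_zero hδ' (by nlinarith [hδ.1]) hKδ (by simp only [freqSeq]; linarith)
        hc₀.le hs fun x => (hst δ hδ' hs x).trans ?_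
      simp only [freqSeq]
      rw [le_div_iff₀ (by positivity)]
      have := hδ.1
      nlinarith
    | succ j ih =>
      have hf := freqSeq_bounds hT4 j
      have hf' := freqSeq_bounds hT4 (j + 1)
      obtain ⟨h1, h2, h3, h4⟩ := hCs _ _ _ _ _ ih
      refine ih.next h1 h2 h3 h4 hC hc₀.le (by linarith) (by linarith) ?_ (by linarith)
        (freqSeq_succ_sq hT4 j)
      nlinarith [hf.1]
  refine ⟨min δ₁ K⁻¹, K, T, c, lt_min hδ₁ (by positivity), (min_le_left _ _).trans hδ₁₀,
    by linarith, ?_, hT4, fun δ hδ hs j => ?_, fun q => ?_⟩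
  · rw [← hKi]
    exact mul_le_mul_of_nonneg_left (min_le_right _ _) (by linarith)
  · obtain ⟨h1, h2, -, -⟩ := hCs _ _ _ _ _ (key δ hδ hs j)
    exact ⟨h1, h2, (key δ hδ hs j).err_le⟩
  · obtain ⟨D, hD, hDs⟩ := hstep q
    refine ⟨D, hD, fun δ hδ hs j ε hε => ?_⟩
    exact (hDs _ _ _ _ _ ((key δ hδ hs j).of_err_le hε)).2.2

lemma LagFamily.exists_torusSeq_rapid (h : LagFamily Bf r δ₀) (hδ₀ : 0 < δ₀) (hδ₀1 : δ₀ ≤ 1)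
    (hΛ : 0 ≤ Λ) : ∃ δ₁ T : ℝ, 0 < δ₁ ∧ δ₁ ≤ δ₀ ∧
      (∀ δ ∈ Set.Ioc 0 δ₁, SmallDivisor δ Ω Λ p → ∀ j,
        ContDiff ℝ ∞ (newtonIncr Bf (lagr Bf r δ) δ Ω (freqSeq T j)
          (torusSeq Bf (lagr Bf r δ) δ Ω T j)) ∧
        IsPer (newtonIncr Bf (lagr Bf r δ) δ Ω (freqSeq T j)
          (torusSeq Bf (lagr Bf r δ) δ Ω T j))) ∧
      (∃ A, ∀ δ ∈ Set.Ioc 0 δ₁, SmallDivisor δ Ω Λ p → ∀ j x,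
        ‖elErr (lagr Bf r δ) δ Ω (torusSeq Bf (lagr Bf r δ) δ Ω T j) x‖ ≤ A * (1 / 2) ^ j) ∧
      ∀ k, ∃ D, 0 ≤ D ∧ ∀ δ ∈ Set.Ioc 0 δ₁, SmallDivisor δ Ω Λ p → ∀ j x,
        ‖iteratedFDeriv ℝ k (newtonIncr Bf (lagr Bf r δ) δ Ω (freqSeq T j)
          (torusSeq Bf (lagr Bf r δ) δ Ω T j)) x‖ ≤ D * δ * (1 / 2) ^ j := by
  obtain ⟨δ₁, K, T, c, hδ₁, hδ₁₀, hK, hKδ₁, hT4, hsm, hstep⟩ :=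
    h.exists_torusSeq (Ω := Ω) (p := p) hδ₀ hδ₀1 hΛ
  have hKδ : ∀ δ ∈ Set.Ioc 0 δ₁, 0 ≤ K * δ ∧ K * δ ≤ 1 := fun δ hδ =>
    ⟨mul_nonneg hK hδ.1.le, (mul_le_mul_of_nonneg_left hδ.2 hK).trans hKδ₁⟩
  have hF1 : ∀ j, 1 ≤ freqSeq T j := fun j => by linarith [(freqSeq_bounds hT4 j).1]
  have hF : ∀ j, 1 / freqSeq T j ≤ (1 / 2) ^ j := fun j => by
    rw [one_div_pow]
    exact one_div_le_one_div_of_le (by positivity) (freqSeq_bounds hT4 j).2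
  have rapid : ∀ b, c + 4 ≤ b → ∃ A, 0 ≤ A ∧ ∀ δ ∈ Set.Ioc 0 δ₁, SmallDivisor δ Ω Λ p → ∀ j x,
      ‖elErr (lagr Bf r δ) δ Ω (torusSeq Bf (lagr Bf r δ) δ Ω T j) x‖ ≤
        A * (K * δ) / freqSeq T j ^ (2 * b) := by
    intro b hb
    induction b, hb using Nat.le_induction with
    | base => exact ⟨1, zero_le_one, fun δ hδ hs j => by rw [one_mul]; exact (hsm δ hδ hs j).2.2⟩
    | succ b hb ih =>
      obtain ⟨A, hA, ih⟩ := ih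
      obtain ⟨C, hC, hCs⟩ := hstep (4 * b)
      refine ⟨A * T ^ 2 + C * ((A + 1) ^ 2 + 1), by positivity, fun δ hδ hs j x => ?_⟩
      obtain ⟨h0, h1⟩ := hKδ δ hδ
      cases j with
      | zero =>
        refine (ih δ hδ hs 0 x).trans ?_
        simp only [freqSeq]
        rw [div_le_div_iff₀ (by positivity) (by positivity), Nat.mul_succ, pow_add]
        have h2 : 0 ≤ C * ((A + 1) ^ 2 + 1) * (K * δ) * T ^ (2 * b) := by positivity
        linear_combination h2
      | succ j =>
        have hF0 : 0 < freqSeq T j := by linarith [hF1 j]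
        refine ((hCs δ hδ hs j _ (ih δ hδ hs j)).2 x).trans ?_
        refine (step_error_le hC h0 h1 (hF1 j) hA).trans ?_
        rw [pow_mul (freqSeq T (j + 1)), freqSeq_succ_sq hT4 j, ← pow_mul,
          div_le_div_iff₀ (by positivity) (by positivity)]
        have h3 : freqSeq T j ^ c * freqSeq T j ^ (3 * (b + 1)) ≤ freqSeq T j ^ (4 * b) := by
          rw [← pow_add]
          exact pow_le_pow_right₀ (hF1 j) (by omega)
        calc _ = C * ((A + 1) ^ 2 + 1) * (K * δ) *
              (freqSeq T j ^ c * freqSeq T j ^ (3 * (b + 1))) := by ring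
          _ ≤ (A * T ^ 2 + C * ((A + 1) ^ 2 + 1)) * (K * δ) * freqSeq T j ^ (4 * b) := by
            have : 0 ≤ A * T ^ 2 := by positivity
            gcongr
            linarith
  refine ⟨δ₁, T, hδ₁, hδ₁₀, fun δ hδ hs j => ⟨(hsm δ hδ hs j).1, (hsm δ hδ hs j).2.1⟩, ?_,
    fun k => ?_⟩
  · obtain ⟨A, hA, hb⟩ := rapid (c + 4) le_rfl
    refine ⟨A, fun δ hδ hs j x => (hb δ hδ hs j x).trans ?_⟩
    obtain ⟨h0, h1⟩ := hKδ δ hδ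
    have h2 : freqSeq T j ≤ freqSeq T j ^ (2 * (c + 4)) := le_self_pow₀ (hF1 j) (by omega)
    have hF0 : 0 < freqSeq T j := by linarith [hF1 j]
    calc _ ≤ A * 1 / freqSeq T j := by gcongr
      _ = A * (1 / freqSeq T j) := by ring
      _ ≤ _ := mul_le_mul_of_nonneg_left (hF j) hA
  · obtain ⟨A, hA, hb⟩ := rapid (c + 4 + 2 * k) (by omega)
    obtain ⟨C, hC, hCs⟩ := hstep (2 * (c + 4 + 2 * k))
    have hB := bernC_nonneg n k
    refine ⟨bernC n k * C * (A + 1) * K, by positivity, fun δ hδ hs j x => ?_⟩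
    refine ((hCs δ hδ hs j _ (hb δ hδ hs j)).1 k x).trans ?_
    obtain ⟨h0, h1⟩ := hKδ δ hδ
    have hF0 : 0 < freqSeq T j := by linarith [hF1 j]
    have h3 : freqSeq T j ^ (3 * k) * freqSeq T j ^ c * freqSeq T j ≤
        freqSeq T j ^ (2 * (c + 4 + 2 * k)) := by
      rw [← pow_add, ← pow_succ]
      exact pow_le_pow_right₀ (hF1 j) (by omega)
    calc _ = bernC n k * C * (A + 1) * K * δ * (freqSeq T j ^ (3 * k) * freqSeq T j ^ c /
          freqSeq T j ^ (2 * (c + 4 + 2 * k))) := by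
          rw [← pow_mul]
          ring
      _ ≤ bernC n k * C * (A + 1) * K * δ * (1 / freqSeq T j) := by
          refine mul_le_mul_of_nonneg_left ?_ (mul_nonneg (by positivity) hδ.1.le)
          rw [div_le_div_iff₀ (by positivity) hF0, one_mul]
          exact h3
      _ ≤ _ := mul_le_mul_of_nonneg_left (hF j) (mul_nonneg (by positivity) hδ.1.le)

lemma tendsto_elErr {L : E n × E n → ℝ} (hL : ContDiff ℝ ∞ L) (δ : ℝ) (Ω : E n)
    {v : ℕ → E n → E n} {u : E n → E n} (hv : ∀ x, Tendsto (fun j => v j x) atTop (nhds (u x)))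
    (x : E n) : Tendsto (fun j => elErr L δ Ω (v j) x) atTop (nhds (elErr L δ Ω u x)) := by
  have hz : ∀ x, Tendsto (fun j => zmap δ Ω (v j) x) atTop (nhds (zmap δ Ω u x)) := fun x =>
    (tendsto_const_nhds.add (hv x)).prodMk_nhds
      (tendsto_const_nhds.add (((hv _).sub (hv x)).const_smul _))
  have hf : ∀ x, Tendsto (fun j => fderiv ℝ L (zmap δ Ω (v j) x)) atTop
      (nhds (fderiv ℝ L (zmap δ Ω u x))) := fun x =>
    ((hL.continuous_fderiv (by simp)).tendsto _).comp (hz x)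
  have hi : ∀ (g : E n →L[ℝ] E n × E n) x,
      Tendsto (fun j => (fderiv ℝ L (zmap δ Ω (v j) x)).comp g) atTop
        (nhds ((fderiv ℝ L (zmap δ Ω u x)).comp g)) := fun g x =>
    ((ContinuousLinearMap.compL ℝ (E n) (E n × E n) ℝ).flip g).continuous.tendsto _ |>.comp (hf x)
  exact (hi _ _).sub (((hi _ _).sub (hi _ _)).const_smul _)

lemma LagFamily.exists_invariant_torus (h : LagFamily Bf r δ₀) (hδ₀ : 0 < δ₀) (hδ₀1 : δ₀ ≤ 1)
    (hΛ : 0 ≤ Λ) : ∃ δ₁ : ℝ, 0 < δ₁ ∧ δ₁ ≤ δ₀ ∧ ∃ C : ℕ → ℝ, ∀ δ ∈ Set.Ioc 0 δ₁,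
      SmallDivisor δ Ω Λ p → ∃ u : E n → E n, ContDiff ℝ ∞ u ∧ IsPer u ∧
        (∀ k x, ‖iteratedFDeriv ℝ k u x‖ ≤ C k * δ) ∧
        ∀ x, elErr (lagr Bf r δ) δ Ω u x = 0 := by
  obtain ⟨δ₁, T, hδ₁, hδ₁₀, hsm, ⟨A, hA⟩, hinc⟩ :=
    h.exists_torusSeq_rapid (Ω := Ω) (p := p) hδ₀ hδ₀1 hΛ
  choose D hD hDs using hinc
  refine ⟨δ₁, hδ₁, hδ₁₀, fun k => D k * 2, fun δ hδ hs => ?_⟩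
  set w : ℕ → E n → E n := fun j => newtonIncr Bf (lagr Bf r δ) δ Ω (freqSeq T j)
    (torusSeq Bf (lagr Bf r δ) δ Ω T j) with hw
  have hsum : ∀ k, Summable fun j : ℕ => D k * δ * (1 / 2 : ℝ) ^ j := fun k =>
    (summable_geometric_two).mul_left _
  have hb : ∀ (k j : ℕ) x, ‖iteratedFDeriv ℝ k (w j) x‖ ≤ D k * δ * (1 / 2) ^ j :=
    fun k j x => hDs k δ hδ hs j x
  have hb0 : ∀ (j : ℕ) x, ‖w j x‖ ≤ D 0 * δ * (1 / 2) ^ j := fun j x => by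
    simpa using hb 0 j x
  have hwsum : ∀ x, Summable fun j => w j x := fun x =>
    Summable.of_norm_bounded (hsum 0) fun j => hb0 j x
  refine ⟨fun x => ∑' j, w j x, ?_, fun x l => ?_, fun k x => ?_, fun x => ?_⟩
  · exact contDiff_tsum (N := (⊤ : ℕ∞)) (fun j => (hsm δ hδ hs j).1) (fun k _ => hsum k)
      fun k j x _ => hb k j x
  · exact tsum_congr fun j => (hsm δ hδ hs j).2 x l
  · rw [iteratedFDeriv_tsum_apply (N := (⊤ : ℕ∞)) (fun j => (hsm δ hδ hs j).1) (fun k _ => hsum k)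
      (fun k j x _ => hb k j x) le_top]
    refine (tsum_of_norm_bounded (hsum k).hasSum fun j => hb k j x).trans ?_
    rw [tsum_mul_left, tsum_geometric_two]
    linarith
  · have h1 : ∀ x, Tendsto (fun j => torusSeq Bf (lagr Bf r δ) δ Ω T j x) atTop
        (nhds (∑' j, w j x)) := fun x => by
      simp only [torusSeq_eq_sum]
      exact (hwsum x).hasSum.tendsto_sum_nat
    have h2 := (tendsto_elErr (h.contDiff_lagr δ) δ Ω h1 x).norm
    have h3 : Tendsto (fun j : ℕ => A * (1 / 2 : ℝ) ^ j) atTop (nhds (A * 0)) :=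
      (tendsto_pow_atTop_nhds_zero_of_lt_one (by norm_num) (by norm_num)).const_mul A
    rw [mul_zero] at h3
    have h4 := le_of_tendsto_of_tendsto' h2 h3 fun j => hA δ hδ hs j x
    exact norm_le_zero_iff.1 h4

end NashMoserIteration

section InvariantTori

open scoped ContDiff

variable {n : ℕ}

/-- The identification of `E n` with its dual given by the euclidean pairing. -/
def dualEquiv (n : ℕ) : E n ≃L[ℝ] (E n →L[ℝ] ℝ) :=
  ({ (dotL n : E n →ₗ[ℝ] E n →L[ℝ] ℝ) with
    invFun := fun f i => f (Pi.single i 1)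
    left_inv := fun a => dotP_ext fun v => by
      rw [dotP_apply_single]
      exact dotL_apply a v
    right_inv := fun f => by
      ext1 v
      exact (dotL_apply _ v).trans (dotP_apply_single f v) } :
    E n ≃ₗ[ℝ] (E n →L[ℝ] ℝ)).toContinuousLinearEquiv

lemma dualEquiv_apply (a b : E n) : dualEquiv n a b = dotP n a b := dotL_apply a b

lemma dotP_dualEquiv_symm (f : E n →L[ℝ] ℝ) (v : E n) : dotP n ((dualEquiv n).symm f) v = f v :=
  dotP_apply_single f v

lemma gradP_eq_dualEquiv_symm {L : E n × E n → ℝ} (hL : ContDiff ℝ ∞ L) (z : E n × E n) :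
    gradP n L z.1 z.2 =
      (dualEquiv n).symm ((fderiv ℝ L z).comp (ContinuousLinearMap.inr ℝ (E n) (E n))) :=
  dotP_ext fun v => by
    rw [dotP_gradP (hL.differentiable (by simp)), dotP_dualEquiv_symm]
    simp

lemma gradX_eq_dualEquiv_symm {L : E n × E n → ℝ} (hL : ContDiff ℝ ∞ L) (z : E n × E n) :
    gradX n L z.1 z.2 =
      (dualEquiv n).symm ((fderiv ℝ L z).comp (ContinuousLinearMap.inl ℝ (E n) (E n))) :=
  dotP_ext fun v => by
    rw [dotP_gradX (hL.differentiable (by simp)), dotP_dualEquiv_symm]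
    simp

/-- The momentum of the torus `x ↦ x + u x`. -/
def torusMom (L : E n × E n → ℝ) (δ : ℝ) (Ω : E n) (u : E n → E n) (x : E n) : E n :=
  δ • gradP n L (zmap δ Ω u x).1 (zmap δ Ω u x).2 -
    δ ^ 2 • gradX n L (zmap δ Ω u x).1 (zmap δ Ω u x).2

variable {L : E n × E n → ℝ} {δ Λ : ℝ} {Ω : E n} {p : ℕ} {u : E n → E n}

lemma contDiff_torusMom (hL : ContDiff ℝ ∞ L) (hu : ContDiff ℝ ∞ u) :
    ContDiff ℝ ∞ (torusMom L δ Ω u) :=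
  (((contDiff_gradP hL).comp (contDiff_zmap hu)).const_smul δ).sub
    (((contDiff_gradX hL).comp (contDiff_zmap hu)).const_smul (δ ^ 2))

lemma torusMom_add (hδ : δ ≠ 0) (hL : ContDiff ℝ ∞ L) (x : E n) (he : elErr L δ Ω u x = 0) :
    torusMom L δ Ω u (x + δ • Ω) = δ • gradP n L (zmap δ Ω u x).1 (zmap δ Ω u x).2 := by
  have h1 := congrArg (dualEquiv n).symm he
  simp only [elErr, dd, map_sub, map_smul, map_zero, ← gradP_eq_dualEquiv_symm hL,
    ← gradX_eq_dualEquiv_symm hL] at h1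
  rw [sub_eq_zero] at h1
  rw [torusMom, h1, smul_smul, pow_two, mul_assoc, mul_inv_cancel₀ hδ, mul_one, smul_sub]
  abel

lemma conj_of_elErr_eq_zero {f : E n × E n → E n × E n} (hδ : δ ≠ 0) (hL : ContDiff ℝ ∞ L)
    (x : E n) (he : elErr L δ Ω u x = 0)
    (hf : f ((zmap δ Ω u x).1, torusMom L δ Ω u x) = ((zmap δ Ω u x).1 + δ • (zmap δ Ω u x).2,
      δ • gradP n L (zmap δ Ω u x).1 (zmap δ Ω u x).2)) :
    f (x + u x, torusMom L δ Ω u x) =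
      (x + δ • Ω + u (x + δ • Ω), torusMom L δ Ω u (x + δ • Ω)) := by
  rw [torusMom_add hδ hL x he]
  refine hf.trans (Prod.ext ?_ rfl)
  simp only [zmap, dd, smul_add, smul_smul, mul_inv_cancel₀ hδ, one_smul]
  abel

set_option maxSynthPendingDepth 5 in
lemma lagForm_eq_zero (hδ : δ ≠ 0) (hL : ContDiff ℝ ∞ L) (hu : ContDiff ℝ ∞ u) (hp : IsPer u)
    (hLper : ∀ (x y : E n) (l : Fin n → ℤ), L (x + intVec l, y) = L (x, y))
    (hs : SmallDivisor δ Ω Λ p) (he : ∀ x, elErr L δ Ω u x = 0) (x : E n) :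
    lagForm L δ Ω u x = 0 := by
  have h1 : dd δ Ω (lagForm L δ Ω u) = fun _ => 0 := by
    funext x
    ext a b
    rw [dd_lagForm hδ hL hu, show elErr L δ Ω u = fun _ => 0 from funext he]
    simp
  have h2 := ddInv_dd hs (isPer_lagForm (δ := δ) (Ω := Ω) hLper hp) (contDiff_lagForm hL hu) x
  have h3 := ddInv_dd hs (f := fun _ : E n => (0 : E n →L[ℝ] E n →L[ℝ] ℝ)) (fun _ _ => rfl)
    contDiff_const x
  have h4 : dd δ Ω (fun _ : E n => (0 : E n →L[ℝ] E n →L[ℝ] ℝ)) = fun _ => 0 := by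
    funext x
    simp [dd]
  rw [torusMean_lagForm hLper hL hu hp, h1] at h2
  rw [torusMean_const, h4] at h3
  exact (h2.trans (sub_zero _)).symm.trans (h3.trans (sub_zero _))

lemma hess_apply_eq_dotP (hL : ContDiff ℝ ∞ L) (hu : ContDiff ℝ ∞ u) (x a w : E n) :
    hess L δ Ω u x (zjac δ Ω u x a) (0, w) =
      dotP n (fderiv ℝ (fun y => gradP n L (zmap δ Ω u y).1 (zmap δ Ω u y).2) x a) w := by
  have h1 : HasFDerivAt (fderiv ℝ L) (hess L δ Ω u x) (zmap δ Ω u x) := by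
    have : ContDiff ℝ ∞ (fderiv ℝ L) := hL.fderiv_right (by simp)
    exact (this.differentiable (by simp) _).hasFDerivAt
  have h2 := h1.comp x (hasFDerivAt_zmap (δ := δ) (Ω := Ω) hu x)
  have h3 := ((ContinuousLinearMap.compL ℝ (E n) (E n × E n) ℝ).flip
    (ContinuousLinearMap.inr ℝ (E n) (E n))).hasFDerivAt.comp x h2
  have h4 := ((dualEquiv n).symm : (E n →L[ℝ] ℝ) →L[ℝ] E n).hasFDerivAt.comp x h3
  have h5 : HasFDerivAt (fun y => gradP n L (zmap δ Ω u y).1 (zmap δ Ω u y).2) _ x :=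
    h4.congr_of_eventuallyEq (Eventually.of_forall fun y => gradP_eq_dualEquiv_symm hL _)
  rw [h5.fderiv]
  refine Eq.trans ?_ (dotP_dualEquiv_symm _ w).symm
  simp

lemma omega0_fderiv_torus (hδ : δ ≠ 0) (hL : ContDiff ℝ ∞ L) (hu : ContDiff ℝ ∞ u)
    (hp : IsPer u) (hLper : ∀ (x y : E n) (l : Fin n → ℤ), L (x + intVec l, y) = L (x, y))
    (hs : SmallDivisor δ Ω Λ p) (he : ∀ x, elErr L δ Ω u x = 0) (x a b : E n) :
    omega0 n (fderiv ℝ (fun y => (y + u y, torusMom L δ Ω u y)) x a)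
      (fderiv ℝ (fun y => (y + u y, torusMom L δ Ω u y)) x b) = 0 := by
  obtain ⟨x, rfl⟩ : ∃ y, x = y + δ • Ω := ⟨x - δ • Ω, by simp⟩
  have h1 : HasFDerivAt (fun y => y + u y) (jac u (x + δ • Ω)) (x + δ • Ω) :=
    (hasFDerivAt_id _).add (hu.differentiable (by simp) _).hasFDerivAt
  have h2 : HasFDerivAt (torusMom L δ Ω u) (fderiv ℝ (torusMom L δ Ω u) (x + δ • Ω)) (x + δ • Ω) :=
    ((contDiff_torusMom hL hu).differentiable (by simp) _).hasFDerivAt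
  have h3 : fderiv ℝ (torusMom L δ Ω u) (x + δ • Ω) =
      δ • fderiv ℝ (fun y => gradP n L (zmap δ Ω u y).1 (zmap δ Ω u y).2) x := by
    have h4 := h2.comp_shift
    rw [show (fun y => torusMom L δ Ω u (y + δ • Ω)) =
      fun y => δ • gradP n L (zmap δ Ω u y).1 (zmap δ Ω u y).2 from
        funext fun y => torusMom_add hδ hL y (he y)] at h4
    have h5 : HasFDerivAt (fun y => gradP n L (zmap δ Ω u y).1 (zmap δ Ω u y).2) _ x :=
      ((((contDiff_gradP hL).comp (contDiff_zmap hu)).differentiable (by simp)) x).hasFDerivAt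
    exact h4.unique (h5.const_smul δ)
  have h6 := congrArg (fun T => T a b) (lagForm_eq_zero hδ hL hu hp hLper hs he x)
  simp only [lagForm_apply, hess_apply_eq_dotP hL hu] at h6
  rw [(h1.prodMk h2).fderiv, h3]
  simp only [omega0, ContinuousLinearMap.prod_apply, smul_apply]
  rw [dotP_comm (jac u (x + δ • Ω) a)]
  simp only [← dotL_apply, map_smul, smul_apply, smul_eq_mul] at h6 ⊢
  rw [← mul_sub, h6]
  simp

lemma iterate_conj {X : Type*} [NormedAddCommGroup X] [NormedSpace ℝ X] {f : X → X}
    (hf : ContDiff ℝ 1 f) {Φ : ℝ → X → X} (h : IsFlowOf f Φ) {T : ℝ} (hT : 0 ≤ T) {j : E n → X}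
    {h₀ : E n} (hj : ∀ x, Φ T (j x) = j (x + h₀)) (m : ℕ) (x : E n) :
    Φ (m * T) (j x) = j (x + (m : ℝ) • h₀) := by
  induction m with
  | zero => simp [h.1]
  | succ m ih =>
    have h1 : ((m + 1 : ℕ) : ℝ) * T = T + m * T := by
      push_cast
      ring
    rw [h1, h.add hf _ hT, ih, hj]
    congr 1
    push_cast
    rw [add_smul, one_smul, add_assoc]

end InvariantTori

section UniformEstimates

open scoped ContDiff

variable {n : ℕ} {Bf : E n ≃L[ℝ] (E n →L[ℝ] ℝ)} {r : ℝ → E n × E n → ℝ} {δ₀ : ℝ} {Ω : E n} {Λ : ℝ}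
  {p : ℕ}

/-- The deviation of the momentum of a torus from the momentum of the linear torus. -/
def momDev (Bf : E n ≃L[ℝ] (E n →L[ℝ] ℝ)) (r : ℝ → E n × E n → ℝ) (δ : ℝ) (Ω : E n)
    (u : E n → E n) (x : E n) : E n :=
  (dualEquiv n).symm (Bf (dd δ Ω u x) +
    (δ • (fderiv ℝ (r δ) (zmap δ Ω u x)).comp (ContinuousLinearMap.inr ℝ (E n) (E n)) -
      δ ^ 2 • (fderiv ℝ (r δ) (zmap δ Ω u x)).comp (ContinuousLinearMap.inl ℝ (E n) (E n))))

lemma LagFamily.torusMom_eq (h : LagFamily Bf r δ₀) (δ : ℝ) (u : E n → E n) (x : E n) :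
    torusMom (lagr Bf r δ) δ Ω u x =
      (dualEquiv n).symm (Bf (δ • Ω)) + δ • momDev Bf r δ Ω u x := by
  refine dotP_ext fun v => ?_
  rw [torusMom, gradP_eq_dualEquiv_symm (h.contDiff_lagr δ),
    gradX_eq_dualEquiv_symm (h.contDiff_lagr δ), momDev, ← map_smul, ← map_smul, ← map_smul,
    ← map_sub, ← map_add, dotP_dualEquiv_symm, dotP_dualEquiv_symm, h.fderiv_lagr]
  simp [kin_apply, zmap]
  ring

lemma TorusFamily.tame_momDev {ι : Type*} {δ κ N : ι → ℝ} {u : ι → E n → E n}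
    (h : TorusFamily Bf r δ₀ Ω Λ p δ κ N u) :
    Tame 0 (fun _ => κ) N fun i => momDev Bf r (δ i) Ω (u i) := by
  have h1 : Tame 0 (fun _ => κ) N fun i x => δ i • fderiv ℝ (r (δ i)) (zmap (δ i) Ω (u i) x) :=
    (h.tame_fderiv_pert.smul_param δ).mono (a := fun _ => 1) (fun _ i => by
      rw [abs_of_pos (h.delta_pos i)]
      simpa using h.delta_le i) (fun _ i => h.kappa_nonneg i)
      (fun _ => le_rfl) le_rfl
  have h2 : Tame 0 (fun _ => κ) N
      fun i x => δ i • δ i • fderiv ℝ (r (δ i)) (zmap (δ i) Ω (u i) x) :=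
    (h1.smul_param δ).mono (a := fun _ => 1) (fun _ i => by
      rw [abs_of_pos (h.delta_pos i), one_mul]
      exact mul_le_of_le_one_left (h.kappa_nonneg i) ((h.delta_le i).trans (h.kappa_le i)))
      (fun _ i => h.kappa_nonneg i) (fun _ => le_rfl) le_rfl
  have h3 := h1.clm ((ContinuousLinearMap.compL ℝ (E n) (E n × E n) ℝ).flip
    (ContinuousLinearMap.inr ℝ (E n) (E n)))
  have h4 := h2.clm ((ContinuousLinearMap.compL ℝ (E n) (E n × E n) ℝ).flip
    (ContinuousLinearMap.inl ℝ (E n) (E n)))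
  have h5 := h.tame_dd.clm (Bf : E n →L[ℝ] (E n →L[ℝ] ℝ))
  refine ((h5.add_self (h3.sub_self h4)).clm
    ((dualEquiv n).symm : (E n →L[ℝ] ℝ) →L[ℝ] E n)).congr fun i x => ?_
  simp [momDev, pow_two, mul_smul]

lemma isPer_zmap {δ : ℝ} {u : E n → E n} (hu : IsPer u) (x : E n) (l : Fin n → ℤ) :
    zmap δ Ω u (x + intVec l) = zmap δ Ω u x + (intVec l, 0) := by
  refine Prod.ext ?_ ?_
  · simp only [zmap, hu x l, Prod.fst_add]
    abel
  · simp only [zmap, hu.dd δ Ω x l, Prod.snd_add, add_zero]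

lemma LagFamily.isPer_momDev (h : LagFamily Bf r δ₀) {δ : ℝ} (hδ : δ ∈ Set.Ioc 0 δ₀)
    {u : E n → E n} (hu : IsPer u) : IsPer (momDev Bf r δ Ω u) := fun x l => by
  have h1 : ∀ z, fderiv ℝ (r δ) (z + (intVec l, 0)) = fderiv ℝ (r δ) z := by
    intro z
    rw [← fderiv_comp_add_right]
    congr 1
    funext w
    exact hper_pair (h.per δ hδ) w l
  simp only [momDev, isPer_zmap hu, h1, hu.dd δ Ω x l]

lemma LagFamily.exists_uniform_torus (h : LagFamily Bf r δ₀) (hδ₀ : 0 < δ₀) (hδ₀1 : δ₀ ≤ 1)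
    (hΛ : 0 ≤ Λ) : ∃ δ₁ : ℝ, 0 < δ₁ ∧ δ₁ ≤ δ₀ ∧ ∃ C D : ℕ → ℝ, ∀ δ ∈ Set.Ioc 0 δ₁,
      SmallDivisor δ Ω Λ p → ∃ u : E n → E n, ContDiff ℝ ∞ u ∧ IsPer u ∧
        (∀ k x, ‖iteratedFDeriv ℝ k u x‖ ≤ C k * δ) ∧
        (∀ x, elErr (lagr Bf r δ) δ Ω u x = 0) ∧ (∀ x, ‖dd δ Ω u x‖ ≤ ‖Ω‖) ∧
        ContDiff ℝ ∞ (momDev Bf r δ Ω u) ∧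
        ∀ k x, ‖iteratedFDeriv ℝ k (momDev Bf r δ Ω u) x‖ ≤ D k * δ := by
  obtain ⟨δ₁, hδ₁, hδ₁₀, C, hC⟩ := h.exists_invariant_torus (Ω := Ω) (p := p) hδ₀ hδ₀1 hΛ
  obtain ⟨η, hη, hη4, hb⟩ := h.exists_twist_bound hδ₀1
  let J : Type := {δ : ℝ // δ ∈ Set.Ioc 0 (min δ₁ (min η (η / (|C 1| + 1)))) ∧ SmallDivisor δ Ω Λ p}
  have hJ1 : ∀ i : J, i.1 ∈ Set.Ioc 0 δ₁ := fun i => ⟨i.2.1.1, i.2.1.2.trans (min_le_left _ _)⟩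
  choose! u hu using hC
  have hJ0 : ∀ i : J, i.1 ∈ Set.Ioc 0 δ₀ := fun i => ⟨i.2.1.1, (hJ1 i).2.trans hδ₁₀⟩
  have hd : ∀ (i : J) x, ‖fderiv ℝ (u i.1) x‖ ≤ η := fun i x => by
    have h1 := (hu i.1 (hJ1 i) i.2.2).2.2.1 1 x
    rw [← norm_iteratedFDeriv_fderiv, norm_iteratedFDeriv_zero] at h1
    have h2 : i.1 ≤ η / (|C 1| + 1) := i.2.1.2.trans ((min_le_right _ _).trans (min_le_right _ _))
    rw [le_div_iff₀ (by positivity)] at h2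
    have h3 := i.2.1.1
    nlinarith [le_abs_self (C 1)]
  have hfam : TorusFamily Bf r δ₀ Ω Λ p (fun i : J => i.1) (fun i => i.1) (fun _ => 1)
      fun i => u i.1 :=
    { lag := h
      delta_mem := hJ0
      delta_le := fun _ => le_rfl
      kappa_le := fun i => (hJ0 i).2.trans hδ₀1
      one_le := fun _ => le_rfl
      small_divisor := fun i => i.2.2
      nonneg := hΛ
      smooth := fun i => (hu i.1 (hJ1 i) i.2.2).1
      per := fun i => (hu i.1 (hJ1 i) i.2.2).2.1
      bound := fun k => ⟨|C k|, abs_nonneg _, fun i x => by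
        rw [one_pow, mul_one]
        exact ((hu i.1 (hJ1 i) i.2.2).2.2.1 k x).trans
          (mul_le_mul_of_nonneg_right (le_abs_self _) i.2.1.1.le)⟩
      fderiv_le := fun i x => (hd i x).trans hη4
      twist_le := fun i x => hb i.1 (hJ0 i)
        (i.2.1.2.trans ((min_le_right _ _).trans (min_le_left _ _))) Ω _ (hd i) x }
  choose D hD hDs using hfam.tame_momDev.bound 0
  refine ⟨min δ₁ (min η (η / (|C 1| + 1))), by positivity, (min_le_left _ _).trans hδ₁₀, C, D,
    fun δ hδ hs => ⟨u δ, ?_⟩⟩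
  have hδ' : δ ∈ Set.Ioc 0 δ₁ := ⟨hδ.1, hδ.2.trans (min_le_left _ _)⟩
  obtain ⟨h1, h2, h3, h4⟩ := hu δ hδ' hs
  refine ⟨h1, h2, h3, h4, fun x => ?_, hfam.tame_momDev.smooth ⟨δ, hδ, hs⟩, fun k x => ?_⟩
  · have h5 : ∀ x, ‖iteratedFDeriv ℝ (0 + 1) (u δ) x‖ ≤ 1 := fun x => by
      rw [← norm_iteratedFDeriv_fderiv, norm_iteratedFDeriv_zero]
      exact (hd ⟨δ, hδ, hs⟩ x).trans (by linarith)
    have h6 := norm_iteratedFDeriv_dd_le hδ.1 Ω h1 h5 x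
    rwa [norm_iteratedFDeriv_zero, one_mul] at h6
  · simpa using hDs k ⟨δ, hδ, hs⟩ x

lemma CkNorm_nonneg (k : ℕ) (f : E n → E n) : 0 ≤ CkNorm n k f :=
  Real.iSup_nonneg fun _ => norm_nonneg _

lemma CkNorm_le {k : ℕ} {f : E n → E n} {C : ℕ → ℝ}
    (hC : ∀ j x, ‖iteratedFDeriv ℝ j f x‖ ≤ C j) :
    CkNorm n k f ≤ ∑ j ∈ Finset.range (k + 1), C j := by
  refine ciSup_le fun q => (hC q.2 q.1).trans ?_
  exact Finset.single_le_sum (f := C) (fun j _ => (norm_nonneg _).trans (hC j 0))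
    (Finset.mem_range.2 q.2.2)

lemma tendsto_CkNorm {f : ℕ → E n → E n} {C : ℕ → ℝ} {m₁ : ℕ}
    (hC : ∀ m, m₁ ≤ m → ∀ k x, ‖iteratedFDeriv ℝ k (f m) x‖ ≤ C k * (1 / (m : ℝ))) (k : ℕ) :
    Tendsto (fun m => CkNorm n k (f m)) atTop (nhds 0) := by
  have h1 : Tendsto (fun m : ℕ => (∑ j ∈ Finset.range (k + 1), C j) * (1 / (m : ℝ))) atTop
      (nhds ((∑ j ∈ Finset.range (k + 1), C j) * 0)) :=
    tendsto_one_div_atTop_nhds_zero_nat.const_mul _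
  rw [mul_zero] at h1
  refine squeeze_zero' (Eventually.of_forall fun m => CkNorm_nonneg k _) ?_ h1
  filter_upwards [eventually_ge_atTop m₁] with m hm
  rw [Finset.sum_mul]
  exact CkNorm_le (hC m hm)

lemma CkNorm_smul (k : ℕ) {f : E n → E n} (hf : ContDiff ℝ ∞ f) {c : ℝ} (hc : 0 ≤ c) :
    CkNorm n k (c • f) = c * CkNorm n k f := by
  rw [CkNorm, CkNorm, Real.mul_iSup_of_nonneg hc]
  congr 1
  funext q
  rw [iteratedFDeriv_const_smul_apply (hf.contDiffAt.of_le (by exact_mod_cast le_top)), norm_smul,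
    Real.norm_of_nonneg hc]

end UniformEstimates

section InvariantTori

open scoped ContDiff

variable {n : ℕ}

/-- The kinetic form dual to the twist `A`. -/
def twistForm (A : Matrix (Fin n) (Fin n) ℝ) (hA : IsUnit A.det) : E n ≃L[ℝ] (E n →L[ℝ] ℝ) :=
  (matEquiv A hA).symm.trans (dualEquiv n)

lemma twistForm_apply (A : Matrix (Fin n) (Fin n) ℝ) (hA : IsUnit A.det) (a b : E n) :
    twistForm A hA a b = dotP n ((matEquiv A hA).symm a) b := dualEquiv_apply _ _

lemma scaledLag_eq_lagr (A : Matrix (Fin n) (Fin n) ℝ) (hA : IsUnit A.det)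
    (r : ℝ → E n × E n → ℝ) (δ : ℝ) :
    scaledLag ((matEquiv A hA).symm : E n →L[ℝ] E n) (r δ) δ = lagr (twistForm A hA) r δ := by
  funext z
  rw [scaledLag, lagr, kin_apply, twistForm_apply]
  rfl

lemma IsHamFlow.exists_lagFamily (hn : 1 ≤ n) {H : E n × E n → ℝ} (hH : ContDiff ℝ ∞ H)
    (hHper : ∀ (x p : E n) (m : Fin n → ℤ), H (x + intVec m, p) = H (x, p))
    {φ : ℝ → E n × E n → E n × E n} (hφ : IsHamFlow n H φ) {T : ℝ} (hT : 0 ≤ T)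
    {A : Matrix (Fin n) (Fin n) ℝ} (hAs : A.IsSymm) (hA : IsUnit A.det)
    {R₁ R₂ : E n × E n → E n} {ε : ℝ} (hε : 0 < ε)
    (hnf : ∀ θ I : E n, ‖I‖ < ε →
      φ T (θ, I) = (θ + A.mulVec I + R₁ (θ, I), I + R₂ (θ, I)))
    (hR₁ : BigOI n 2 R₁) (hR₂ : BigOI n 3 R₂) {Rad : ℝ} (hRad : 0 ≤ Rad) :
    ∃ (δ₀ : ℝ) (r : ℝ → E n × E n → ℝ), 0 < δ₀ ∧ δ₀ ≤ 1 ∧ LagFamily (twistForm A hA) r δ₀ ∧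
      ∀ δ ∈ Set.Ioc 0 δ₀, ∀ x Y, ‖Y‖ ≤ Rad →
        φ T (x, δ • gradP n (lagr (twistForm A hA) r δ) x Y -
          δ ^ 2 • gradX n (lagr (twistForm A hA) r δ) x Y) =
          (x + δ • Y, δ • gradP n (lagr (twistForm A hA) r δ) x Y) := by
  obtain ⟨S, hS, hSper, hSd⟩ := hφ.exists_action hH hHper hT
  obtain ⟨ρ, C, L, P, Q, hρ, hL, hf, hLd, hLper, hLb⟩ := exists_generating_function hn
    (hφ.contDiff hH hT) (hφ.add_intVec hH hHper hT) hS hSper hSd hA hAs hε hnf hR₁ hR₂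
  obtain ⟨δ₀, r, hδ₀, hδ₀1, h1, h2, h3, h4⟩ := exists_scaled_lagrangian
    (B := ((matEquiv A hA).symm : E n →L[ℝ] E n)) hρ hL hf hLd hLper hLb hRad
  refine ⟨δ₀, r, hδ₀, hδ₀1, ⟨fun a b => ?_, h1, h2, h3⟩, fun δ hδ x Y hY => ?_⟩
  · rw [twistForm_apply, twistForm_apply, dotP_matEquiv_symm hA hAs]
  · rw [← scaledLag_eq_lagr]
    exact h4 δ hδ x Y hY

lemma exists_kam_tori (hn : 1 ≤ n) {H : E n × E n → ℝ} (hH : ContDiff ℝ ∞ H)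
    (hHper : ∀ (x p : E n) (m : Fin n → ℤ), H (x + intVec m, p) = H (x, p))
    {φ : ℝ → E n × E n → E n × E n} (hφ : IsHamFlow n H φ) {T : ℝ} (hT : 0 ≤ T)
    {A : Matrix (Fin n) (Fin n) ℝ} (hAs : A.IsSymm) (hA : IsUnit A.det)
    {R₁ R₂ : E n × E n → E n} {ε : ℝ} (hε : 0 < ε)
    (hnf : ∀ θ I : E n, ‖I‖ < ε →
      φ T (θ, I) = (θ + A.mulVec I + R₁ (θ, I), I + R₂ (θ, I)))
    (hR₁ : BigOI n 2 R₁) (hR₂ : BigOI n 3 R₂) {Ω : E n} (hΩ : StronglyDiophantine n Ω) :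
    ∃ (m₁ : ℕ) (u w : ℕ → E n → E n) (C D : ℕ → ℝ), 0 < m₁ ∧ ∀ m, m₁ ≤ m →
      ContDiff ℝ ∞ (u m) ∧ ContDiff ℝ ∞ (w m) ∧ IsPer (u m) ∧ IsPer (w m) ∧
      (∀ k x, ‖iteratedFDeriv ℝ k (u m) x‖ ≤ C k * (1 / (m : ℝ))) ∧
      (∀ k x, ‖iteratedFDeriv ℝ k (w m) x‖ ≤ D k * (1 / (m : ℝ))) ∧
      ∃ j : E n → E n × E n,
        (∀ x, j x = (x + u m x, A⁻¹.mulVec ((1 / (m : ℝ)) • Ω) + ((1 / (m : ℝ)) • w m) x)) ∧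
        (∀ x, φ (m * T) (j x) = j (x + Ω)) ∧
        ∀ x a b, omega0 n (fderiv ℝ j x a) (fderiv ℝ j x b) = 0 := by
  obtain ⟨δ₀, r, hδ₀, hδ₀1, hlag, hφT⟩ := hφ.exists_lagFamily hn hH hHper hT hAs hA hε hnf hR₁ hR₂
    (Rad := 2 * ‖Ω‖) (by positivity)
  obtain ⟨Λ, q, hΛ, hsd⟩ := exists_smallDivisor hΩ
  obtain ⟨δ₁, hδ₁, hδ₁₀, C, D, hmain⟩ :=
    hlag.exists_uniform_torus (Ω := Ω) (p := q) hδ₀ hδ₀1 hΛ.le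
  choose! u hu using hmain
  obtain ⟨m₁, hm₁⟩ := exists_nat_ge (1 / δ₁)
  refine ⟨m₁ + 1, fun m => u (1 / (m : ℝ)),
    fun m => momDev (twistForm A hA) r (1 / (m : ℝ)) Ω (u (1 / (m : ℝ))), C, D, m₁.succ_pos,
    fun m hm => ?_⟩
  have hm0 : 0 < m := by omega
  have hmR : (0 : ℝ) < m := by exact_mod_cast hm0
  have hmle : 1 / (m : ℝ) ≤ δ₁ := by
    rw [one_div_le hmR hδ₁]
    exact hm₁.trans (by exact_mod_cast (by omega : m₁ ≤ m))
  have hδ : (0 : ℝ) < 1 / (m : ℝ) := by positivity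
  have hδm : 1 / (m : ℝ) ∈ Set.Ioc 0 δ₀ := ⟨hδ, hmle.trans hδ₁₀⟩
  have hs := hsd m hm0
  obtain ⟨h1, h2, h3, h4, h5, h6, h7⟩ := hu _ ⟨hδ, hmle⟩ hs
  have hmδ : (m : ℝ) • (1 / (m : ℝ)) • Ω = Ω := by
    rw [smul_smul, mul_one_div_cancel hmR.ne', one_smul]
  beta_reduce
  generalize 1 / (m : ℝ) = δ at *
  have hL := hlag.contDiff_lagr δ
  refine ⟨h1, h6, h2, hlag.isPer_momDev hδm h2, h3, h7,
    fun x => (x + u δ x, torusMom (lagr (twistForm A hA) r δ) δ Ω (u δ) x), fun x => ?_,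
    fun x => ?_, fun x a b => omega0_fderiv_torus hδ.ne' hL h1 h2 (hlag.lagr_per hδm) hs h4 x a b⟩
  · beta_reduce
    rw [hlag.torusMom_eq]
    simp only [twistForm, ContinuousLinearEquiv.trans_apply,
      ContinuousLinearEquiv.symm_apply_apply, matEquiv_symm_apply, Pi.smul_apply]
  · have key := iterate_conj ((contDiff_hamVF hH).of_le (by exact_mod_cast le_top)) hφ.isFlowOf hT
      (j := fun x => (x + u δ x, torusMom (lagr (twistForm A hA) r δ) δ Ω (u δ) x))
      (h₀ := δ • Ω) (fun x => conj_of_elErr_eq_zero hδ.ne' hL x (h4 x)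
        (hφT δ hδm _ _ ((norm_add_le _ _).trans (by linarith [h5 x])))) m x
    rwa [hmδ] at key

end InvariantTori

/-- KAM step: if the time-`T` map of a smooth periodic Hamiltonian has
the normal form `(θ, I) ↦ (θ + Ā I + O(I²), I + O(I³))` near the zero section with `Ā`
symmetric invertible, and `ω̄ ≠ 0` is strongly Diophantine, then for all large `m` there
are Lagrangian embeddings `j_m (η) = (η + u_m η, Ā⁻¹(ω̄/m) + v_m η)` with
`‖u_m‖_{Cᵏ} = o(1)`, `‖v_m‖_{Cᵏ} = o(1/m)`, on which `φ^H_{mT}` acts as the translation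
by `ω̄`. -/
theorem kam_step (n : ℕ) (hn : 1 ≤ n)
    (H : E n × E n → ℝ) (hH : ContDiff ℝ (⊤ : ℕ∞) H)
    (hHper : ∀ (x p : E n) (m : Fin n → ℤ), H (x + intVec m, p) = H (x, p))
    (φ : ℝ → E n × E n → E n × E n) (hφ : IsHamFlow n H φ)
    (T : ℝ) (hT : 0 < T)
    (A : Matrix (Fin n) (Fin n) ℝ) (hAsymm : A.IsSymm) (hAinv : IsUnit A.det)
    (R₁ R₂ : E n × E n → E n)
    (hnf : ∃ ε : ℝ, 0 < ε ∧ ∀ θ I : E n, ‖I‖ < ε →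
      φ T (θ, I) = (θ + A.mulVec I + R₁ (θ, I), I + R₂ (θ, I)))
    (hR₁ : BigOI n 2 R₁) (hR₂ : BigOI n 3 R₂)
    (ω : E n) (hω : ω ≠ 0) (hdio : StronglyDiophantine n ω) :
    ∃ m₁ : ℕ, ∃ u v : ℕ → E n → E n,
      -- `‖u_m‖_{Cᵏ} = o(1)` and `‖v_m‖_{Cᵏ} = o(1/m)` as `m → ∞`, for every `k`
      (∀ k : ℕ, Tendsto (fun m : ℕ => CkNorm n k (u m)) atTop (nhds 0)) ∧
      (∀ k : ℕ, Tendsto (fun m : ℕ => (m : ℝ) * CkNorm n k (v m)) atTop (nhds 0)) ∧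
      ∀ m : ℕ, m₁ ≤ m →
        ContDiff ℝ (⊤ : ℕ∞) (u m) ∧ ContDiff ℝ (⊤ : ℕ∞) (v m) ∧
        (∀ (η : E n) (l : Fin n → ℤ),
          u m (η + intVec l) = u m η ∧ v m (η + intVec l) = v m η) ∧
        ∃ jm : E n → E n × E n,
          (∀ η : E n, jm η = (η + u m η, A⁻¹.mulVec ((1 / (m : ℝ)) • ω) + v m η)) ∧
          -- (i) `φ^H_{mT} (j_m η) = j_m (η + ω̄)` modulo `ℤⁿ`-translations
          (∀ η : E n, ∃ l : Fin n → ℤ,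
            φ ((m : ℝ) * T) (jm η) = ((jm (η + ω)).1 + intVec l, (jm (η + ω)).2)) ∧
          -- (ii) `j_m` induces a Lagrangian embedding of `𝕋ⁿ`
          (∀ (η : E n) (a b : E n),
            omega0 n (fderiv ℝ jm η a) (fderiv ℝ jm η b) = 0) := by
  obtain ⟨ε, hε, hnf⟩ := hnf
  obtain ⟨m₁, u, w, C, D, hm₁, h⟩ := exists_kam_tori hn hH hHper hφ hT.le hAsymm hAinv hε hnf
    hR₁ hR₂ hdio
  refine ⟨m₁, u, fun m => (1 / (m : ℝ)) • w m, tendsto_CkNorm fun m hm => (h m hm).2.2.2.2.1,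
    fun k => ?_, fun m hm => ?_⟩
  · refine (tendsto_CkNorm (fun m hm => (h m hm).2.2.2.2.2.1) k).congr' ?_
    filter_upwards [eventually_ge_atTop m₁] with m hm
    have hm0 : (m : ℝ) ≠ 0 := by exact_mod_cast (hm₁.trans_le hm).ne'
    rw [CkNorm_smul k (h m hm).2.1 (by positivity), ← mul_assoc, mul_one_div_cancel hm0, one_mul]
  · obtain ⟨h1, h2, h3, h4, -, -, j, hj, hconj, hlag⟩ := h m hm
    refine ⟨h1, contDiff_const.smul h2, fun η l => ⟨h3 η l, ?_⟩, j, hj, fun η => ⟨0, ?_⟩, hlag⟩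
    · simp only [Pi.smul_apply, h4 η l]
    · have h0 : (intVec (0 : Fin n → ℤ) : E n) = 0 := by
        funext i
        simp [intVec]
      rw [hconj, h0, add_zero]

end
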